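/- arXiv:2401.11477 — 2 statements merged into one kernel-verified Lean document; each statement's English description precedes it below -/
import Mathlib

section
/- Let Σ = (x̃,ρ,B̃) be an acyclic and coprime generalized seed of a generalized cluster algebra of geometric type, ordered so that b_{ij} ≥ 0 whenever n ≥ i > j ≥ 1. Then the generalized cluster algebra equals the lower bound generalized cluster algebra: 𝒜(x̃,ρ,B̃) = ℒ^{(n)}(Σ) = ℤℙ[x_1, x_1^{(n)}, …, x_n, x_n^{(n)}]. -/
open Finset

namespace GCA

/-- Ambient field: the field of rational functions `ℚ(x₁,…,x_m)`. -/
abbrev K (m : ℕ) : Type := FractionRing (MvPolynomial (Fin m) ℚ)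

/-- The variables `x₁,…,x_m` inside the ambient field. -/
noncomputable def xv (m : ℕ) (j : Fin m) : K m :=
  algebraMap (MvPolynomial (Fin m) ℚ) (K m) (MvPolynomial.X j)

/-- The coefficient ring `ℤℙ`: the Laurent polynomial ring generated over `ℤ`
by the frozen variables `x_{n+1},…,x_m` and their inverses, as a subalgebra of `K m`. -/
noncomputable def ZP (m n : ℕ) : Subalgebra ℤ (K m) :=
  Algebra.adjoin ℤ {y | ∃ j : Fin m, n ≤ (j : ℕ) ∧ (y = xv m j ∨ y = (xv m j)⁻¹)}

/-- A (generalized) seed datum: the extended cluster, strings, and the exchange matrix. -/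
structure Seed (m n : ℕ) where
  x : Fin m → K m
  ρ : Fin n → ℕ → K m
  B : Matrix (Fin m) (Fin n) ℤ

variable {m n : ℕ}

/-- The exponent `⌊[rβ]₊⌋ + ⌊[−(d−r)β]₊⌋` where `β = b/d`. -/
def mutExp (d : ℕ) (b : ℤ) (r : ℕ) : ℤ :=
  ⌊max ((r : ℚ) * b / d) 0⌋ + ⌊max (-(((d : ℚ) - r) * b / d)) 0⌋

/-- Matrix mutation in direction `i` of an `m × n` exchange matrix. -/
def matMut (hmn : n ≤ m) (i : Fin n) (B : Matrix (Fin m) (Fin n) ℤ) :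
    Matrix (Fin m) (Fin n) ℤ := fun k l =>
  if k = Fin.castLE hmn i ∨ l = i then -B k l
  else B k l + (|B k i| * B (Fin.castLE hmn i) l + B k i * |B (Fin.castLE hmn i) l|) / 2

/-- The exchanged cluster variable `x'_i` of a seed. -/
noncomputable def exchangeVar (hmn : n ≤ m) (d : Fin n → ℕ) (S : Seed m n) (i : Fin n) :
    K m :=
  (S.x (Fin.castLE hmn i))⁻¹ *
    ∑ r ∈ Finset.range (d i + 1),
      S.ρ i r * ∏ k : Fin m, S.x k ^ mutExp (d i) (S.B k i) r

/-- Seed mutation in direction `i`. -/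
noncomputable def Seed.mut (hmn : n ≤ m) (d : Fin n → ℕ) (i : Fin n) (S : Seed m n) :
    Seed m n where
  x := fun j => if j = Fin.castLE hmn i then exchangeVar hmn d S i else S.x j
  ρ := fun j r => if j = i then S.ρ i (d i - r) else S.ρ j r
  B := matMut hmn i S.B

/-- Apply a finite sequence of mutations (left-most applied first). -/
noncomputable def mutSeq (hmn : n ≤ m) (d : Fin n → ℕ) : List (Fin n) → Seed m n → Seed m n
  | [], S => S
  | i :: l, S => mutSeq hmn d l (Seed.mut hmn d i S)

/-- `seedUpTo hmn d S k = μ_k ⋯ μ_2 μ_1 (S)` (paper's direction `t ∈ [1,n]` is Lean's `t-1`). -/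
noncomputable def seedUpTo (hmn : n ≤ m) (d : Fin n → ℕ) (S : Seed m n) : ℕ → Seed m n
  | 0 => S
  | k + 1 => if h : k < n then Seed.mut hmn d ⟨k, h⟩ (seedUpTo hmn d S k) else seedUpTo hmn d S k

/-- The initial seed whose cluster variables are the canonical variables of `ℚ(x₁,…,x_m)`. -/
noncomputable def initSeed (m n : ℕ) (ρ : Fin n → ℕ → K m) (B : Matrix (Fin m) (Fin n) ℤ) :
    Seed m n := ⟨xv m, ρ, B⟩

/-- The principal part of `B` is skew-symmetrizable. -/
def SkewSymmetrizable (hmn : n ≤ m) (B : Matrix (Fin m) (Fin n) ℤ) : Prop :=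
  ∃ D : Fin n → ℤ, (∀ i, 0 < D i) ∧
    ∀ i j : Fin n, D i * B (Fin.castLE hmn i) j = -(D j * B (Fin.castLE hmn j) i)

/-- `p` is a monomial in `ℤ[x_{n+1},…,x_m]`. -/
def IsFrozenMonomial (m n : ℕ) (p : K m) : Prop :=
  ∃ (c : ℤ) (e : Fin m → ℕ), (∀ j : Fin m, (j : ℕ) < n → e j = 0) ∧
    p = (c : K m) * ∏ j : Fin m, xv m j ^ e j

/-- The defining conditions on the datum `(d, ρ, B)` of a generalized seed of geometric type. -/
structure SeedHyps (m n : ℕ) (hmn : n ≤ m) (d : Fin n → ℕ) (ρ : Fin n → ℕ → K m)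
    (B : Matrix (Fin m) (Fin n) ℤ) : Prop where
  d_pos : ∀ i, 0 < d i
  d_dvd : ∀ i j : Fin n, (d i : ℤ) ∣ B (Fin.castLE hmn j) i
  skew : SkewSymmetrizable hmn B
  rho_zero : ∀ i, ρ i 0 = 1
  rho_top : ∀ i, ρ i (d i) = 1
  rho_mon : ∀ i r, r ≤ d i → IsFrozenMonomial m n (ρ i r)

/-- The edge relation of the directed graph `Γ`: an edge from `i` to `j` iff `b_{ij} > 0`. -/
def GammaEdge (hmn : n ≤ m) (B : Matrix (Fin m) (Fin n) ℤ) (i j : Fin n) : Prop :=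
  0 < B (Fin.castLE hmn i) j

/-- The directed graph `Γ` has no oriented cycle. -/
def Acyclic (hmn : n ≤ m) (B : Matrix (Fin m) (Fin n) ℤ) : Prop :=
  ∀ i : Fin n, ¬ Relation.TransGen (GammaEdge hmn B) i i

/-- The ordering normalization: `b_{ij} ≥ 0` whenever `n ≥ i > j ≥ 1`. -/
def Ordered (hmn : n ≤ m) (B : Matrix (Fin m) (Fin n) ℤ) : Prop :=
  ∀ i j : Fin n, j < i → 0 ≤ B (Fin.castLE hmn i) j

/-- Divisibility inside a subset `R` of the ambient field. -/
def DvdIn (R : Set (K m)) (p u : K m) : Prop := ∃ z ∈ R, u = p * z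

/-- `u` and `v` are coprime in `R`: every common divisor in `R` is a unit of `R`. -/
def CoprimeIn (R : Set (K m)) (u v : K m) : Prop :=
  ∀ p ∈ R, DvdIn R p u → DvdIn R p v → ∃ q ∈ R, p * q = 1

/-- The polynomial ring `ℤℙ[x₁,…,x_n]` as a subalgebra of `K m`. -/
noncomputable def polyRing (hmn : n ≤ m) : Subalgebra ℤ (K m) :=
  Algebra.adjoin ℤ
    ({y | ∃ j : Fin m, n ≤ (j : ℕ) ∧ (y = xv m j ∨ y = (xv m j)⁻¹)} ∪
      {y | ∃ j : Fin n, y = xv m (Fin.castLE hmn j)})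

/-- The seed is coprime: the exchange polynomials `x_i x'_i` are pairwise coprime
in `ℤℙ[x₁,…,x_n]`. -/
def CoprimeSeed (hmn : n ≤ m) (d : Fin n → ℕ) (S : Seed m n) : Prop :=
  ∀ i j : Fin n, i ≠ j →
    CoprimeIn (↑(polyRing hmn (m := m)) : Set (K m))
      (S.x (Fin.castLE hmn i) * exchangeVar hmn d S i)
      (S.x (Fin.castLE hmn j) * exchangeVar hmn d S j)

/-- All cluster variables of all seeds mutation-equivalent to `S`. -/
noncomputable def clusterVars (hmn : n ≤ m) (d : Fin n → ℕ) (S : Seed m n) : Set (K m) :=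
  {y | ∃ (L : List (Fin n)) (i : Fin n), y = (mutSeq hmn d L S).x (Fin.castLE hmn i)}

/-- The generalized cluster algebra `𝒜(x̃,ρ,B̃)` as a `ℤℙ`-subalgebra of `ℚ(x₁,…,x_m)`. -/
noncomputable def gca (hmn : n ≤ m) (d : Fin n → ℕ) (S : Seed m n) :
    Subalgebra (↥(ZP m n)) (K m) :=
  Algebra.adjoin (↥(ZP m n)) (clusterVars hmn d S)

/-- The generalized projective cluster variable `x_i^{(n)}`. -/
noncomputable def projVar (hmn : n ≤ m) (d : Fin n → ℕ) (S : Seed m n) (i : Fin n) : K m :=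
  (seedUpTo hmn d S n).x (Fin.castLE hmn i)

/-- The lower bound generalized cluster algebra
`ℒ^{(n)}(Σ) = ℤℙ[x₁, x₁^{(n)}, …, x_n, x_n^{(n)}]`. -/
noncomputable def lowerBound (hmn : n ≤ m) (d : Fin n → ℕ) (S : Seed m n) :
    Subalgebra (↥(ZP m n)) (K m) :=
  Algebra.adjoin (↥(ZP m n))
    ({y | ∃ i : Fin n, y = S.x (Fin.castLE hmn i)} ∪
      {y | ∃ i : Fin n, y = projVar hmn d S i})

/-- Index type for standard monomials: exponent pairs with no product `x_i x'_i`. -/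
def StdIdx (n : ℕ) : Type := {v : Fin n → ℕ × ℕ // ∀ i, (v i).1 = 0 ∨ (v i).2 = 0}

/-- The (projective) standard monomial attached to an exponent vector. -/
noncomputable def stdMon (x x' : Fin n → K m) (v : StdIdx n) : K m :=
  ∏ i : Fin n, x i ^ (v.1 i).1 * x' i ^ (v.1 i).2

/-- Lexicographic order on exponent vectors. -/
def lexLt (a b : Fin n → ℤ) : Prop :=
  ∃ k : Fin n, a k < b k ∧ ∀ j : Fin n, j < k → a j = b j

/-- The Laurent monomial `x^a = x₁^{a₁} ⋯ x_n^{a_n}`. -/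
noncomputable def xpow (hmn : n ≤ m) (a : Fin n → ℤ) : K m :=
  ∏ i : Fin n, xv m (Fin.castLE hmn i) ^ a i

/-- `x^a` is the first Laurent monomial of `Y` (with some nonzero leading
coefficient in `ℤℙ`): `Y = c_a x^a + Σ_v c_v x^v` with all `v ≺ a`. -/
def IsFirstMonomial (hmn : n ≤ m) (Y : K m) (a : Fin n → ℤ) : Prop :=
  ∃ (s : Finset (Fin n → ℤ)) (c : (Fin n → ℤ) → K m),
    (∀ v, c v ∈ ZP m n) ∧ c a ≠ 0 ∧ (∀ v ∈ s, lexLt v a) ∧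
    Y = c a * xpow hmn a + ∑ v ∈ s, c v * xpow hmn v

end GCA

open Finset

set_option linter.unusedSectionVars false
set_option linter.unusedVariables false

namespace GCX
open GCA

/-- Natural-number form of the mutation exponent. -/
def ex (d : ℕ) (b : ℤ) (r : ℕ) : ℕ := ((r : ℤ) * b / d + max (-b) 0).toNat

theorem floor_aux (d : ℕ) (c : ℤ) : ⌊((c : ℤ) : ℚ) / (d : ℚ)⌋ = c / (d : ℤ) := by
  exact Rat.floor_intCast_div_natCast c d

theorem ex_arg_nonneg (d : ℕ) (hd : 0 < d) (b : ℤ) (r : ℕ) (hr : r ≤ d) :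
    0 ≤ (r : ℤ) * b / d + max (-b) 0 := by
  have hd' : (0 : ℤ) < d := by exact_mod_cast hd
  rcases le_total 0 b with h | h
  · rw [max_eq_right (by linarith)]
    have := Int.ediv_nonneg (mul_nonneg (Int.natCast_nonneg r) h) hd'.le
    linarith
  · rw [max_eq_left (by linarith)]
    have h1 : b ≤ (r : ℤ) * b / d := by
      rw [Int.le_ediv_iff_mul_le hd']
      have : (r : ℤ) ≤ d := by exact_mod_cast hr
      nlinarith
    linarith

theorem mutExp_eq (d : ℕ) (hd : 0 < d) (b : ℤ) (r : ℕ) (hr : r ≤ d) :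
    mutExp d b r = (ex d b r : ℤ) := by
  unfold ex
  rw [Int.toNat_of_nonneg (ex_arg_nonneg d hd b r hr)]
  unfold mutExp
  have hd0 : (0 : ℚ) < d := by exact_mod_cast hd
  have hd' : (d : ℤ) ≠ 0 := by exact_mod_cast hd.ne'
  have hr' : (r : ℚ) ≤ d := by exact_mod_cast hr
  rcases le_total 0 b with h | h
  · have hb : (0 : ℚ) ≤ b := by exact_mod_cast h
    rw [max_eq_left (by positivity), max_eq_right (a := -_), max_eq_right (by linarith)]
    · have := floor_aux d (r * b)
      push_cast at this
      rw [this]; simp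
    · have : 0 ≤ ((d : ℚ) - r) * b / d :=
        div_nonneg (mul_nonneg (by linarith) hb) hd0.le
      linarith
  · have hb : (b : ℚ) ≤ 0 := by exact_mod_cast h
    rw [max_eq_right (a := _ / _), max_eq_left (a := -(_ / _)), max_eq_left (a := -b) (by linarith)]
    · have h2 : -(((d : ℚ) - r) * b / d) = (((r * b : ℤ)) : ℚ) / d + ((-b : ℤ) : ℚ) := by
        push_cast; field_simp; ring
      rw [h2, Int.floor_add_intCast, floor_aux]; simp
    · have : ((d : ℚ) - r) * b / d ≤ 0 :=
        div_nonpos_of_nonpos_of_nonneg (mul_nonpos_of_nonneg_of_nonpos (by linarith) hb) hd0.le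
      linarith
    · exact div_nonpos_of_nonpos_of_nonneg
        (mul_nonpos_of_nonneg_of_nonpos (by positivity) hb) hd0.le

theorem ex_cast (d : ℕ) (hd : 0 < d) (b : ℤ) (r : ℕ) (hr : r ≤ d) :
    (ex d b r : ℤ) = (r : ℤ) * b / d + max (-b) 0 := by
  unfold ex
  rw [Int.toNat_of_nonneg (ex_arg_nonneg d hd b r hr)]

theorem ex_cast_dvd (d : ℕ) (hd : 0 < d) (β : ℤ) (r : ℕ) (hr : r ≤ d) :
    (ex d (d * β) r : ℤ) = (r : ℤ) * β + max (-(d * β)) 0 := by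
  rw [ex_cast d hd _ r hr]
  have hd' : (d : ℤ) ≠ 0 := by exact_mod_cast hd.ne'
  rw [mul_left_comm, Int.mul_ediv_cancel_left _ hd']

theorem ex_cast_add (d : ℕ) (hd : 0 < d) (b β : ℤ) (r : ℕ) (hr : r ≤ d) :
    (ex d (b + d * β) r : ℤ) = (ex d b r : ℤ) + r * β + (max (-(b + d * β)) 0 - max (-b) 0) := by
  rw [ex_cast d hd _ r hr, ex_cast d hd _ r hr]
  have hd' : (d : ℤ) ≠ 0 := by exact_mod_cast hd.ne'
  rw [mul_add, mul_left_comm (r : ℤ) (d : ℤ) β, Int.add_mul_ediv_left _ _ hd']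
  ring

theorem ex_neg (d : ℕ) (hd : 0 < d) (b : ℤ) (r : ℕ) (hr : r ≤ d) :
    ex d (-b) (d - r) = ex d b r := by
  have h1 := ex_cast d hd (-b) (d - r) (Nat.sub_le _ _)
  have h2 := ex_cast d hd b r hr
  have hd' : (d : ℤ) ≠ 0 := by exact_mod_cast hd.ne'
  have h3 : ((d - r : ℕ) : ℤ) * -b / d = (r : ℤ) * b / d - b := by
    rw [Nat.cast_sub hr, show ((d : ℤ) - r) * -b = r * b + d * (-b) by ring,
      Int.add_mul_ediv_left _ _ hd']; ring
  rw [h3] at h1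
  have h4 : max (- -b) 0 = b + max (-b) 0 := by
    rcases le_total 0 b with h | h
    · rw [max_eq_left (by linarith), max_eq_right (by linarith)]; ring
    · rw [max_eq_right (by linarith), max_eq_left (by linarith)]; ring
  have : (ex d (-b) (d - r) : ℤ) = ex d b r := by rw [h1, h2, h4]; ring
  exact_mod_cast this

theorem ex_zero_b (d : ℕ) (r : ℕ) : ex d 0 r = 0 := by simp [ex]

theorem ex_zero_r (d : ℕ) (b : ℤ) : ex d b 0 = (-b).toNat := by
  simp [ex, Int.toNat]
  rcases le_total 0 (-b) with h | h
  · simp [max_eq_left h]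
  · rw [max_eq_right h]
    have := Int.toNat_of_nonpos h
    simp only [Int.toNat] at this
    simp [this]

theorem ex_pos (d : ℕ) (hd : 0 < d) (b : ℤ) (hb : (d : ℤ) ≤ b) (r : ℕ) (h1 : 1 ≤ r) (hr : r ≤ d) :
    1 ≤ ex d b r := by
  have h2 := ex_cast d hd b r hr
  have hd' : (0 : ℤ) < d := by exact_mod_cast hd
  have h3 : 1 ≤ (r : ℤ) * b / d := by
    rw [Int.le_ediv_iff_mul_le hd']
    have : (1 : ℤ) ≤ r := by exact_mod_cast h1
    nlinarith
  have h4 : 0 ≤ max (-b) 0 := le_max_right _ _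
  have : (1 : ℤ) ≤ ex d b r := by linarith
  exact_mod_cast this

/-- Abstract generalized seeds over an arbitrary field. -/
structure GS (I N F : Type) where
  x : I → F
  ρ : N → ℕ → F
  B : I → N → ℤ

/-- Abstract matrix mutation. -/
def mm {I N : Type} [DecidableEq I] [DecidableEq N] (e : N → I) (i : N) (B : I → N → ℤ) :
    I → N → ℤ := fun k l =>
  if k = e i ∨ l = i then -B k l
  else B k l + (|B k i| * B (e i) l + B k i * |B (e i) l|) / 2

theorem mm_formula (a b : ℤ) :
    (|a| * b + a * |b|) / 2 = max a 0 * max b 0 - max (-a) 0 * max (-b) 0 := by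
  rcases le_total 0 a with ha | ha <;> rcases le_total 0 b with hb | hb
  · rw [abs_of_nonneg ha, abs_of_nonneg hb, max_eq_left ha, max_eq_left hb,
      max_eq_right (by linarith), max_eq_right (by linarith)]
    rw [show a * b + a * b = 2 * (a * b) by ring]; simp
  · rw [abs_of_nonneg ha, abs_of_nonpos hb, max_eq_left ha, max_eq_right hb,
      max_eq_right (a := -a) (by linarith)]
    rw [show a * b + a * (-b) = 0 by ring]; simp
  · rw [abs_of_nonpos ha, abs_of_nonneg hb, max_eq_right ha, max_eq_left hb,
      max_eq_right (a := -b) (by linarith)]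
    rw [show -a * b + a * b = 0 by ring]; simp
  · rw [abs_of_nonpos ha, abs_of_nonpos hb, max_eq_right ha, max_eq_right hb,
      max_eq_left (a := -a) (by linarith), max_eq_left (a := -b) (by linarith)]
    rw [show -a * b + a * (-b) = (-(a * b)) * 2 by ring, Int.mul_ediv_cancel _ two_ne_zero]; ring

section
variable {I N F : Type} [Fintype I] [DecidableEq I] [DecidableEq N] [Field F]

/-- The exchange polynomial as a function of raw data. -/
noncomputable def Pev (d : N → ℕ) (B : I → N → ℤ) (ρ : N → ℕ → F) (x : I → F) (i : N) : F :=
  ∑ r ∈ range (d i + 1), ρ i r * ∏ k, x k ^ ex (d i) (B k i) r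

/-- The exchange polynomial of a seed. -/
noncomputable def P (d : N → ℕ) (S : GS I N F) (i : N) : F := Pev d S.B S.ρ S.x i

/-- The new cluster variable. -/
noncomputable def xn (e : N → I) (d : N → ℕ) (S : GS I N F) (i : N) : F :=
  (S.x (e i))⁻¹ * P d S i

/-- Seed mutation. -/
noncomputable def mu (e : N → I) (d : N → ℕ) (i : N) (S : GS I N F) : GS I N F where
  x := fun j => if j = e i then xn e d S i else S.x j
  ρ := fun j r => if j = i then S.ρ i (d i - r) else S.ρ j r
  B := mm e i S.B

/-- Sequences of mutations. -/
noncomputable def ms (e : N → I) (d : N → ℕ) : List N → GS I N F → GS I N F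
  | [], S => S
  | i :: l, S => ms e d l (mu e d i S)

/-- Non-vanishing of all cluster variables along a path. -/
def NV (e : N → I) (d : N → ℕ) : List N → GS I N F → Prop
  | [], S => ∀ k, S.x k ≠ 0
  | i :: l, S => (∀ k, S.x k ≠ 0) ∧ NV e d l (mu e d i S)

theorem NV.init {e : N → I} {d : N → ℕ} {L : List N} {S : GS I N F} (h : NV e d L S) :
    ∀ k, S.x k ≠ 0 := by
  cases L with
  | nil => exact h
  | cons i l => exact h.1

/-- The conditions on the exchange matrix. -/
structure GoodB (e : N → I) (d : N → ℕ) (D : N → ℤ) (B : I → N → ℤ) : Prop where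
  inj : Function.Injective e
  dpos : ∀ i, 0 < d i
  dvd : ∀ i j, (d i : ℤ) ∣ B (e j) i
  Dpos : ∀ i, 0 < D i
  skew : ∀ i j, D i * B (e i) j = -(D j * B (e j) i)

/-- The conditions on the strings. -/
structure GoodR (d : N → ℕ) (A : Subring F) (ρ : N → ℕ → F) : Prop where
  zero : ∀ i, ρ i 0 = 1
  top : ∀ i, ρ i (d i) = 1
  mem : ∀ i r, r ≤ d i → ρ i r ∈ A

variable {e : N → I} {d : N → ℕ} {D : N → ℤ} {B : I → N → ℤ} {A : Subring F}

theorem GoodB.diag (h : GoodB e d D B) (i : N) : B (e i) i = 0 := by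
  have h1 := h.skew i i
  have h2 := h.Dpos i
  have : D i * B (e i) i = 0 := by linarith
  rcases mul_eq_zero.1 this with h | h
  · omega
  · exact h

theorem GoodB.nonneg_iff (h : GoodB e d D B) (i j : N) : 0 ≤ B (e i) j ↔ B (e j) i ≤ 0 := by
  have h1 := h.skew i j
  have h2 := h.Dpos i
  have h3 := h.Dpos j
  constructor
  · intro h4; by_contra h5; push Not at h5; nlinarith [mul_pos h3 h5, mul_nonneg h2.le h4]
  · intro h4; by_contra h5; push Not at h5
    nlinarith [mul_pos h2 (neg_pos.2 h5), mul_nonneg h3.le (neg_nonneg.2 h4)]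

theorem GoodB.zero_iff (h : GoodB e d D B) (i j : N) : B (e i) j = 0 ↔ B (e j) i = 0 := by
  have h1 := h.nonneg_iff i j
  have h2 := h.nonneg_iff j i
  constructor <;> intro h3 <;> omega

theorem mm_self_col (i : N) (k : I) : mm e i B k i = -B k i := by simp [mm]
theorem mm_self_row (i l : N) : mm e i B (e i) l = -B (e i) l := by simp [mm]
theorem mm_other (i l : N) (k : I) (hk : k ≠ e i) (hl : l ≠ i) :
    mm e i B k l = B k l + (max (B k i) 0 * max (B (e i) l) 0 -
      max (-B k i) 0 * max (-B (e i) l) 0) := by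
  simp [mm, hk, hl, mm_formula]

theorem mm_other_nonpos (i l : N) (k : I) (hk : k ≠ e i) (hl : l ≠ i) (h : B (e i) l ≤ 0) :
    mm e i B k l = B k l + max (-B k i) 0 * B (e i) l := by
  rw [mm_other i l k hk hl, max_eq_right h, max_eq_left (a := -B (e i) l) (by linarith)]; ring

theorem GoodB.mm (h : GoodB e d D B) (i : N) : GoodB e d D (mm e i B) where
  inj := h.inj
  dpos := h.dpos
  Dpos := h.Dpos
  dvd := by
    intro a b
    by_cases h1 : e b = e i ∨ a = i
    · simp only [GCX.mm, if_pos h1]; exact (h.dvd a b).neg_right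
    · push Not at h1
      rw [mm_other i a (e b) h1.1 h1.2]
      refine dvd_add (h.dvd a b) (dvd_sub (Dvd.dvd.mul_left ?_ _) (Dvd.dvd.mul_left ?_ _))
      · rcases max_choice (B (e i) a) 0 with h2 | h2 <;> rw [h2]
        exacts [h.dvd a i, dvd_zero _]
      · rcases max_choice (-B (e i) a) 0 with h2 | h2 <;> rw [h2]
        exacts [(h.dvd a i).neg_right, dvd_zero _]
  skew := by
    intro a b
    by_cases ha : a = i
    · subst ha; rw [mm_self_row, mm_self_col]; have := h.skew a b; linarith
    by_cases hb : b = i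
    · subst hb; rw [mm_self_row, mm_self_col]; have := h.skew a b; linarith
    rw [mm_other i b (e a) (fun hh => ha (h.inj hh)) hb,
      mm_other i a (e b) (fun hh => hb (h.inj hh)) ha]
    have h1 := h.skew a b
    have key : ∀ (p q u v : ℤ) , 0 < p → 0 < q → p * u = - (q * v) →
        p * max u 0 = q * max (-v) 0 ∧ p * max (-u) 0 = q * max v 0 := by
      intro p q u v hp hq huv
      rcases le_total 0 u with hu | hu
      · have hv : v ≤ 0 := by by_contra hh; push Not at hh; nlinarith [mul_pos hq hh, mul_nonneg hp.le hu]
        rw [max_eq_left hu, max_eq_left (a := -v) (by linarith), max_eq_right (a := -u) (by linarith),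
          max_eq_right hv]
        constructor <;> linarith
      · have hv : 0 ≤ v := by
          by_contra hh; push Not at hh
          nlinarith [mul_pos hq (neg_pos.2 hh), mul_nonneg hp.le (neg_nonneg.2 hu)]
        rw [max_eq_right hu, max_eq_right (a := -v) (by linarith), max_eq_left (a := -u) (by linarith),
          max_eq_left hv]
        constructor <;> linarith
    obtain ⟨k1, k2⟩ := key _ _ _ _ (h.Dpos a) (h.Dpos i) (h.skew a i)
    obtain ⟨k3, k4⟩ := key _ _ _ _ (h.Dpos b) (h.Dpos i) (h.skew b i)
    have e1 : D a * (max (B (e a) i) 0 * max (B (e i) b) 0) =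
        D b * (max (-B (e b) i) 0 * max (-B (e i) a) 0) := by
      calc _ = (D a * max (B (e a) i) 0) * max (B (e i) b) 0 := by ring
        _ = (D i * max (B (e i) b) 0) * max (-B (e i) a) 0 := by rw [k1]; ring
        _ = _ := by rw [← k4]; ring
    have e2 : D a * (max (-B (e a) i) 0 * max (-B (e i) b) 0) =
        D b * (max (B (e b) i) 0 * max (B (e i) a) 0) := by
      calc _ = (D a * max (-B (e a) i) 0) * max (-B (e i) b) 0 := by ring
        _ = (D i * max (-B (e i) b) 0) * max (B (e i) a) 0 := by rw [k2]; ring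
        _ = _ := by rw [← k3]; ring
    rw [mul_add, mul_sub, mul_add, mul_sub, h1, e1, e2]; ring

theorem mm_mm (i : N) : mm e i (mm e i B) = B := by
  funext k l
  by_cases hk : k = e i
  · subst hk; simp [mm]
  by_cases hl : l = i
  · subst hl; simp [mm]
  rw [mm_other i l k hk hl, mm_other i l k hk hl, mm_self_col, mm_self_row]
  simp only [neg_neg]; ring

theorem GoodR.mu {ρ : N → ℕ → F} (h : GoodR d A ρ) (i : N) :
    GoodR d A (fun j r => if j = i then ρ i (d i - r) else ρ j r) where
  zero := by intro j; by_cases hj : j = i <;> simp [hj, h.zero, h.top]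
  top := by intro j; by_cases hj : j = i <;> simp [hj, h.zero, h.top]
  mem := by
    intro j r hr; by_cases hj : j = i
    · simp only [hj, if_true]; exact h.mem _ _ (Nat.sub_le _ _)
    · simp only [hj, if_false]; exact h.mem _ _ hr

end
end GCX

open Finset
set_option linter.unusedSectionVars false
set_option linter.unusedVariables false

namespace GCX
open GCA Polynomial

section rel
variable {I N F F' : Type} [Fintype I] [DecidableEq I] [DecidableEq N] [Field F] [Field F']
variable {e : N → I} {d : N → ℕ} {D : N → ℤ} {B : I → N → ℤ} {A : Subring F}

/-- A relation between two fields compatible with the field operations. -/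
structure RelClosed (T : F → F' → Prop) : Prop where
  zero : T 0 0
  one : T 1 1
  add : ∀ {a b a' b'}, T a a' → T b b' → T (a + b) (a' + b')
  mul : ∀ {a b a' b'}, T a a' → T b b' → T (a * b) (a' * b')
  inv : ∀ {a a'}, T a a' → a' ≠ 0 → T a⁻¹ a'⁻¹
  ne : ∀ {a a'}, T a a' → a' ≠ 0 → a ≠ 0

theorem RelClosed.pow {T : F → F' → Prop} (h : RelClosed T) {a a'} (ha : T a a') (n : ℕ) :
    T (a ^ n) (a' ^ n) := by
  induction n with
  | zero => simpa using h.one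
  | succ n ih => rw [pow_succ, pow_succ]; exact h.mul ih ha

theorem RelClosed.sum {T : F → F' → Prop} (h : RelClosed T) {ι : Type} (s : Finset ι)
    {f : ι → F} {g : ι → F'} (H : ∀ i ∈ s, T (f i) (g i)) : T (∑ i ∈ s, f i) (∑ i ∈ s, g i) := by
  classical
  induction s using Finset.induction_on with
  | empty => simpa using h.zero
  | insert a s ha ih =>
    rw [sum_insert ha, sum_insert ha]
    exact h.add (H a (mem_insert_self _ _)) (ih fun i hi => H i (mem_insert_of_mem hi))

theorem RelClosed.prod {T : F → F' → Prop} (h : RelClosed T) {ι : Type} (s : Finset ι)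
    {f : ι → F} {g : ι → F'} (H : ∀ i ∈ s, T (f i) (g i)) : T (∏ i ∈ s, f i) (∏ i ∈ s, g i) := by
  classical
  induction s using Finset.induction_on with
  | empty => simpa using h.one
  | insert a s ha ih =>
    rw [prod_insert ha, prod_insert ha]
    exact h.mul (H a (mem_insert_self _ _)) (ih fun i hi => H i (mem_insert_of_mem hi))

/-- Related seeds. -/
structure SR (d : N → ℕ) (T : F → F' → Prop) (S : GS I N F) (S' : GS I N F') : Prop where
  B : S.B = S'.B
  x : ∀ k, T (S.x k) (S'.x k)
  ρ : ∀ i r, r ≤ d i → T (S.ρ i r) (S'.ρ i r)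

theorem SR.P {T : F → F' → Prop} (hT : RelClosed T) {S : GS I N F} {S' : GS I N F'}
    (h : SR d T S S') (i : N) : T (P d S i) (P d S' i) := by
  unfold GCX.P Pev
  rw [h.B]
  refine hT.sum _ fun r hr => hT.mul (h.ρ i r ?_) (hT.prod _ fun k _ => hT.pow (h.x k) _)
  simpa [Nat.lt_succ_iff] using hr

theorem SR.xn {T : F → F' → Prop} (hT : RelClosed T) {S : GS I N F} {S' : GS I N F'}
    (h : SR d T S S') (i : N) (h0 : S'.x (e i) ≠ 0) : T (xn e d S i) (xn e d S' i) :=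
  hT.mul (hT.inv (h.x _) h0) (h.P hT i)

theorem SR.mu {T : F → F' → Prop} (hT : RelClosed T) {S : GS I N F} {S' : GS I N F'}
    (h : SR d T S S') (i : N) (h0 : S'.x (e i) ≠ 0) : SR d T (mu e d i S) (mu e d i S') where
  B := by simp [GCX.mu, h.B]
  x := by
    intro k
    by_cases hk : k = e i
    · simp only [GCX.mu, if_pos hk]; exact h.xn hT i h0
    · simp only [GCX.mu, if_neg hk]; exact h.x k
  ρ := by
    intro j r hr
    by_cases hj : j = i
    · simp only [GCX.mu, if_pos hj]; exact h.ρ i _ (Nat.sub_le _ _)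
    · simp only [GCX.mu, if_neg hj]; exact h.ρ j r hr

theorem SR.ms {T : F → F' → Prop} (hT : RelClosed T) {L : List N} :
    ∀ {S : GS I N F} {S' : GS I N F'}, SR d T S S' → NV e d L S' →
      SR d T (ms e d L S) (ms e d L S') ∧ NV e d L S := by
  induction L with
  | nil => intro S S' h hN; exact ⟨h, fun k => hT.ne (h.x k) (hN k)⟩
  | cons i l ih =>
    intro S S' h hN
    have := ih (h.mu hT i (hN.1 _)) hN.2
    exact ⟨this.1, fun k => hT.ne (h.x k) (hN.1 k), this.2⟩

theorem relEq : RelClosed (F := F) (F' := F) Eq where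
  zero := rfl
  one := rfl
  add := by rintro _ _ _ _ rfl rfl; rfl
  mul := by rintro _ _ _ _ rfl rfl; rfl
  inv := by rintro _ _ rfl _; rfl
  ne := by rintro _ _ rfl h; exact h

theorem P_mu_self (hB : ∀ i, 0 < d i) (i : N) (S : GS I N F) (hd : S.B (e i) i = 0) :
    P d (mu e d i S) i = P d S i := by
  unfold P Pev
  rw [← sum_range_reflect]
  refine sum_congr rfl fun r hr => ?_
  have hr' : r ≤ d i := by simpa [Nat.lt_succ_iff] using hr
  have h1 : d i + 1 - 1 - r = d i - r := by omega
  rw [h1]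
  congr 1
  · simp [mu, Nat.sub_sub_self hr']
  · refine prod_congr rfl fun k _ => ?_
    by_cases hk : k = e i
    · subst hk; simp [mu, mm_self_col, hd, ex_zero_b]
    · simp only [mu, if_neg hk, mm_self_col, ex_neg _ (hB i) _ _ hr']

theorem mu_mu (hB : GoodB e d D B) (i : N) (S : GS I N F) (hS : S.B = B)
    (h0 : S.x (e i) ≠ 0) (h1 : P d S i ≠ 0) : SR d Eq (mu e d i (mu e d i S)) S where
  B := by simp [mu, mm_mm]
  x := by
    intro k
    by_cases hk : k = e i
    · subst hk
      have := P_mu_self (e := e) hB.dpos i S (by rw [hS]; exact hB.diag i)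
      simp only [mu, xn, if_true] at this ⊢
      rw [this]; field_simp
    · simp [mu, hk]
  ρ := by
    intro j r hr
    by_cases hj : j = i
    · subst hj; simp [mu, Nat.sub_sub_self hr]
    · simp [mu, hj]

/-- The opposite seed: same cluster variables. -/
def flip (d : N → ℕ) (S : GS I N F) : GS I N F where
  x := S.x
  ρ := fun j r => S.ρ j (d j - r)
  B := fun k l => -S.B k l

theorem P_flip (hB : ∀ i, 0 < d i) (i : N) (S : GS I N F) : P d (flip d S) i = P d S i := by
  unfold P Pev
  rw [← sum_range_reflect]
  refine sum_congr rfl fun r hr => ?_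
  have hr' : r ≤ d i := by simpa [Nat.lt_succ_iff] using hr
  have h1 : d i + 1 - 1 - r = d i - r := by omega
  rw [h1]
  congr 1
  · simp [flip, Nat.sub_sub_self hr']
  · refine prod_congr rfl fun k _ => ?_
    simp only [flip, ex_neg _ (hB i) _ _ hr']

theorem mu_flip (hB : ∀ i, 0 < d i) (i : N) (S : GS I N F) :
    mu e d i (flip d S) = flip d (mu e d i S) := by
  have h : xn e d (flip d S) i = xn e d S i := by
    unfold xn; rw [P_flip hB]; rfl
  unfold mu flip at *
  simp only [GS.mk.injEq]
  refine ⟨?_, ?_, ?_⟩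
  · funext k; by_cases hk : k = e i <;> simp [hk, h]
  · funext j r; by_cases hj : j = i <;> simp [hj]
  · funext k l
    by_cases hk : k = e i ∨ l = i
    · simp [mm, hk]
    · simp only [mm, if_neg hk, abs_neg]
      simp only [mm_formula]
      have h1 := mm_formula (-S.B k i) (-S.B (e i) l)
      simp only [abs_neg, neg_neg] at h1
      rw [h1]; ring

theorem ms_flip (hB : ∀ i, 0 < d i) (L : List N) : ∀ (S : GS I N F),
    ms e d L (flip d S) = flip d (ms e d L S) := by
  induction L with
  | nil => intro S; rfl
  | cons i l ih => intro S; simp only [ms, mu_flip hB, ih]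

theorem NV_flip (hB : ∀ i, 0 < d i) (L : List N) : ∀ (S : GS I N F),
    NV e d L S → NV e d L (flip d S) := by
  induction L with
  | nil => intro S h; exact h
  | cons i l ih =>
    intro S h; refine ⟨h.1, ?_⟩
    rw [mu_flip hB]; exact ih _ h.2

theorem GoodB.flip (h : GoodB e d D B) : GoodB e d D (fun k l => -B k l) where
  inj := h.inj
  dpos := h.dpos
  Dpos := h.Dpos
  dvd := fun i j => (h.dvd i j).neg_right
  skew := fun i j => by have := h.skew i j; linarith

theorem GoodR.flip {ρ : N → ℕ → F} (h : GoodR d A ρ) :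
    GoodR d A (fun j r => ρ j (d j - r)) where
  zero := by intro j; simp [h.top]
  top := by intro j; simp [h.zero]
  mem := by intro j r hr; exact h.mem _ _ (Nat.sub_le _ _)

/-- Adding one row to the exchange matrix, with the trivial variable `1`. -/
def addRow (k0 : N) (d : N → ℕ) (S : GS I N F) : GS (Option I) N F where
  x := fun k => k.elim 1 S.x
  ρ := S.ρ
  B := fun k l => k.elim (if l = k0 then (d k0 : ℤ) else 0) (fun k => S.B k l)

/-- `S'` is obtained from `S` by adding one row and the variable `1`. -/
structure RowRel (S : GS I N F) (S' : GS (Option I) N F) : Prop where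
  none : S'.x none = 1
  some : ∀ k, S'.x (some k) = S.x k
  ρ : S'.ρ = S.ρ
  B : ∀ k l, S'.B (Option.some k) l = S.B k l

theorem addRow_rel (k0 : N) (S : GS I N F) : RowRel S (addRow k0 d S) :=
  ⟨rfl, fun _ => rfl, rfl, fun _ _ => rfl⟩

theorem RowRel.P {S : GS I N F} {S' : GS (Option I) N F} (h : RowRel S S') (i : N) :
    P d S' i = P d S i := by
  unfold GCX.P Pev
  refine sum_congr rfl fun r _ => ?_
  rw [h.ρ, Fintype.prod_option, h.none, one_pow, one_mul]
  simp only [h.some, h.B]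

theorem RowRel.xn {S : GS I N F} {S' : GS (Option I) N F} (h : RowRel S S') (i : N) :
    xn (fun i => Option.some (e i)) d S' i = xn e d S i := by
  unfold GCX.xn; rw [h.P, h.some]

theorem RowRel.mu {S : GS I N F} {S' : GS (Option I) N F} (h : RowRel S S') (i : N) :
    RowRel (mu e d i S) (mu (fun i => Option.some (e i)) d i S') where
  none := by simp [GCX.mu, h.none]
  some := by
    intro k
    by_cases hk : k = e i
    · simp [GCX.mu, hk, h.xn]
    · simp [GCX.mu, hk, h.some]
  ρ := by simp [GCX.mu, h.ρ]
  B := by intro k l; simp [GCX.mu, mm, h.B]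

theorem RowRel.ms {L : List N} : ∀ {S : GS I N F} {S' : GS (Option I) N F}, RowRel S S' →
    RowRel (ms e d L S) (ms (fun i => Option.some (e i)) d L S') := by
  induction L with
  | nil => intro S S' h; exact h
  | cons i l ih => intro S S' h; exact ih (h.mu i)

theorem RowRel.NV {L : List N} : ∀ {S : GS I N F} {S' : GS (Option I) N F}, RowRel S S' →
    NV e d L S → NV (fun i => Option.some (e i)) d L S' := by
  have key : ∀ {S : GS I N F} {S' : GS (Option I) N F}, RowRel S S' → (∀ k, S.x k ≠ 0) →
      ∀ k, S'.x k ≠ 0 := by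
    intro S S' h h0 k
    cases k with
    | none => rw [h.none]; exact one_ne_zero
    | some k => rw [h.some]; exact h0 k
  induction L with
  | nil => intro S S' h h0; exact key h h0
  | cons i l ih => intro S S' h h0; exact ⟨key h h0.1, ih (h.mu i) h0.2⟩

theorem addRow_good (k0 : N) (S : GS I N F) (h : GoodB e d D S.B) :
    GoodB (fun i => Option.some (e i)) d D (addRow k0 d S).B where
  inj := fun a b hab => h.inj (Option.some.inj hab)
  dpos := h.dpos
  Dpos := h.Dpos
  dvd := h.dvd
  skew := h.skew

/-- Specialization at a point, as a relation. -/
def Sp (s : F) (a : RatFunc F) (b : F) : Prop :=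
  ∃ p q : F[X], q.eval s ≠ 0 ∧ a = algebraMap F[X] (RatFunc F) p / algebraMap F[X] (RatFunc F) q ∧
    b = p.eval s / q.eval s

theorem am_ne {q : F[X]} (h : q ≠ 0) : algebraMap F[X] (RatFunc F) q ≠ 0 :=
  RatFunc.algebraMap_ne_zero h

theorem am_inj : Function.Injective (algebraMap F[X] (RatFunc F)) :=
  RatFunc.algebraMap_injective F

theorem ne_of_eval {s : F} {q : F[X]} (h : q.eval s ≠ 0) : q ≠ 0 := by
  rintro rfl; simp at h

theorem Sp.unique {s : F} {a : RatFunc F} {b b' : F} (h : Sp s a b) (h' : Sp s a b') : b = b' := by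
  obtain ⟨p, q, hq, ha, hb⟩ := h
  obtain ⟨p', q', hq', ha', hb'⟩ := h'
  rw [ha, div_eq_div_iff (am_ne (ne_of_eval hq)) (am_ne (ne_of_eval hq')), ← map_mul, ← map_mul] at ha'
  have := congrArg (Polynomial.eval s) (am_inj ha')
  rw [hb, hb', div_eq_div_iff hq hq']
  simpa using this

theorem Sp.poly (s : F) (p : F[X]) : Sp s (algebraMap F[X] (RatFunc F) p) (p.eval s) :=
  ⟨p, 1, by simp, by simp, by simp⟩

theorem Sp.C (s : F) (a : F) : Sp s (RatFunc.C a) a := by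
  have := Sp.poly s (Polynomial.C a)
  simpa using this

theorem Sp.X (s : F) : Sp s (RatFunc.X) s := by
  have := Sp.poly s (Polynomial.X)
  simpa using this

theorem spRel (s : F) : RelClosed (Sp s) where
  zero := by simpa using Sp.C s 0
  one := by simpa using Sp.C s 1
  add := by
    rintro a b a' b' ⟨p, q, hq, rfl, rfl⟩ ⟨p', q', hq', rfl, rfl⟩
    refine ⟨p * q' + q * p', q * q', ?_, ?_, ?_⟩
    · simp [hq, hq']
    · rw [div_add_div _ _ (am_ne (ne_of_eval hq)) (am_ne (ne_of_eval hq'))]; simp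
    · rw [div_add_div _ _ hq hq']; simp
  mul := by
    rintro a b a' b' ⟨p, q, hq, rfl, rfl⟩ ⟨p', q', hq', rfl, rfl⟩
    refine ⟨p * p', q * q', ?_, ?_, ?_⟩
    · simp [hq, hq']
    · rw [div_mul_div_comm]; simp
    · rw [div_mul_div_comm]; simp
  inv := by
    rintro a a' ⟨p, q, hq, rfl, rfl⟩ h
    refine ⟨q, p, ?_, by simp, by simp⟩
    intro h1; simp [h1] at h
  ne := by
    rintro a a' ⟨p, q, hq, rfl, rfl⟩ h
    have : p ≠ 0 := by rintro rfl; simp at h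
    exact div_ne_zero (am_ne this) (am_ne (ne_of_eval hq))

/-- Make the variable with index `k0` generic. -/
noncomputable def gen (k0 : I) (S : GS I N F) : GS I N (RatFunc F) where
  x := fun k => if k = k0 then RatFunc.X else RatFunc.C (S.x k)
  ρ := fun i r => RatFunc.C (S.ρ i r)
  B := S.B

theorem gen_rel (k0 : I) (S : GS I N F) : SR d (Sp (S.x k0)) (gen k0 S) S where
  B := rfl
  x := by
    intro k
    by_cases hk : k = k0
    · subst hk; simp only [gen, if_true]; exact Sp.X _
    · simp only [gen, if_neg hk]; exact Sp.C _ _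
  ρ := fun i r _ => Sp.C _ _

theorem gen_goodR {ρ : N → ℕ → F} (h : GoodR d A ρ) :
    GoodR d (A.map (RatFunc.C)) (fun i r => RatFunc.C (ρ i r)) where
  zero := by intro j; simp [h.zero]
  top := by intro j; simp [h.top]
  mem := by intro j r hr; exact ⟨_, h.mem j r hr, rfl⟩

/-- The exchange polynomial does not involve the generic variable when the exponent vanishes. -/
theorem gen_P (k0 : I) (S : GS I N F) (i : N) (h : S.B k0 i = 0) :
    P d (gen k0 S) i = RatFunc.C (P d S i) := by
  unfold P Pev
  rw [map_sum]
  refine sum_congr rfl fun r _ => ?_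
  rw [map_mul, map_prod]
  congr 1
  refine prod_congr rfl fun k _ => ?_
  by_cases hk : k = k0
  · subst hk; simp [gen, h, ex_zero_b]
  · simp [gen, hk]

end rel

section phi
variable {F : Type} [Field F]

/-- Laurent polynomials whose coefficients satisfy a twisted membership condition. -/
def Phi (E : Subring F) (Q : F) (hQ : Q ≠ 0) : Subring (RatFunc F) where
  carrier := {a | ∃ (M : ℕ) (p : F[X]), RatFunc.X ^ M * a = algebraMap F[X] (RatFunc F) p ∧
    ∀ w, p.coeff w * Q ^ ((w : ℤ) - M) ∈ E}
  mul_mem' := by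
    rintro a b ⟨M, p, hp, hp'⟩ ⟨M', q, hq, hq'⟩
    refine ⟨M + M', p * q, ?_, ?_⟩
    · rw [map_mul, ← hp, ← hq, pow_add]; ring
    · intro w
      rw [Polynomial.coeff_mul, sum_mul]
      refine E.sum_mem fun x hx => ?_
      have : x.1 + x.2 = w := by simpa using hx
      have h1 : p.coeff x.1 * q.coeff x.2 * Q ^ ((w : ℤ) - (M + M' : ℕ)) =
          (p.coeff x.1 * Q ^ ((x.1 : ℤ) - M)) * (q.coeff x.2 * Q ^ ((x.2 : ℤ) - M')) := by
        rw [show (w : ℤ) - (M + M' : ℕ) = ((x.1 : ℤ) - M) + ((x.2 : ℤ) - M') by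
          rw [← this]; push_cast; ring, zpow_add₀ hQ]; ring
      rw [h1]; exact E.mul_mem (hp' _) (hq' _)
  one_mem' := by
    refine ⟨0, 1, by simp, ?_⟩
    intro w
    rw [Polynomial.coeff_one]
    split_ifs with h
    · subst h; simp
    · simp
  zero_mem' := ⟨0, 0, by simp, by simp⟩
  add_mem' := by
    have key : ∀ {a : RatFunc F} {M : ℕ} {p : F[X]} (M' : ℕ),
        RatFunc.X ^ M * a = algebraMap F[X] (RatFunc F) p →
        (∀ w : ℕ, p.coeff w * Q ^ ((w : ℤ) - M) ∈ E) →
        RatFunc.X ^ (M + M') * a = algebraMap F[X] (RatFunc F) (p * X ^ M') ∧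
        (∀ w : ℕ, (p * X ^ M').coeff w * Q ^ ((w : ℤ) - (M + M' : ℕ)) ∈ E) := by
      intro a M p M' h1 h2
      refine ⟨?_, ?_⟩
      · rw [map_mul, ← h1, map_pow, RatFunc.algebraMap_X]; ring
      · intro w
        rw [Polynomial.coeff_mul_X_pow']
        split_ifs with h
        · have := h2 (w - M')
          rw [Nat.cast_sub h] at this
          convert this using 3; push_cast; ring
        · simp
    rintro a b ⟨M, p, hp, hp'⟩ ⟨M', q, hq, hq'⟩
    obtain ⟨k1, k2⟩ := key M' hp hp'
    obtain ⟨k3, k4⟩ := key M hq hq'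
    rw [add_comm M' M] at k3 k4
    refine ⟨M + M', p * X ^ M' + q * X ^ M, ?_, ?_⟩
    · rw [mul_add, k1, k3, map_add]
    · intro w
      rw [Polynomial.coeff_add, add_mul]
      exact E.add_mem (k2 w) (k4 w)
  neg_mem' := by
    rintro a ⟨M, p, hp, hp'⟩
    refine ⟨M, -p, by rw [mul_neg, hp, map_neg], ?_⟩
    intro w
    rw [Polynomial.coeff_neg, neg_mul]
    exact E.neg_mem (hp' w)

/-- Laurent polynomials with coefficients in a subring. -/
def LP (R : Subring F) : Subring (RatFunc F) := Phi R 1 one_ne_zero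

theorem mem_Phi {E : Subring F} {Q : F} {hQ : Q ≠ 0} {a : RatFunc F} : a ∈ Phi E Q hQ ↔
    ∃ (M : ℕ) (p : F[X]), RatFunc.X ^ M * a = algebraMap F[X] (RatFunc F) p ∧
    ∀ w, p.coeff w * Q ^ ((w : ℤ) - M) ∈ E := Iff.rfl

theorem mem_LP {R : Subring F} {a : RatFunc F} : a ∈ LP R ↔
    ∃ (M : ℕ) (p : F[X]), RatFunc.X ^ M * a = algebraMap F[X] (RatFunc F) p ∧
    ∀ w, p.coeff w ∈ R := by
  unfold LP; rw [mem_Phi]; simp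

theorem X_ne : (RatFunc.X : RatFunc F) ≠ 0 := RatFunc.X_ne_zero

theorem Phi_C {E : Subring F} {Q : F} {hQ : Q ≠ 0} {a : F} (h : a ∈ E) :
    RatFunc.C a ∈ Phi E Q hQ := by
  refine ⟨0, Polynomial.C a, by simp, ?_⟩
  intro w
  rw [Polynomial.coeff_C]
  split_ifs with h1
  · subst h1; simpa using h
  · simp

theorem Phi_X {E : Subring F} {Q : F} {hQ : Q ≠ 0} :
    RatFunc.C Q⁻¹ * RatFunc.X ∈ Phi E Q hQ := by
  refine ⟨0, Polynomial.C Q⁻¹ * X, by simp, ?_⟩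
  intro w
  rw [Polynomial.coeff_C_mul, Polynomial.coeff_X]
  split_ifs with h1
  · subst h1; simp [hQ]
  · simp

theorem Phi_Xinv {E : Subring F} {Q : F} {hQ : Q ≠ 0} :
    RatFunc.C Q * RatFunc.X⁻¹ ∈ Phi E Q hQ := by
  refine ⟨1, Polynomial.C Q, ?_, ?_⟩
  · have := X_ne (F := F)
    simp; field_simp
  intro w
  rw [Polynomial.coeff_C]
  split_ifs with h1
  · subst h1; simp [hQ]
  · simp

theorem LP_C {R : Subring F} {a : F} (h : a ∈ R) : RatFunc.C a ∈ LP R := Phi_C h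
theorem LP_X {R : Subring F} : RatFunc.X ∈ LP R := by
  have := Phi_X (E := R) (hQ := one_ne_zero); unfold LP; simpa using this
theorem LP_Xinv {R : Subring F} : RatFunc.X⁻¹ ∈ LP R := by
  have := Phi_Xinv (E := R) (hQ := one_ne_zero); unfold LP; simpa using this

theorem am_mem {W : Subring (RatFunc F)} {p : F[X]} (hX : RatFunc.X ∈ W)
    (h : ∀ w, RatFunc.C (p.coeff w) ∈ W) : algebraMap F[X] (RatFunc F) p ∈ W := by
  rw [p.as_sum_range_C_mul_X_pow, map_sum]
  refine W.sum_mem fun i _ => ?_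
  rw [map_mul, map_pow, RatFunc.algebraMap_X, RatFunc.algebraMap_C]
  exact W.mul_mem (h i) (W.pow_mem hX _)

theorem LP_le {R : Subring F} {W : Subring (RatFunc F)} (hC : ∀ a ∈ R, RatFunc.C a ∈ W)
    (hX : RatFunc.X ∈ W) (hX' : RatFunc.X⁻¹ ∈ W) : LP R ≤ W := by
  intro a ha
  obtain ⟨M, p, h1, h2⟩ := mem_LP.1 ha
  have h3 : a = RatFunc.X⁻¹ ^ M * algebraMap F[X] (RatFunc F) p := by
    rw [← h1, ← mul_assoc, ← mul_pow, inv_mul_cancel₀ X_ne]; simp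
  rw [h3]
  exact W.mul_mem (W.pow_mem hX' _) (am_mem hX fun w => hC _ (h2 w))

theorem LP_mono {R R' : Subring F} (h : R ≤ R') : LP R ≤ LP R' :=
  LP_le (fun a ha => LP_C (h ha)) LP_X LP_Xinv

/-- Division by a polynomial with invertible constant term. -/
theorem LP_div {R : Subring F} {a : RatFunc F} {q : F[X]} (ha : a ∈ LP (⊤ : Subring F))
    (hq : ∀ w, q.coeff w ∈ R) (hu : (q.coeff 0)⁻¹ ∈ R) (hu0 : q.coeff 0 ≠ 0)
    (h : algebraMap F[X] (RatFunc F) q * a ∈ LP R) : a ∈ LP R := by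
  obtain ⟨M, p, h1, -⟩ := mem_LP.1 ha
  obtain ⟨M', p', h2, h3⟩ := mem_LP.1 h
  rw [mem_LP]
  refine ⟨M + M', p * X ^ M', ?_, ?_⟩
  · rw [map_mul, ← h1, map_pow, RatFunc.algebraMap_X]; ring
  have h4 : q * (p * X ^ M') = p' * X ^ M := by
    apply am_inj
    rw [map_mul, map_mul, map_mul, ← h1, ← h2, map_pow, map_pow, RatFunc.algebraMap_X]; ring
  have h5 : ∀ w, (q * (p * X ^ M')).coeff w ∈ R := by
    intro w
    rw [h4, Polynomial.coeff_mul_X_pow']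
    split_ifs
    · exact h3 _
    · exact R.zero_mem
  generalize p * X ^ M' = s at h5
  intro w
  induction w using Nat.strong_induction_on with
  | _ w ih =>
    have h6 := h5 w
    rw [Polynomial.coeff_mul, Finset.Nat.sum_antidiagonal_eq_sum_range_succ_mk, sum_range_succ'] at h6
    simp only [Nat.sub_zero] at h6
    have h7 : ∑ k ∈ range w, q.coeff (k + 1) * s.coeff (w - (k + 1)) ∈ R := by
      refine R.sum_mem fun k hk => R.mul_mem (hq _) (ih _ ?_)
      have := mem_range.1 hk
      omega
    have h8 := R.sub_mem h6 h7
    rw [add_sub_cancel_left] at h8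
    have h9 := R.mul_mem hu h8
    rwa [← mul_assoc, inv_mul_cancel₀ hu0, one_mul] at h9

theorem LP_div_pow {R : Subring F} {a : RatFunc F} {q : F[X]} (ha : a ∈ LP (⊤ : Subring F))
    (hq : ∀ w, q.coeff w ∈ R) (hu : (q.coeff 0)⁻¹ ∈ R) (hu0 : q.coeff 0 ≠ 0) (M : ℕ)
    (h : (algebraMap F[X] (RatFunc F) q) ^ M * a ∈ LP R) : a ∈ LP R := by
  induction M with
  | zero => simpa using h
  | succ M ih =>
    apply ih
    rw [pow_succ', mul_assoc] at h
    refine LP_div ((LP ⊤).mul_mem ((LP ⊤).pow_mem ?_ _) ha) hq hu hu0 h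
    exact am_mem LP_X fun w => LP_C (Subring.mem_top _)

end phi
end GCX

open Finset
set_option linter.unusedSectionVars false
set_option linter.unusedVariables false

namespace GCX
open GCA Polynomial

section r2
variable {I N F F' : Type} [Fintype I] [DecidableEq I] [DecidableEq N] [Field F] [Field F']
variable {e : N → I} {d : N → ℕ} {D : N → ℤ} {B : I → N → ℤ} {A : Subring F}

/-- The term of index zero of the exchange polynomial. -/
noncomputable def c0 (B : I → N → ℤ) (x : I → F) (s : N) : F := ∏ l, x l ^ (-B l s).toNat

/-- The monomial comparing two exchange polynomials. -/
noncomputable def nu (e : N → I) (B : I → N → ℤ) (x : I → F) (s j : N) : F :=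
  ∏ l ∈ univ.erase (e s), x l ^ (max (-mm e s B l j) 0 - max (-B l j) 0)

theorem R2H_term (hB : GoodB e d D B) {x : I → F} (s j : N) (hsj : s ≠ j)
    (hneg : B (e s) j ≤ 0) (hx0 : ∀ l, x l ≠ 0 ∨ 0 ≤ B l s) (r : ℕ) (hr : r ≤ d j) (m : ℕ)
    (hm : m = ex (d j) (mm e s B (e s) j) r) :
    c0 B x s ^ m * ∏ l ∈ univ.erase (e s), x l ^ ex (d j) (mm e s B l j) r =
      nu e B x s j * ∏ l ∈ univ.erase (e s), x l ^ ex (d j) (B l j) r := by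
  have h1 : c0 B x s = ∏ l ∈ univ.erase (e s), x l ^ (-B l s).toNat := by
    unfold c0
    rw [← mul_prod_erase univ _ (mem_univ (e s)), hB.diag]; simp
  rw [h1, nu, ← prod_pow, ← prod_mul_distrib, ← prod_mul_distrib]
  refine prod_congr rfl fun l hl => ?_
  have hl' : l ≠ e s := by simpa using hl
  obtain ⟨β, hβ⟩ := hB.dvd j s
  have hmm := mm_other_nonpos (e := e) (B := B) s j l hl' hsj.symm hneg
  have hm' : (m : ℤ) = -(r * β) := by
    rw [hm, mm_self_row, hβ, ← mul_neg, ex_cast_dvd _ (hB.dpos j) _ _ hr, mul_neg, mul_neg, neg_neg,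
      max_eq_right (by rw [← hβ]; exact hneg)]
    ring
  by_cases hls : 0 ≤ B l s
  · have : mm e s B l j = B l j := by
      rw [hmm, max_eq_right (by linarith)]; simp
    rw [this, Int.toNat_of_nonpos (by linarith)]; simp
  · have hx : x l ≠ 0 := (hx0 l).resolve_right hls
    push Not at hls
    rw [max_eq_left (by linarith), hβ] at hmm
    have h2 := ex_cast_add (d j) (hB.dpos j) (B l j) (-B l s * β) r hr
    rw [show B l j + (d j : ℤ) * (-B l s * β) = mm e s B l j by rw [hmm]; ring] at h2
    have h3 : ((-B l s).toNat : ℤ) = - B l s := Int.toNat_of_nonneg (by linarith)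
    rw [← pow_mul, ← zpow_natCast, ← zpow_natCast, ← zpow_natCast, ← zpow_add₀ hx, ← zpow_add₀ hx]
    congr 1
    push_cast
    rw [h2, h3, hm']; ring

theorem R2H (hB : GoodB e d D B) {ρ : N → ℕ → F} {x : I → F} (s j : N) (hsj : s ≠ j)
    (hneg : B (e s) j ≤ 0) (O : Subring F) (hx : ∀ k, x k ∈ O)
    (hρ : ∀ r, r ≤ d j → ρ j r ∈ O) (hx0 : ∀ l, x l ≠ 0 ∨ 0 ≤ B l s)
    (X δ : F) (hX : B (e s) j ≠ 0 → ∃ w ∈ O, x (e s) * X = c0 B x s + δ * w) (hδ : δ ∈ O) :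
    ∃ w ∈ O, x (e s) ^ (-B (e s) j).toNat * Pev d (mm e s B) ρ (Function.update x (e s) X) j =
      nu e B x s j * Pev d B ρ x j + δ * w := by
  have hc0 : c0 B x s ∈ O := O.prod_mem fun l _ => O.pow_mem (hx l) _
  obtain ⟨β, hβ⟩ := hB.dvd j s
  have key : ∀ r ∈ range (d j + 1), ∃ w ∈ O,
      x (e s) ^ (-B (e s) j).toNat * (ρ j r * ∏ k, Function.update x (e s) X k ^
        ex (d j) (mm e s B k j) r) =
      nu e B x s j * (ρ j r * ∏ k, x k ^ ex (d j) (B k j) r) + δ * w := by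
    intro r hr
    have hr : r ≤ d j := by simpa [Nat.lt_succ_iff] using hr
    have hT := R2H_term hB s j hsj hneg hx0 r hr _ rfl
    set m := ex (d j) (mm e s B (e s) j) r with hm
    have h1 : (-B (e s) j).toNat = ex (d j) (B (e s) j) r + m := by
      have e1 : (m : ℤ) = -(r * β) := by
        rw [hm, mm_self_row, hβ, ← mul_neg, ex_cast_dvd _ (hB.dpos j) _ _ hr, mul_neg, mul_neg, neg_neg,
          max_eq_right (by rw [← hβ]; exact hneg)]
        ring
      have e2 := ex_cast_dvd (d j) (hB.dpos j) β r hr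
      rw [← hβ, max_eq_left (by linarith)] at e2
      have e3 : ((-B (e s) j).toNat : ℤ) = - B (e s) j := Int.toNat_of_nonneg (by linarith)
      have : ((-B (e s) j).toNat : ℤ) = ex (d j) (B (e s) j) r + m := by
        rw [e3, e2, e1]; ring
      exact_mod_cast this
    have h2 : ∃ w ∈ O, (x (e s) * X) ^ m = c0 B x s ^ m + δ * w := by
      by_cases h0 : B (e s) j = 0
      · have : m = 0 := by rw [hm, mm_self_row, h0]; simp [ex_zero_b]
        exact ⟨0, O.zero_mem, by simp [this]⟩
      · obtain ⟨w, hw, hw'⟩ := hX h0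
        have : ∀ m : ℕ, ∃ w' ∈ O, (x (e s) * X) ^ m = c0 B x s ^ m + δ * w' := by
          intro m
          induction m with
          | zero => exact ⟨0, O.zero_mem, by simp⟩
          | succ m ih =>
            obtain ⟨w', h1, h2⟩ := ih
            refine ⟨c0 B x s ^ m * w + w' * c0 B x s + δ * w' * w, ?_, ?_⟩
            · exact O.add_mem (O.add_mem (O.mul_mem (O.pow_mem hc0 _) hw) (O.mul_mem h1 hc0))
                (O.mul_mem (O.mul_mem hδ h1) hw)
            · rw [pow_succ, h2, hw']; ring
        exact this m
    obtain ⟨w, hw, hw'⟩ := h2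
    refine ⟨ρ j r * x (e s) ^ ex (d j) (B (e s) j) r * w *
      ∏ l ∈ univ.erase (e s), x l ^ ex (d j) (mm e s B l j) r, ?_, ?_⟩
    · exact O.mul_mem (O.mul_mem (O.mul_mem (hρ r hr) (O.pow_mem (hx _) _)) hw)
        (O.prod_mem fun l _ => O.pow_mem (hx l) _)
    · rw [← mul_prod_erase univ _ (mem_univ (e s)),
        ← mul_prod_erase univ (fun k => x k ^ ex (d j) (B k j) r) (mem_univ (e s)), ← hm]
      have h3 : ∏ l ∈ univ.erase (e s), Function.update x (e s) X l ^ ex (d j) (mm e s B l j) r =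
          ∏ l ∈ univ.erase (e s), x l ^ ex (d j) (mm e s B l j) r := by
        refine prod_congr rfl fun l hl => ?_
        rw [Function.update_of_ne (by simpa using hl)]
      rw [h3, Function.update_self, h1, pow_add]
      rw [mul_pow] at hw'
      linear_combination (ρ j r * x (e s) ^ ex (d j) (B (e s) j) r *
        ∏ l ∈ univ.erase (e s), x l ^ ex (d j) (mm e s B l j) r) * hw' +
        (ρ j r * x (e s) ^ ex (d j) (B (e s) j) r) * hT
  choose! w hw hw' using key
  refine ⟨∑ r ∈ range (d j + 1), w r, O.sum_mem hw, ?_⟩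
  unfold Pev
  rw [mul_sum, mul_sum, mul_sum, ← sum_add_distrib]
  exact sum_congr rfl hw'

theorem Psplit (hB : GoodB e d D B) {ρ : N → ℕ → F} {x : I → F} (s : N) (O : Subring F)
    (hx : ∀ k, k ≠ e s → x k ∈ O) (hρ0 : ρ s 0 = 1) (hρ : ∀ r, r ≤ d s → ρ s r ∈ O)
    (Q : Finset I) (hQ : ∀ q ∈ Q, (d s : ℤ) ≤ B q s) :
    ∃ w ∈ O, Pev d B ρ x s = c0 B x s + (∏ q ∈ Q, x q) * w := by
  have hes : ∀ k r, x k ^ ex (d s) (B k s) r ∈ O := by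
    intro k r
    by_cases hk : k = e s
    · subst hk; rw [hB.diag, ex_zero_b]; simp
    · exact O.pow_mem (hx k hk) _
  have key : ∀ r ∈ range (d s), ∃ w ∈ O,
      ρ s (r + 1) * ∏ k, x k ^ ex (d s) (B k s) (r + 1) = (∏ q ∈ Q, x q) * w := by
    intro r hr
    have hr : r + 1 ≤ d s := by simpa using hr
    refine ⟨ρ s (r + 1) * ((∏ q ∈ Q, x q ^ (ex (d s) (B q s) (r + 1) - 1)) *
      ∏ q ∈ univ \ Q, x q ^ ex (d s) (B q s) (r + 1)), ?_, ?_⟩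
    · refine O.mul_mem (hρ _ hr) (O.mul_mem (O.prod_mem fun q hq => ?_) (O.prod_mem fun q _ => hes q _))
      refine O.pow_mem (hx q ?_) _
      rintro rfl
      have h1 := hQ _ hq
      rw [hB.diag] at h1
      have := hB.dpos s
      omega
    · rw [← prod_sdiff (subset_univ Q)]
      have h1 : ∏ q ∈ Q, x q ^ ex (d s) (B q s) (r + 1) =
          (∏ q ∈ Q, x q) * ∏ q ∈ Q, x q ^ (ex (d s) (B q s) (r + 1) - 1) := by
        rw [← prod_mul_distrib]
        refine prod_congr rfl fun q hq => ?_
        have := ex_pos (d s) (hB.dpos s) _ (hQ q hq) (r + 1) (by omega) hr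
        rw [← pow_succ', Nat.sub_add_cancel this]
      rw [h1]; ring
  choose! w hw hw' using key
  refine ⟨∑ r ∈ range (d s), w r, O.sum_mem hw, ?_⟩
  unfold Pev
  rw [sum_range_succ', sum_congr rfl hw', mul_sum, hρ0, one_mul, add_comm]
  congr 1
  unfold c0
  simp only [ex_zero_r]

end r2
end GCX

open Finset
set_option linter.unusedSectionVars false
set_option linter.unusedVariables false

namespace GCX
open GCA Polynomial

section w
variable {I N F F' : Type} [Fintype I] [DecidableEq I] [DecidableEq N] [Field F] [Field F']
variable {e : N → I} {d : N → ℕ} {D : N → ℤ} {B : I → N → ℤ} {A : Subring F}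

/-- Partial upper/lower bound rings. -/
noncomputable def W (e : N → I) (d : N → ℕ) (A : Subring F) (G : Finset N) (S : GS I N F) :
    Subring F :=
  Subring.closure ({y | y ∈ A ∨ (∃ k, y = S.x k) ∨ (∃ k, (∀ i ∈ G, k ≠ e i) ∧ y = (S.x k)⁻¹) ∨
    ∃ i ∈ G, y = xn e d S i})

variable {G : Finset N} {S : GS I N F}

theorem W_A {a : F} (h : a ∈ A) : a ∈ W e d A G S := Subring.subset_closure (Or.inl h)
theorem W_x (k : I) : S.x k ∈ W e d A G S := Subring.subset_closure (Or.inr (Or.inl ⟨k, rfl⟩))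
theorem W_inv {k : I} (h : ∀ i ∈ G, k ≠ e i) : (S.x k)⁻¹ ∈ W e d A G S :=
  Subring.subset_closure (Or.inr (Or.inr (Or.inl ⟨k, h, rfl⟩)))
theorem W_xn {i : N} (h : i ∈ G) : xn e d S i ∈ W e d A G S :=
  Subring.subset_closure (Or.inr (Or.inr (Or.inr ⟨i, h, rfl⟩)))

theorem W_le {R : Subring F} (hA : ∀ a ∈ A, a ∈ R) (hx : ∀ k, S.x k ∈ R)
    (hinv : ∀ k, (∀ i ∈ G, k ≠ e i) → (S.x k)⁻¹ ∈ R) (hxn : ∀ i ∈ G, xn e d S i ∈ R) :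
    W e d A G S ≤ R := by
  refine Subring.closure_le.2 ?_
  rintro y (h | ⟨k, rfl⟩ | ⟨k, h, rfl⟩ | ⟨i, h, rfl⟩)
  exacts [hA _ h, hx _, hinv _ h, hxn _ h]

/-- Elements that become members after multiplying by a power. -/
def Lc (R : Subring F) (Q : F) (hQ : Q ∈ R) : Subring F where
  carrier := {y | ∃ M : ℕ, Q ^ M * y ∈ R}
  mul_mem' := by
    rintro a b ⟨M, h⟩ ⟨M', h'⟩
    refine ⟨M + M', ?_⟩
    have := R.mul_mem h h'
    rwa [show Q ^ M * a * (Q ^ M' * b) = Q ^ (M + M') * (a * b) by ring] at this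
  one_mem' := ⟨0, by simp⟩
  zero_mem' := ⟨0, by simp⟩
  add_mem' := by
    rintro a b ⟨M, h⟩ ⟨M', h'⟩
    refine ⟨M + M', ?_⟩
    have := R.add_mem (R.mul_mem (R.pow_mem hQ M') h) (R.mul_mem (R.pow_mem hQ M) h')
    rwa [show Q ^ M' * (Q ^ M * a) + Q ^ M * (Q ^ M' * b) = Q ^ (M + M') * (a + b) by ring] at this
  neg_mem' := by
    rintro a ⟨M, h⟩
    refine ⟨M, ?_⟩
    have := R.neg_mem h
    rwa [show -(Q ^ M * a) = Q ^ M * (-a) by ring] at this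

theorem Lc_mk {R : Subring F} {Q : F} {hQ : Q ∈ R} {y : F} (M : ℕ) (h : Q ^ M * y ∈ R) :
    y ∈ Lc R Q hQ := ⟨M, h⟩
theorem Lc_of {R : Subring F} {Q : F} {hQ : Q ∈ R} {y : F} (h : y ∈ R) : y ∈ Lc R Q hQ :=
  ⟨0, by simpa using h⟩

theorem W_spec {T : F → F' → Prop} (hT : RelClosed T) {A : Subring F} {A' : Subring F'}
    (hA : ∀ a ∈ A, ∃ b ∈ A', T a b) {S : GS I N F} {S' : GS I N F'} (h : SR d T S S')
    (h0 : ∀ k, S'.x k ≠ 0) {a : F} (ha : a ∈ W e d A G S) : ∃ b ∈ W e d A' G S', T a b := by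
  unfold W at ha
  obtain ⟨m1, hm1, hm1'⟩ := hA (-1) (A.neg_mem A.one_mem)
  induction ha using Subring.closure_induction with
  | mem y hy =>
    rcases hy with h1 | ⟨k, rfl⟩ | ⟨k, h1, rfl⟩ | ⟨i, h1, rfl⟩
    · obtain ⟨b, hb, hb'⟩ := hA y h1
      exact ⟨b, W_A hb, hb'⟩
    · exact ⟨_, W_x k, h.x k⟩
    · exact ⟨_, W_inv h1, hT.inv (h.x k) (h0 k)⟩
    · exact ⟨_, W_xn h1, h.xn hT i (h0 _)⟩
  | zero => exact ⟨0, Subring.zero_mem _, hT.zero⟩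
  | one => exact ⟨1, Subring.one_mem _, hT.one⟩
  | add a b _ _ h1 h2 =>
    obtain ⟨a', k1, k2⟩ := h1
    obtain ⟨b', k3, k4⟩ := h2
    exact ⟨_, Subring.add_mem _ k1 k3, hT.add k2 k4⟩
  | mul a b _ _ h1 h2 =>
    obtain ⟨a', k1, k2⟩ := h1
    obtain ⟨b', k3, k4⟩ := h2
    exact ⟨_, Subring.mul_mem _ k1 k3, hT.mul k2 k4⟩
  | neg a _ h1 =>
    obtain ⟨a', k1, k2⟩ := h1
    refine ⟨m1 * a', Subring.mul_mem _ (W_A hm1) k1, ?_⟩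
    have := hT.mul hm1' k2
    rwa [neg_one_mul] at this

theorem W_row {S' : GS (Option I) N F} (h : RowRel S S') :
    W (fun i => Option.some (e i)) d A G S' ≤ W e d A G S := by
  refine W_le (fun a => W_A) ?_ ?_ ?_
  · rintro (_ | k)
    · rw [h.none]; exact Subring.one_mem _
    · rw [h.some]; exact W_x k
  · rintro (_ | k) hk
    · rw [h.none, inv_one]; exact Subring.one_mem _
    · rw [h.some]; exact W_inv (fun i hi hh => hk i hi (by rw [hh]))
  · intro i hi; rw [h.xn]; exact W_xn hi

/-- Polynomials in `X` with coefficients in `R`. -/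
noncomputable def PR (R : Subring F) : Subring (RatFunc F) :=
  ((Polynomial.mapRingHom R.subtype).range).map (algebraMap F[X] (RatFunc F))

theorem mem_PR {R : Subring F} {a : RatFunc F} : a ∈ PR R ↔ ∃ p : F[X],
    a = algebraMap F[X] (RatFunc F) p ∧ ∀ w, p.coeff w ∈ R := by
  unfold PR
  rw [Subring.mem_map]
  constructor
  · rintro ⟨p, ⟨q, rfl⟩, rfl⟩
    exact ⟨_, rfl, fun w => by simp⟩
  · rintro ⟨p, rfl, h⟩
    refine ⟨p, ?_, rfl⟩
    rw [Polynomial.mem_map_range]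
    intro n; simpa using h n

theorem PR_C {R : Subring F} {a : F} (h : a ∈ R) : RatFunc.C a ∈ PR R := by
  rw [mem_PR]
  refine ⟨Polynomial.C a, by simp, fun w => ?_⟩
  rw [Polynomial.coeff_C]; split_ifs
  exacts [h, R.zero_mem]

theorem PR_X {R : Subring F} : RatFunc.X ∈ PR R := by
  rw [mem_PR]
  refine ⟨Polynomial.X, by simp, fun w => ?_⟩
  rw [Polynomial.coeff_X]; split_ifs
  exacts [R.one_mem, R.zero_mem]

/-- `C u + X w` as a polynomial with known constant coefficient. -/
theorem PR_const {R : Subring F} {u : F} (hu : u ∈ R) {w : RatFunc F} (hw : w ∈ PR R) :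
    ∃ p : F[X], RatFunc.C u + RatFunc.X * w = algebraMap F[X] (RatFunc F) p ∧
      (∀ v, p.coeff v ∈ R) ∧ p.coeff 0 = u := by
  obtain ⟨p, rfl, hp⟩ := mem_PR.1 hw
  refine ⟨Polynomial.C u + Polynomial.X * p, by simp, ?_, by simp⟩
  intro v
  rw [Polynomial.coeff_add, Polynomial.coeff_C]
  refine R.add_mem ?_ ?_
  · split_ifs
    exacts [hu, R.zero_mem]
  · cases v with
    | zero => simp
    | succ v => rw [Polynomial.coeff_X_mul]; exact hp v

theorem PR_le_LP {R : Subring F} : PR R ≤ LP R := by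
  intro a ha
  obtain ⟨p, rfl, hp⟩ := mem_PR.1 ha
  exact am_mem LP_X fun w => LP_C (hp w)

theorem LP_spec {R : Subring F} {a : RatFunc F} (h : a ∈ LP R) : ∃ b ∈ R, Sp 1 a b := by
  obtain ⟨M, p, h1, h2⟩ := mem_LP.1 h
  refine ⟨p.eval 1, ?_, p, X ^ M, by simp, ?_, by simp⟩
  · rw [Polynomial.eval_eq_sum_range]
    exact R.sum_mem fun i _ => R.mul_mem (h2 i) (R.pow_mem R.one_mem _)
  · rw [← h1]; have := X_ne (F := F); simp; field_simp

/-- Units of `R` inside `RatFunc`. -/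
def UC (R : Subring F) (a : RatFunc F) : Prop :=
  ∃ u, u ∈ R ∧ u⁻¹ ∈ R ∧ u ≠ 0 ∧ a = RatFunc.C u

theorem UC.one {R : Subring F} : UC R (1 : RatFunc F) := ⟨1, R.one_mem, by simp, one_ne_zero, by simp⟩
theorem UC.mul {R : Subring F} {a b : RatFunc F} (ha : UC R a) (hb : UC R b) : UC R (a * b) := by
  obtain ⟨u, h1, h2, h3, rfl⟩ := ha
  obtain ⟨v, k1, k2, k3, rfl⟩ := hb
  exact ⟨u * v, R.mul_mem h1 k1, by rw [mul_inv]; exact R.mul_mem h2 k2, mul_ne_zero h3 k3, by simp⟩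
theorem UC.inv {R : Subring F} {a : RatFunc F} (ha : UC R a) : UC R a⁻¹ := by
  obtain ⟨u, h1, h2, h3, rfl⟩ := ha
  exact ⟨u⁻¹, h2, by simpa using h1, inv_ne_zero h3, by simp⟩
theorem UC.pow {R : Subring F} {a : RatFunc F} (ha : UC R a) (n : ℕ) : UC R (a ^ n) := by
  induction n with
  | zero => simpa using UC.one
  | succ n ih => rw [pow_succ]; exact ih.mul ha
theorem UC.zpow {R : Subring F} {a : RatFunc F} (ha : UC R a) (n : ℤ) : UC R (a ^ n) := by
  cases n with
  | ofNat n => simpa using ha.pow n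
  | negSucc n => rw [zpow_negSucc]; exact (ha.pow _).inv
theorem UC.prod {R : Subring F} {ι : Type} (s : Finset ι) {f : ι → RatFunc F}
    (h : ∀ i ∈ s, UC R (f i)) : UC R (∏ i ∈ s, f i) :=
  Finset.prod_induction _ _ (fun _ _ => UC.mul) UC.one h

theorem W_flip : W e d A ∅ (flip d S) ≤ W e d A ∅ S :=
  W_le (fun a => W_A) (fun k => W_x (S := S) k) (fun k hk => W_inv (S := S) hk) (by simp)

theorem W_congr {S S' : GS I N F} (h : SR d Eq S S') (h0 : ∀ k, S'.x k ≠ 0) {a : F}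
    (ha : a ∈ W e d A G S) : a ∈ W e d A G S' := by
  obtain ⟨b, hb, rfl⟩ := W_spec (A' := A) relEq (fun a ha => ⟨a, ha, rfl⟩) h h0 ha
  exact hb

theorem NV_congr {L : List N} {S S' : GS I N F} (h : SR d Eq S S') (hN : NV e d L S') :
    NV e d L S ∧ ∀ k, (ms e d L S).x k = (ms e d L S').x k := by
  have := SR.ms relEq h hN
  exact ⟨this.2, this.1.x⟩

/-- The generic seed with coefficient variable attached to direction `k0`. -/
theorem gen_setup (k0 : N) (S : GS I N F) (L : List N) (hN : NV e d L S) :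
    NV (fun i => Option.some (e i)) d L (gen none (addRow k0 d S)) ∧
    ∀ k, Sp 1 ((ms (fun i => Option.some (e i)) d L (gen none (addRow k0 d S))).x (some k))
      ((ms e d L S).x k) := by
  have h1 := (addRow_rel (d := d) k0 S).NV (e := e) hN
  have h2 := SR.ms (spRel _) (gen_rel none (addRow k0 d S)) h1
  refine ⟨h2.2, fun k => ?_⟩
  have h3 := h2.1.x (some k)
  rwa [((addRow_rel (d := d) k0 S).ms (e := e)).some k] at h3

end w
end GCX

open Finset
set_option linter.unusedSectionVars false
set_option linter.unusedVariables false

namespace GCX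
open GCA Polynomial

section laurent
variable {N : Type} [DecidableEq N] {d : N → ℕ} {D : N → ℤ}

theorem mu_P_other {I F : Type} [Fintype I] [DecidableEq I] [Field F] {e : N → I} (k j : N)
    (hkj : j ≠ k) (S : GS I N F) :
    P d (mu e d k S) j = Pev d (mm e k S.B) S.ρ (Function.update S.x (e k) (xn e d S k)) j := by
  unfold P Pev
  refine sum_congr rfl fun r _ => ?_
  congr 1
  · simp [mu, hkj]
  · refine prod_congr rfl fun l _ => ?_
    congr 1
    by_cases hl : l = e k
    · subst hl; simp [mu]
    · simp [mu, hl]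

theorem P_mem' {I F : Type} [Fintype I] [DecidableEq I] [Field F] {A O : Subring F}
    {S : GS I N F} {j : N} (hR : GoodR d A S.ρ) (hA : ∀ a ∈ A, a ∈ O) (hx : ∀ k, S.x k ∈ O) :
    P d S j ∈ O := by
  unfold P Pev
  refine O.sum_mem fun r hr => O.mul_mem (hA _ (hR.mem j r ?_))
    (O.prod_mem fun l _ => O.pow_mem (hx l) _)
  simpa [Nat.lt_succ_iff] using hr

/-- The local computation for two consecutive mutations. -/
theorem laurent_local {I F : Type} [Fintype I] [DecidableEq I] [Field F] (e : N → I)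
    (A : Subring F) (S : GS I N F) (j k : N) (hjk : j ≠ k) (hB : GoodB e d D S.B)
    (hR : GoodR d A S.ρ) (hx : ∀ l, S.x l ≠ 0) (hpos : 0 ≤ S.B (e k) j) (ha : P d S j ≠ 0)
    (R : Subring F) (hRW : R = W e d A ∅ S)
    (S1 : GS (Option I) N (RatFunc F))
    (hS1 : S1 = mu (fun i => Option.some (e i)) d j (gen none (addRow k d S))) :
    S1.x none = RatFunc.X ∧
    (∃ a ∈ R, a ≠ 0 ∧ S1.x (some (e j)) = RatFunc.C a) ∧
    (∀ l, l ≠ e j → S1.x (some l) = RatFunc.C (S.x l)) ∧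
    (∃ q : F[X], (∀ w, q.coeff w ∈ R) ∧ (q.coeff 0)⁻¹ ∈ R ∧ q.coeff 0 ≠ 0 ∧
      RatFunc.C (S.x (e k)) * xn (fun i => Option.some (e i)) d S1 k =
        algebraMap F[X] (RatFunc F) q) ∧
    (∃ M : ℕ, ∃ q : F[X], (∀ w, q.coeff w ∈ R) ∧ (q.coeff 0)⁻¹ ∈ R ∧ q.coeff 0 ≠ 0 ∧
      RatFunc.C (S.x (e k)) ^ M * xn (fun i => Option.some (e i)) d
        (mu (fun i => Option.some (e i)) d k S1) j = algebraMap F[X] (RatFunc F) q) := by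
  set e' : N → Option I := fun i => Option.some (e i) with he'
  set S0 := gen none (addRow k d S) with hS0
  have hB0 : GoodB e' d D S0.B := addRow_good k S hB
  have hR0 : GoodR d (A.map RatFunc.C) S0.ρ := gen_goodR hR
  have hB1 : GoodB e' d D S1.B := by rw [hS1]; exact hB0.mm j
  have hR1 : GoodR d (A.map RatFunc.C) S1.ρ := by rw [hS1]; exact hR0.mu j
  have hn0 : ∀ l, S0.B none l = if l = k then (d k : ℤ) else 0 := fun l => rfl
  have hs0 : ∀ i l, S0.B (some i) l = S.B i l := fun i l => rfl
  have hPj : P d S0 j = RatFunc.C (P d S j) := by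
    rw [hS0, gen_P none _ j (by simp [addRow, hjk]), (addRow_rel (d := d) k S).P]
  have hxj : S.x (e j) ≠ 0 := hx _
  set a := xn e d S j with ha'
  have haR : a ∈ R := by
    rw [hRW, ha', xn]
    refine Subring.mul_mem _ (W_inv (by simp)) ?_
    exact P_mem' hR (fun a => W_A) (fun l => W_x l)
  have ha0 : a ≠ 0 := mul_ne_zero (inv_ne_zero hxj) ha
  have hS0x : ∀ l, S0.x (some l) = RatFunc.C (S.x l) := fun l => by simp [hS0, gen, addRow]
  have x1 : S1.x none = RatFunc.X := by simp [hS1, mu, hS0, gen, he']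
  have x2 : S1.x (some (e j)) = RatFunc.C a := by
    have : S1.x (e' j) = xn e' d S0 j := by simp [hS1, mu]
    rw [show some (e j) = e' j from rfl, this, xn, hPj, ha', xn, map_mul, map_inv₀]
    simp only [he', hS0x]
  have x3 : ∀ l, l ≠ e j → S1.x (some l) = RatFunc.C (S.x l) := by
    intro l hl
    have : S1.x (some l) = S0.x (some l) := by simp [hS1, mu, he', hl]
    rw [this, hS0x]
  have hxR : ∀ l, S.x l ∈ R := fun l => by rw [hRW]; exact W_x l
  have hxR' : ∀ l, (S.x l)⁻¹ ∈ R := fun l => by rw [hRW]; exact W_inv (by simp)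
  have hO : ∀ l, S1.x l ∈ PR R := by
    rintro (_ | l)
    · rw [x1]; exact PR_X
    · by_cases hl : l = e j
      · rw [hl, x2]; exact PR_C haR
      · rw [x3 l hl]; exact PR_C (hxR l)
  have hρO : ∀ i r, r ≤ d i → S1.ρ i r ∈ PR R := by
    intro i r hr
    obtain ⟨u, hu, hu'⟩ := hR1.mem i r hr
    rw [← hu']; exact PR_C (by rw [hRW]; exact W_A hu)
  have hn1 : S1.B none k = d k := by
    rw [hS1]
    change mm e' j S0.B none k = _
    rw [mm_other j k none (by simp [he']) hjk.symm, hn0 j, if_neg hjk, hn0 k]; simp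
  have hej1 : S1.B (e' j) k = -S.B (e j) k := by
    rw [hS1]; change mm e' j S0.B (e' j) k = _; rw [mm_self_row]; rfl
  have hek1 : S1.B (e' k) j = -S.B (e k) j := by
    rw [hS1]; change mm e' j S0.B (e' k) j = _; rw [mm_self_col]; rfl
  have hej1' : 0 ≤ S1.B (e' j) k := by
    rw [hej1]; have := (hB.nonneg_iff k j).1 hpos; linarith
  have huc : ∀ l, l ≠ none → l ≠ some (e j) → UC R (S1.x l) := by
    rintro (_ | l) h1 h2
    · exact absurd rfl h1
    · rw [x3 l (fun h => h2 (by rw [h]))]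
      exact ⟨_, hxR l, hxR' l, hx l, rfl⟩
  have hek0 : S1.x (e' k) = RatFunc.C (S.x (e k)) := x3 _ (fun h => hjk (hB.inj h).symm)
  have hCk : RatFunc.C (S.x (e k)) ≠ 0 := by
    rw [Ne, map_eq_zero]; exact hx _
  -- the constant term
  have hc0 : UC R (c0 S1.B S1.x k) := by
    unfold c0
    refine UC.prod _ fun l _ => ?_
    by_cases h1 : l = none
    · subst h1; rw [hn1, Int.toNat_of_nonpos (by omega), pow_zero]; exact UC.one
    by_cases h2 : l = some (e j)
    · subst h2; rw [Int.toNat_of_nonpos (by simpa [he'] using hej1'), pow_zero]; exact UC.one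
    exact (huc l h1 h2).pow _
  have hnu : UC R (nu e' S1.B S1.x k j) := by
    unfold nu
    refine UC.prod _ fun l hl => ?_
    have hl' : l ≠ e' k := by simpa using hl
    have hmm := mm_other_nonpos (e := e') (B := S1.B) k j l hl' hjk (by rw [hek1]; linarith)
    by_cases h1 : l = none
    · subst h1
      rw [hn1, max_eq_right (a := -((d k : ℕ) : ℤ)) (by omega), zero_mul, add_zero] at hmm
      rw [hmm, sub_self, zpow_zero]; exact UC.one
    by_cases h2 : l = some (e j)
    · subst h2
      rw [max_eq_right (a := -S1.B (some (e j)) k) (by simpa [he'] using hej1'), zero_mul, add_zero] at hmm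
      rw [hmm, sub_self, zpow_zero]; exact UC.one
    exact (huc l h1 h2).zpow _
  have hb : S1.x (e' k) * xn e' d S1 k = P d S1 k := by
    rw [xn, hek0, mul_inv_cancel_left₀ hCk]
  refine ⟨x1, ⟨a, haR, ha0, x2⟩, x3, ?_, ?_⟩
  · obtain ⟨w, hw, hw'⟩ := Psplit hB1 k (PR R) (fun l _ => hO l) (hR1.zero k) (hρO k) {none}
      (by simp [hn1])
    rw [prod_singleton, x1] at hw'
    obtain ⟨u, h1, h2, h3, h4⟩ := hc0
    rw [h4] at hw'
    obtain ⟨q, q1, q2, q3⟩ := PR_const h1 hw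
    refine ⟨q, q2, by rw [q3]; exact h2, by rw [q3]; exact h3, ?_⟩
    rw [← hek0, hb, ← q1]; exact hw'
  · obtain ⟨w, hw, hw'⟩ := R2H hB1 (ρ := S1.ρ) (x := S1.x) k j hjk.symm (by rw [hek1]; linarith) (PR R)
      hO (hρO j) (by
        rintro (_ | l)
        · left; rw [x1]; exact X_ne
        · left
          by_cases hl : l = e j
          · rw [hl, x2, Ne, map_eq_zero]; exact ha0
          · rw [x3 l hl, Ne, map_eq_zero]; exact hx l)
      (xn e' d S1 k) (RatFunc.X * RatFunc.C a) (by
        intro hne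
        have hne2 : S1.B (e' j) k ≠ 0 := fun h => hne ((hB1.zero_iff j k).1 h)
        have hdv := Int.le_of_dvd (lt_of_le_of_ne hej1' hne2.symm) (hB1.dvd k j)
        obtain ⟨w, hw, hw'⟩ := Psplit hB1 k (PR R) (fun l _ => hO l) (hR1.zero k) (hρO k)
          {none, some (e j)} (by
            intro q hq
            rcases mem_insert.1 hq with rfl | hq
            · rw [hn1]
            · rw [mem_singleton.1 hq]; exact hdv)
        rw [prod_pair (by simp), x1, x2] at hw'
        exact ⟨w, hw, by rw [hb]; exact hw'⟩) (Subring.mul_mem _ PR_X (PR_C haR))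
    rw [← mu_P_other k j hjk] at hw'
    have h5 : Pev d S1.B S1.ρ S1.x j = RatFunc.C (S.x (e j)) * RatFunc.C a := by
      have : P d S1 j = P d S0 j := by
        rw [hS1]; exact P_mu_self hB0.dpos j S0 (hB0.diag j)
      change P d S1 j = _
      rw [this, hPj, ← map_mul, ha', xn, mul_inv_cancel_left₀ hxj]
    have hnu2 : UC R (nu e' S1.B S1.x k j * RatFunc.C (S.x (e j))) :=
      hnu.mul ⟨_, hxR _, hxR' _, hxj, rfl⟩
    obtain ⟨u, h1, h2, h3, h4⟩ := hnu2
    obtain ⟨q, q1, q2, q3⟩ := PR_const h1 hw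
    refine ⟨(-S1.B (e' k) j).toNat, q, q2, by rw [q3]; exact h2, by rw [q3]; exact h3, ?_⟩
    have hCa : RatFunc.C a ≠ 0 := by rw [Ne, map_eq_zero]; exact ha0
    have h6 : xn e' d (mu e' d k S1) j = (RatFunc.C a)⁻¹ * P d (mu e' d k S1) j := by
      rw [xn]; congr 2
      have : e' j ≠ e' k := fun h => hjk (hB1.inj h)
      simp only [mu, if_neg this]; exact x2
    rw [h6, mul_left_comm, ← hek0, hw', h5, ← q1, ← h4]
    field_simp

/-- The Laurent phenomenon. -/
theorem laurent_aux (ℓ : ℕ) : ∀ {I F : Type} [Fintype I] [DecidableEq I] [Field F] (e : N → I)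
    (A : Subring F) (S : GS I N F) (L : List N), L.length ≤ ℓ → GoodB e d D S.B →
    GoodR d A S.ρ → NV e d L S → ∀ k, (ms e d L S).x k ∈ W e d A ∅ S := by
  induction ℓ with
  | zero =>
    intro I F _ _ _ e A S L hL hB hR hN k
    have : L = [] := List.length_eq_zero_iff.1 (by omega)
    subst this
    exact W_x k
  | succ ℓ ih =>
    intro I F _ _ _ e A S L hL hB hR hN k
    match L, hL, hN with
    | [], _, _ => exact W_x k
    | [j], _, _ =>
      by_cases hk : k = e j
      · subst hk
        simp only [ms, mu, if_true, xn]
        refine Subring.mul_mem _ (W_inv (by simp)) ?_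
        exact P_mem' hR (fun a => W_A) (fun l => W_x l)
      · simp only [ms, mu, if_neg hk]; exact W_x k
    | j :: l :: L', hL, hN =>
      have hPj : P d S j ≠ 0 := by
        have := hN.2.init (e j)
        simp only [mu, if_true, xn] at this
        exact right_ne_zero_of_mul this
      by_cases hjl : j = l
      · subst hjl
        have hm := mu_mu hB j S rfl (hN.1 _) hPj
        have hS : SR d Eq S (mu e d j (mu e d j S)) :=
          ⟨hm.B.symm, fun k => (hm.x k).symm, fun i r hr => (hm.ρ i r hr).symm⟩
        obtain ⟨h1, h2⟩ := NV_congr hS hN.2.2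
        have := ih e A S L' (by simp at hL; omega) hB hR h1 k
        rw [h2] at this
        exact this
      -- main case, after a possible flip
      have main : ∀ (S : GS I N F), GoodB e d D S.B → GoodR d A S.ρ → NV e d (j :: l :: L') S →
          0 ≤ S.B (e l) j → P d S j ≠ 0 →
          ∀ k, (ms e d (j :: l :: L') S).x k ∈ W e d A ∅ S := by
        intro S hB hR hN hpos hPj k
        obtain ⟨g1, g2⟩ := gen_setup (e := e) l S _ hN
        set e' : N → Option I := fun i => Option.some (e i) with he'
        set S0 := gen none (addRow l d S) with hS0
        have hB0 : GoodB e' d D S0.B := addRow_good l S hB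
        have hR0 : GoodR d (A.map RatFunc.C) S0.ρ := gen_goodR hR
        obtain ⟨x1, ⟨a, a1, a2, a3⟩, x3, ⟨q, q1, q2, q3, q4⟩, ⟨M, p, p1, p2, p3, p4⟩⟩ :=
          laurent_local e A S j l hjl hB hR hN.1 hpos hPj _ rfl (mu e' d j S0) rfl
        set S1 := mu e' d j S0 with hS1
        set R := W e d A ∅ S with hRdef
        have hB1 : GoodB e' d D S1.B := hB0.mm j
        have hR1 : GoodR d (A.map RatFunc.C) S1.ρ := hR0.mu j
        set S2 := mu e' d l S1 with hS2
        have hB2 : GoodB e' d D S2.B := hB1.mm l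
        have hR2 : GoodR d (A.map RatFunc.C) S2.ρ := hR1.mu l
        set y := (ms e' d (j :: l :: L') S0).x (some k) with hy
        have hxl : S.x (e l) ≠ 0 := hN.1 _
        have hCl : RatFunc.C (S.x (e l)) ≠ 0 := by rw [Ne, map_eq_zero]; exact hxl
        have hlen : (l :: L').length ≤ ℓ := by simp at hL ⊢; omega
        -- first: y is Laurent with arbitrary coefficients
        have y1 : y ∈ LP (⊤ : Subring F) := by
          have h := ih e' _ S1 (l :: L') hlen hB1 hR1 g1.2 (some k)
          refine W_le (R := LP ⊤) ?_ ?_ ?_ (by simp) h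
          · rintro _ ⟨b, _, rfl⟩; exact LP_C (Subring.mem_top _)
          · rintro (_ | i)
            · rw [x1]; exact LP_X
            · by_cases hi : i = e j
              · rw [hi, a3]; exact LP_C (Subring.mem_top _)
              · rw [x3 i hi]; exact LP_C (Subring.mem_top _)
          · rintro (_ | i) _
            · rw [x1]; exact LP_Xinv
            · by_cases hi : i = e j
              · rw [hi, a3, ← map_inv₀]; exact LP_C (Subring.mem_top _)
              · rw [x3 i hi, ← map_inv₀]; exact LP_C (Subring.mem_top _)
        -- second
        have hP2 : xn e' d S2 j ≠ 0 := by
          intro h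
          rw [h, mul_zero] at p4
          have : p = 0 := am_inj (by rw [← p4, map_zero])
          rw [this] at p3; simp at p3
        have hPS2 : P d S2 j ≠ 0 := right_ne_zero_of_mul hP2
        have hm := mu_mu hB2 j S2 rfl (g1.2.2.init _) hPS2
        obtain ⟨n1, n2⟩ := NV_congr hm g1.2.2
        have nv3 : NV e' d (j :: L') (mu e' d j S2) := by
          refine ⟨fun i => ?_, n1⟩
          by_cases hi : i = e' j
          · subst hi; simp only [mu, if_true]; exact hP2
          · simp only [mu, if_neg hi]; exact g1.2.2.init i
        have y2 := ih e' _ (mu e' d j S2) (j :: L') (by simp at hlen ⊢; omega) (hB2.mm j) (hR2.mu j)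
          nv3 (some k)
        have y3 : (ms e' d (j :: L') (mu e' d j S2)).x (some k) = y := n2 (some k)
        rw [y3] at y2
        have hAR : ∀ b ∈ A, b ∈ R := fun b => W_A
        have hxR : ∀ i, S.x i ∈ R := fun i => W_x i
        have hxR' : ∀ i, (S.x i)⁻¹ ∈ R := fun i => W_inv (by simp)
        have hqL : algebraMap F[X] (RatFunc F) q ∈ LP R := am_mem LP_X fun w => LP_C (q1 w)
        have hpL : algebraMap F[X] (RatFunc F) p ∈ LP R := am_mem LP_X fun w => LP_C (p1 w)
        have hQ : algebraMap F[X] (RatFunc F) (q * p) ∈ LP R := by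
          rw [map_mul]; exact (LP R).mul_mem hqL hpL
        have hCinv : (RatFunc.C (S.x (e l)))⁻¹ ∈ LP R := by rw [← map_inv₀]; exact LP_C (hxR' _)
        -- cluster of S3
        have z1 : (mu e' d j S2).x (e' j) = xn e' d S2 j := by simp [mu]
        have hne : e' j ≠ e' l := fun h => hjl (hB0.inj h)
        have z2 : (mu e' d j S2).x (e' l) = xn e' d S1 l := by simp [mu, hne.symm, hS2]
        have z3 : ∀ i, i ≠ e' j → i ≠ e' l → (mu e' d j S2).x i = S1.x i := by
          intro i h1 h2; simp [mu, h1, hS2, h2]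
        have hbq : xn e' d S1 l = (RatFunc.C (S.x (e l)))⁻¹ * algebraMap F[X] (RatFunc F) q := by
          rw [← q4, inv_mul_cancel_left₀ hCl]
        have hap : xn e' d S2 j = (RatFunc.C (S.x (e l)))⁻¹ ^ M * algebraMap F[X] (RatFunc F) p := by
          rw [← p4, inv_pow, inv_mul_cancel_left₀ (pow_ne_zero _ hCl)]
        have hq0 : algebraMap F[X] (RatFunc F) q ≠ 0 := am_ne (by rintro rfl; simp at q3)
        have hp0 : algebraMap F[X] (RatFunc F) p ≠ 0 := am_ne (by rintro rfl; simp at p3)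
        have y4 : y ∈ Lc (LP R) _ hQ := by
          refine W_le (R := Lc (LP R) _ hQ) ?_ ?_ ?_ (by simp) y2
          · rintro _ ⟨b, hb, rfl⟩; exact Lc_of (LP_C (hAR b hb))
          · intro i
            by_cases h1 : i = e' j
            · rw [h1, z1, hap]
              exact Lc_of ((LP R).mul_mem ((LP R).pow_mem hCinv _) hpL)
            by_cases h2 : i = e' l
            · rw [h2, z2, hbq]
              exact Lc_of ((LP R).mul_mem hCinv hqL)
            rw [z3 i h1 h2]
            cases i with
            | none => rw [x1]; exact Lc_of LP_X
            | some i => rw [x3 i (fun h => h1 (by rw [h]))]; exact Lc_of (LP_C (hxR i))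
          · intro i _
            by_cases h1 : i = e' j
            · rw [h1, z1, hap]
              refine Lc_mk 1 ?_
              have : (algebraMap F[X] (RatFunc F) (q * p)) ^ 1 *
                  ((RatFunc.C (S.x (e l)))⁻¹ ^ M * algebraMap F[X] (RatFunc F) p)⁻¹ =
                  algebraMap F[X] (RatFunc F) q * RatFunc.C (S.x (e l)) ^ M := by
                rw [map_mul, pow_one, inv_pow]; field_simp
              rw [this]
              exact (LP R).mul_mem hqL ((LP R).pow_mem (LP_C (hxR _)) _)
            by_cases h2 : i = e' l
            · rw [h2, z2, hbq]
              refine Lc_mk 1 ?_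
              have : (algebraMap F[X] (RatFunc F) (q * p)) ^ 1 *
                  ((RatFunc.C (S.x (e l)))⁻¹ * algebraMap F[X] (RatFunc F) q)⁻¹ =
                  algebraMap F[X] (RatFunc F) p * RatFunc.C (S.x (e l)) := by
                rw [map_mul, pow_one]; field_simp
              rw [this]
              exact (LP R).mul_mem hpL (LP_C (hxR _))
            rw [z3 i h1 h2]
            cases i with
            | none => rw [x1]; exact Lc_of LP_Xinv
            | some i =>
              rw [x3 i (fun h => h1 (by rw [h])), ← map_inv₀]; exact Lc_of (LP_C (hxR' i))
        obtain ⟨M', hM'⟩ := y4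
        have y5 : y ∈ LP R := by
          refine LP_div_pow (q := q * p) y1 ?_ ?_ ?_ M' hM'
          · intro w
            rw [Polynomial.coeff_mul]
            exact R.sum_mem fun i _ => R.mul_mem (q1 _) (p1 _)
          · rw [Polynomial.mul_coeff_zero, mul_inv]; exact R.mul_mem q2 p2
          · rw [Polynomial.mul_coeff_zero]; exact mul_ne_zero q3 p3
        obtain ⟨b, b1, b2⟩ := LP_spec y5
        rw [Sp.unique (g2 k) b2]
        exact b1
      by_cases hpos : 0 ≤ S.B (e l) j
      · exact main S hB hR hN hpos hPj k
      · have h := main (flip d S) hB.flip hR.flip (NV_flip hB.dpos _ S hN)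
          (by simp only [flip]; linarith) (by rw [P_flip hB.dpos]; exact hPj) k
        rw [ms_flip hB.dpos] at h
        exact W_flip h

theorem laurent {I F : Type} [Fintype I] [DecidableEq I] [Field F] {e : N → I}
    {A : Subring F} {S : GS I N F} {L : List N} (hB : GoodB e d D S.B)
    (hR : GoodR d A S.ρ) (hN : NV e d L S) (k : I) : (ms e d L S).x k ∈ W e d A ∅ S :=
  laurent_aux L.length e A S L le_rfl hB hR hN k

end laurent
end GCX

open Finset
set_option linter.unusedSectionVars false
set_option linter.unusedVariables false

namespace GCX
open GCA Polynomial

theorem combine {F : Type} [Field F] {y : RatFunc F} {D1 E : Subring F} {Q : F} (hQ : Q ≠ 0)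
    (h1 : y ∈ LP D1) (h2 : y ∈ Phi E Q hQ) (h3 : ∀ a ∈ E, ∀ n : ℕ, Q ^ n * a ∈ D1 → a ∈ D1)
    {W : Subring (RatFunc F)} (hC : ∀ a ∈ D1, RatFunc.C a ∈ W) (hX : RatFunc.X ∈ W)
    (hX' : RatFunc.C Q * RatFunc.X⁻¹ ∈ W) : y ∈ W := by
  obtain ⟨M, p, hp, hp'⟩ := mem_LP.1 h1
  obtain ⟨M', p', hq, hq'⟩ := mem_Phi.1 h2
  have hX0 := X_ne (F := F)
  have h4 : p * X ^ M' = p' * X ^ M := by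
    apply am_inj
    rw [map_mul, map_mul, ← hp, ← hq, map_pow, map_pow, RatFunc.algebraMap_X]; ring
  have h5 : ∀ w, (p * X ^ M').coeff w ∈ D1 := by
    intro w
    rw [Polynomial.coeff_mul_X_pow']
    split_ifs
    exacts [hp' _, D1.zero_mem]
  have h6 : ∀ w : ℕ, (p * X ^ M').coeff w * Q ^ ((w : ℤ) - (M + M' : ℕ)) ∈ E := by
    intro w
    rw [h4, Polynomial.coeff_mul_X_pow']
    split_ifs with h
    · have := hq' (w - M)
      rw [Nat.cast_sub h] at this
      convert this using 3; push_cast; ring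
    · simp
  have h7 : RatFunc.X ^ (M + M') * y = algebraMap F[X] (RatFunc F) (p * X ^ M') := by
    rw [map_mul, ← hp, map_pow, RatFunc.algebraMap_X]; ring
  generalize p * X ^ M' = s at h5 h6 h7
  generalize M + M' = K at h6 h7
  have h8 : y = ∑ w ∈ range (s.natDegree + 1), RatFunc.X⁻¹ ^ K * (RatFunc.C (s.coeff w) * RatFunc.X ^ w) := by
    rw [← mul_sum]
    have : algebraMap F[X] (RatFunc F) s = ∑ w ∈ range (s.natDegree + 1),
        (RatFunc.C (s.coeff w) * RatFunc.X ^ w) := by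
      conv_lhs => rw [s.as_sum_range_C_mul_X_pow]
      rw [map_sum]
      refine sum_congr rfl fun i _ => ?_
      rw [map_mul, map_pow, RatFunc.algebraMap_X, RatFunc.algebraMap_C]
    rw [← this, ← h7, inv_pow, inv_mul_cancel_left₀ (pow_ne_zero _ hX0)]
  rw [h8]
  refine W.sum_mem fun w _ => ?_
  rcases le_total K w with hw | hw
  · obtain ⟨v, rfl⟩ := Nat.exists_eq_add_of_le hw
    have : RatFunc.X⁻¹ ^ K * (RatFunc.C (s.coeff (K + v)) * RatFunc.X ^ (K + v)) =
        RatFunc.C (s.coeff (K + v)) * RatFunc.X ^ v := by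
      rw [pow_add, inv_pow]; field_simp
    rw [this]
    exact W.mul_mem (hC _ (h5 _)) (W.pow_mem hX _)
  · obtain ⟨v, rfl⟩ := Nat.exists_eq_add_of_le hw
    have h9 := h6 w
    rw [show (w : ℤ) - (w + v : ℕ) = -(v : ℤ) by push_cast; ring, zpow_neg, zpow_natCast] at h9
    have h10 : s.coeff w = Q ^ v * (s.coeff w * (Q ^ v)⁻¹) := by field_simp
    have h11 := h3 _ h9 v (by rw [← h10]; exact h5 w)
    have : RatFunc.X⁻¹ ^ (w + v) * (RatFunc.C (s.coeff w) * RatFunc.X ^ w) =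
        RatFunc.C (s.coeff w * (Q ^ v)⁻¹) * (RatFunc.C Q * RatFunc.X⁻¹) ^ v := by
      conv_lhs => rw [h10, mul_comm (Q ^ v), map_mul, map_pow]
      rw [mul_pow, pow_add, inv_pow, inv_pow]; field_simp
    rw [this]
    exact W.mul_mem (hC _ h11) (W.pow_mem hX' _)

theorem coprime_mem {F : Type} [Field F] {R : Subring F} {a b u v y : F} (ha : a ∈ R) (hb : b ∈ R)
    (hu : u ∈ R) (hv : v ∈ R) (h : u * a + v * b = 1) (n m : ℕ) (h1 : a ^ n * y ∈ R)
    (h2 : b ^ m * y ∈ R) : y ∈ R := by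
  have hc : IsCoprime (⟨a, ha⟩ : R) ⟨b, hb⟩ := ⟨⟨u, hu⟩, ⟨v, hv⟩, Subtype.ext h⟩
  obtain ⟨s, t, hst⟩ := (hc.pow (m := n) (n := m))
  have hst' := congrArg (Subtype.val) hst
  simp only [Subring.coe_add, Subring.coe_mul, SubmonoidClass.coe_pow, Subring.coe_one] at hst'
  have : y = s.1 * (a ^ n * y) + t.1 * (b ^ m * y) := by
    rw [← mul_assoc, ← mul_assoc, ← add_mul, hst', one_mul]
  rw [this]
  exact R.add_mem (R.mul_mem s.2 h1) (R.mul_mem t.2 h2)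

section vthm
variable {N : Type} [DecidableEq N] {d : N → ℕ} {D : N → ℤ}

theorem W_erase {I F : Type} [Fintype I] [DecidableEq I] [Field F] {e : N → I}
    {A : Subring F} {S : GS I N F} {G : Finset N} {i : N} (hi : S.x (e i) ≠ 0) {y : F}
    (hy : y ∈ W e d A (G.erase i) S) : ∃ M : ℕ, S.x (e i) ^ M * y ∈ W e d A G S := by
  suffices h : W e d A (G.erase i) S ≤ Lc (W e d A G S) (S.x (e i)) (W_x _) from h hy
  refine W_le (fun a ha => Lc_of (W_A ha)) (fun k => Lc_of (W_x k)) ?_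
    (fun j hj => Lc_of (W_xn (mem_of_mem_erase hj)))
  intro k hk
  by_cases h : k = e i
  · subst h
    refine Lc_mk 1 ?_
    rw [pow_one, mul_inv_cancel₀ hi]; exact Subring.one_mem _
  · refine Lc_of (W_inv fun j hj => ?_)
    by_cases hji : j = i
    · rw [hji]; exact h
    · exact hk j (mem_erase.2 ⟨hji, hj⟩)

set_option maxHeartbeats 4000000 in
theorem V_noedge {I F : Type} [Fintype I] [DecidableEq I] [Field F] (e : N → I)
    (A : Subring F) (S : GS I N F) (L : List N) (hB : GoodB e d D S.B)
    (hR : GoodR d A S.ρ) (hN : NV e d L S) (G : Finset N) (i : N) (hi : i ∈ G)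
    (hE : ∀ k ∈ G, ∀ l ∈ G, S.B (e k) l = 0)
    (IH : ∀ (S2 : GS (Option I) N (RatFunc (RatFunc F))),
      S2 = gen (some (e i)) (gen none (addRow i d S)) →
      NV (fun i => Option.some (e i)) d L S2 → ∀ k,
      (ms (fun i => Option.some (e i)) d L S2).x k ∈
        W (fun i => Option.some (e i)) d ((A.map RatFunc.C).map RatFunc.C) (G.erase i) S2) :
    ∀ k, (ms e d L S).x k ∈ W e d A G S := by
  intro k
  obtain ⟨g1, g2⟩ := gen_setup (e := e) i S _ hN
  set e' : N → Option I := fun i => Option.some (e i) with he'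
  set S1 := gen none (addRow i d S) with hS1
  have hB1 : GoodB e' d D S1.B := addRow_good i S hB
  have hR1 : GoodR d (A.map RatFunc.C) S1.ρ := gen_goodR hR
  set S2 := gen (some (e i)) S1 with hS2
  have hB2 : GoodB e' d D S2.B := hB1
  have hR2 : GoodR d ((A.map RatFunc.C).map RatFunc.C) S2.ρ := gen_goodR hR1
  obtain ⟨g3, g4⟩ := SR.ms (e := e') (spRel _) (gen_rel (d := d) (some (e i)) S1) g1
  have hk1 : Sp _ ((ms e' d L S2).x (some k)) ((ms e' d L S1).x (some k)) := g3.x (some k)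
  set y := (ms e' d L S2).x (some k) with hy
  have s1 : ∀ l, S1.x (some l) = RatFunc.C (S.x l) := fun l => by simp [hS1, gen, addRow]
  have s1n : S1.x none = RatFunc.X := by simp [hS1, gen]
  have s2 : ∀ l, l ≠ e i → S2.x (some l) = RatFunc.C (RatFunc.C (S.x l)) := fun l hl => by
    rw [← s1]; simp [hS2, gen, hl]
  have s2n : S2.x none = RatFunc.C (RatFunc.X : RatFunc F) := by rw [← s1n]; simp [hS2, gen]
  have s2i : S2.x (some (e i)) = RatFunc.X := by simp [hS2, gen]
  have b1n : ∀ l, S1.B none l = if l = i then (d i : ℤ) else 0 := fun l => rfl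
  have hQ2 : P d S2 i = RatFunc.C (P d S1 i) := gen_P _ _ _ (hB1.diag i)
  have hxn : ∀ l ∈ G.erase i, xn e' d S2 l = RatFunc.C (RatFunc.C (xn e d S l)) := by
    intro l hl
    obtain ⟨hl1, hl2⟩ := mem_erase.1 hl
    have : P d S2 l = RatFunc.C (RatFunc.C (P d S l)) := by
      rw [hS2, gen_P _ _ _ (show S1.B (some (e i)) l = 0 from hE i hi l hl2), hS1,
        gen_P none _ l (by simp [addRow, hl1]), (addRow_rel (d := d) i S).P]
    rw [xn, this, xn, show e' l = some (e l) from rfl, s2 _ (fun h => hl1 (hB.inj h))]; simp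
  -- coefficient ring
  set D0 : Subring F := Subring.closure {y | y ∈ A ∨ (∃ k, k ≠ e i ∧ y = S.x k) ∨
    (∃ k, (∀ i ∈ G, k ≠ e i) ∧ y = (S.x k)⁻¹) ∨ ∃ l ∈ G.erase i, y = xn e d S l} with hD0
  have dA : ∀ a ∈ A, a ∈ D0 := fun a ha => Subring.subset_closure (Or.inl ha)
  have dx : ∀ k, k ≠ e i → S.x k ∈ D0 := fun k hk =>
    Subring.subset_closure (Or.inr (Or.inl ⟨k, hk, rfl⟩))
  have dinv : ∀ k, (∀ i ∈ G, k ≠ e i) → (S.x k)⁻¹ ∈ D0 := fun k hk =>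
    Subring.subset_closure (Or.inr (Or.inr (Or.inl ⟨k, hk, rfl⟩)))
  have dxn : ∀ l ∈ G.erase i, xn e d S l ∈ D0 := fun k hk =>
    Subring.subset_closure (Or.inr (Or.inr (Or.inr ⟨k, hk, rfl⟩)))
  -- the exchange polynomial of direction i
  have hq : ∃ q : F[X], P d S1 i = algebraMap F[X] (RatFunc F) q ∧ (∀ w, q.coeff w ∈ D0) ∧
      (q.coeff 0)⁻¹ ∈ D0 ∧ q.coeff 0 ≠ 0 := by
    obtain ⟨w, hw, hw'⟩ := Psplit hB1 (x := S1.x) i (PR D0)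
      (by
        rintro (_ | l) hl
        · rw [s1n]; exact PR_X
        · rw [s1]; exact PR_C (dx l (fun h => hl (by rw [h]))))
      (hR1.zero i) (by
        intro r hr
        obtain ⟨u, hu, hu'⟩ := hR1.mem i r hr
        rw [← hu']; exact PR_C (dA _ hu)) {none} (by simp [b1n])
    rw [prod_singleton, s1n] at hw'
    have hc0 : UC D0 (c0 S1.B S1.x i) := by
      unfold c0
      refine UC.prod _ fun l _ => ?_
      rcases l with _ | l
      · rw [b1n, if_pos rfl, Int.toNat_of_nonpos (by omega), pow_zero]; exact UC.one
      · by_cases hl : ∃ g ∈ G, l = e g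
        · obtain ⟨g, hg, rfl⟩ := hl
          rw [show S1.B (some (e g)) i = 0 from hE g hg i hi]; simpa using UC.one
        · push Not at hl
          rw [s1]
          exact UC.pow ⟨_, dx l (hl i hi), dinv l hl, hN.init l, rfl⟩ _
    obtain ⟨u, h1, h2, h3, h4⟩ := hc0
    rw [h4] at hw'
    obtain ⟨q, q1, q2, q3⟩ := PR_const h1 hw
    exact ⟨q, by rw [← q1]; exact hw', q2, by rw [q3]; exact h2, by rw [q3]; exact h3⟩
  obtain ⟨q, q1, q2, q3, q4⟩ := hq
  have hQ0 : P d S1 i ≠ 0 := by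
    rw [q1]; exact am_ne (by rintro rfl; simp at q4)
  have hQ20 : P d S2 i ≠ 0 := by rw [hQ2, Ne, map_eq_zero]; exact hQ0
  -- first membership
  have y1 : y ∈ LP (LP D0) := by
    refine W_le (R := LP (LP D0)) ?_ ?_ ?_ ?_ (IH S2 rfl g4 (some k))
    · rintro _ ⟨_, ⟨a, ha, rfl⟩, rfl⟩; exact LP_C (F := RatFunc F) (LP_C (F := F) (dA a ha))
    · rintro (_ | l)
      · rw [s2n]; exact LP_C LP_X
      · by_cases hl : l = e i
        · rw [hl, s2i]; exact LP_X
        · rw [s2 l hl]; exact LP_C (LP_C (dx l hl))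
    · rintro (_ | l) hG
      · rw [s2n, ← map_inv₀]; exact LP_C LP_Xinv
      · by_cases hl : l = e i
        · rw [hl, s2i]; exact LP_Xinv
        · rw [s2 l hl, ← map_inv₀, ← map_inv₀]
          refine LP_C (LP_C (dinv l fun g hg => ?_))
          by_cases hgi : g = i
          · rw [hgi]; exact hl
          · exact fun h => hG g (mem_erase.2 ⟨hgi, hg⟩) (by rw [h])
    · intro l hl; rw [hxn l hl]; exact LP_C (LP_C (dxn l hl))
  have hxi : xn e' d S2 i = RatFunc.C (P d S1 i) * RatFunc.X⁻¹ := by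
    rw [xn, hQ2, show e' i = some (e i) from rfl, s2i, mul_comm]
  -- second membership
  have y2 : y ∈ Phi (LP (⊤ : Subring F)) (P d S1 i) hQ0 := by
    have hm := mu_mu hB2 i S2 rfl (g4.init _) hQ20
    obtain ⟨n1, n2⟩ := NV_congr hm g4
    have mx : ∀ l, l ≠ e' i → (mu e' d i S2).x l = S2.x l := fun l hl => by simp [mu, hl]
    have mi : (mu e' d i S2).x (e' i) = xn e' d S2 i := by simp [mu]
    have nv : NV e' d (i :: L) (mu e' d i S2) := by
      refine ⟨fun l => ?_, n1⟩
      by_cases hl : l = e' i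
      · rw [hl, mi, xn]; exact mul_ne_zero (inv_ne_zero (g4.init _)) hQ20
      · rw [mx l hl]; exact g4.init l
    have h := laurent (hB2.mm i : GoodB e' d D (mu e' d i S2).B)
      (hR2.mu i : GoodR d _ (mu e' d i S2).ρ) nv (some k)
    have h' : (ms e' d (i :: L) (mu e' d i S2)).x (some k) = y := n2 (some k)
    rw [h'] at h
    refine W_le (R := Phi (LP (⊤ : Subring F)) (P d S1 i) hQ0) ?_ ?_ ?_ (by simp) h
    · rintro _ ⟨_, ⟨a, ha, rfl⟩, rfl⟩; exact Phi_C (LP_C (Subring.mem_top _))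
    · intro l
      by_cases hl : l = e' i
      · rw [hl, mi, hxi]; exact Phi_Xinv
      · rw [mx l hl]
        rcases l with _ | l
        · rw [s2n]; exact Phi_C LP_X
        · rw [s2 l (fun h => hl (by rw [h]))]; exact Phi_C (LP_C (Subring.mem_top _))
    · intro l _
      by_cases hl : l = e' i
      · rw [hl, mi, hxi, mul_inv, inv_inv, ← map_inv₀]; exact Phi_X
      · rw [mx l hl]
        rcases l with _ | l
        · rw [s2n, ← map_inv₀]; exact Phi_C LP_Xinv
        · rw [s2 l (fun h => hl (by rw [h])), ← map_inv₀, ← map_inv₀]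
          exact Phi_C (LP_C (Subring.mem_top _))
  have y3 : y ∈ W e' d ((A.map RatFunc.C).map RatFunc.C) G S2 := by
    refine combine hQ0 y1 y2 ?_ ?_ ?_ ?_
    · intro a ha n hn
      rw [q1] at hn
      exact LP_div_pow ha q2 q3 q4 n hn
    · intro a ha
      suffices h : LP D0 ≤ (W e' d ((A.map RatFunc.C).map RatFunc.C) G S2).comap RatFunc.C from h ha
      refine LP_le ?_ ?_ ?_
      · intro b hb
        suffices h : D0 ≤ ((W e' d ((A.map RatFunc.C).map RatFunc.C) G S2).comap RatFunc.C).comap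
          RatFunc.C from h hb
        refine Subring.closure_le.2 ?_
        rintro z (h | ⟨l, hl, rfl⟩ | ⟨l, hl, rfl⟩ | ⟨l, hl, rfl⟩)
        · exact W_A ⟨_, ⟨_, h, rfl⟩, rfl⟩
        · refine Subring.mem_comap.2 (Subring.mem_comap.2 ?_)
          rw [← s2 l hl]; exact W_x _
        · refine Subring.mem_comap.2 (Subring.mem_comap.2 ?_)
          rw [map_inv₀, map_inv₀, ← s2 l (hl i hi)]
          exact W_inv fun g hg h => hl g hg (Option.some.inj h)
        · refine Subring.mem_comap.2 (Subring.mem_comap.2 ?_)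
          rw [← hxn l hl]; exact W_xn (mem_of_mem_erase hl)
      · refine Subring.mem_comap.2 ?_
        rw [← s2n]; exact W_x _
      · refine Subring.mem_comap.2 ?_
        rw [map_inv₀, ← s2n]; exact W_inv (by simp [he'])
    · rw [← s2i]; exact W_x _
    · rw [← hxi]; exact W_xn hi
  -- specialize
  have hspec : ∀ {F : Type} [Field F] (A : Subring F) (s : F), ∀ a ∈ A.map RatFunc.C, ∃ b ∈ A, Sp s a b := by
    rintro F _ A s _ ⟨b, hb, rfl⟩; exact ⟨b, hb, Sp.C _ _⟩
  obtain ⟨b, hb, hb'⟩ := W_spec (spRel _) (hspec _ _) (gen_rel (d := d) (some (e i)) S1) g1.init y3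
  rw [Sp.unique hb' hk1] at hb
  obtain ⟨c, hc, hc'⟩ := W_spec (spRel _) (hspec _ _) (gen_rel (d := d) none (addRow i d S))
    ((addRow_rel (d := d) i S).NV (e := e) hN).init hb
  rw [Sp.unique hc' (g2 k)] at hc
  exact W_row (addRow_rel (d := d) i S) hc

theorem V_aux (o : N → ℕ) (ho : Function.Injective o) (n : ℕ) :
    ∀ {I F : Type} [Fintype I] [DecidableEq I] [Field F] (e : N → I)
    (A : Subring F) (S : GS I N F) (L : List N) (G : Finset N), G.card = n → GoodB e d D S.B →
    GoodR d A S.ρ → NV e d L S → (∀ i j, o j < o i → 0 ≤ S.B (e i) j) →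
    ∀ k, (ms e d L S).x k ∈ W e d A G S := by
  induction n with
  | zero =>
    intro I F _ _ _ e A S L G hG hB hR hN hO k
    have : G = ∅ := card_eq_zero.1 hG
    subst this
    exact laurent hB hR hN k
  | succ n ih =>
    intro I F _ _ _ e A S L G hG hB hR hN hO k
    by_cases hE : ∀ k ∈ G, ∀ l ∈ G, S.B (e k) l = 0
    · have : G.Nonempty := by rw [← card_pos]; omega
      obtain ⟨i, hi⟩ := this
      refine V_noedge e A S L hB hR hN G i hi hE ?_ k
      intro S2 hS2 hNV k'
      have hBB : ∀ a l, S2.B (some a) l = S.B a l := by subst hS2; intro a l; rfl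
      refine ih _ _ S2 L (G.erase i) (by rw [card_erase_of_mem hi]; omega) ?_ ?_ hNV ?_ k'
      · subst hS2; exact addRow_good i S hB
      · subst hS2; exact gen_goodR (gen_goodR hR)
      · intro a b hab; rw [hBB]; exact hO a b hab
    · push Not at hE
      obtain ⟨k0, hk0, l0, hl0, h0⟩ := hE
      obtain ⟨i, hi, hmin⟩ := exists_min_image (G.filter fun i => ∃ k ∈ G, S.B (e k) i ≠ 0) o
        ⟨l0, mem_filter.2 ⟨hl0, k0, hk0, h0⟩⟩
      obtain ⟨hiG, k1, hk1, hki⟩ := mem_filter.1 hi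
      have hpos : ∀ l ∈ G, 0 ≤ S.B (e l) i := by
        intro l hl
        by_cases h : S.B (e l) i = 0
        · rw [h]
        · have h2 : S.B (e i) l ≠ 0 := fun h' => h ((hB.zero_iff l i).2 h')
          have h3 := hmin l (mem_filter.2 ⟨hl, i, hiG, h2⟩)
          rcases h3.lt_or_eq with h4 | h4
          · exact hO l i h4
          · have := ho h4; subst this; exact absurd (hB.diag i) h
      have hx0 := hN.init
      obtain ⟨w, hw, hw'⟩ := Psplit hB (ρ := S.ρ) (x := S.x) i (W e d A G S) (fun l _ => W_x l)
        (hR.zero i) (fun r hr => W_A (hR.mem i r hr)) {e k1} (by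
          intro q hq
          rw [mem_singleton.1 hq]
          exact Int.le_of_dvd (lt_of_le_of_ne (hpos k1 hk1) hki.symm) (hB.dvd i k1))
      rw [prod_singleton] at hw'
      have hc0 : c0 S.B S.x i ≠ 0 := prod_ne_zero_iff.2 fun l _ => pow_ne_zero _ (hx0 l)
      have hcinv : (c0 S.B S.x i)⁻¹ ∈ W e d A G S := by
        unfold c0
        rw [← prod_inv_distrib]
        refine Subring.prod_mem _ fun l _ => ?_
        by_cases hl : ∃ g ∈ G, l = e g
        · obtain ⟨g, hg, rfl⟩ := hl
          rw [Int.toNat_of_nonpos (by have := hpos g hg; omega)]; simp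
        · push Not at hl
          rw [← inv_pow]; exact Subring.pow_mem _ (W_inv hl) _
      have hxi : S.x (e i) * xn e d S i = Pev d S.B S.ρ S.x i := by
        rw [xn, mul_inv_cancel_left₀ (hx0 _)]; rfl
      obtain ⟨n1, h1⟩ := W_erase (hx0 (e i)) (ih e A S L (G.erase i)
        (by rw [card_erase_of_mem hiG]; omega) hB hR hN hO k)
      obtain ⟨n2, h2⟩ := W_erase (hx0 (e k1)) (ih e A S L (G.erase k1)
        (by rw [card_erase_of_mem hk1]; omega) hB hR hN hO k)
      refine coprime_mem (W_x (e i)) (W_x (e k1)) (Subring.mul_mem _ hcinv (W_xn hiG))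
        (Subring.neg_mem _ (Subring.mul_mem _ hcinv hw)) ?_ n1 n2 h1 h2
      have : S.x (e i) * xn e d S i - S.x (e k1) * w = c0 S.B S.x i := by rw [hxi, hw']; ring
      field_simp
      rw [← this]; ring

end vthm
end GCX

open Finset
set_option linter.unusedSectionVars false
set_option linter.unusedVariables false

namespace GCX
open GCA

/-- Abstract version of `seedUpTo`. -/
noncomputable def su {n : ℕ} {I F : Type} [Fintype I] [DecidableEq I] [Field F] (e : Fin n → I)
    (d : Fin n → ℕ) (S : GS I (Fin n) F) : ℕ → GS I (Fin n) F
  | 0 => S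
  | k + 1 => if h : k < n then mu e d ⟨k, h⟩ (su e d S k) else su e d S k

/-- Rotated order. -/
def rot (n k i : ℕ) : ℕ := if i < k then i + n else i

section hyb
variable {n : ℕ} {I F : Type} [Fintype I] [DecidableEq I] [Field F] {e : Fin n → I}
  {d : Fin n → ℕ} {D : Fin n → ℤ} {A O : Subring F} {S : GS I (Fin n) F}

theorem su_succ (k : Fin n) : su e d S (k + 1) = mu e d k (su e d S k) := by
  rw [su, dif_pos k.2]

theorem su_good (hB : GoodB e d D S.B) (hR : GoodR d A S.ρ) (k : ℕ) :
    GoodB e d D (su e d S k).B ∧ GoodR d A (su e d S k).ρ := by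
  induction k with
  | zero => exact ⟨hB, hR⟩
  | succ k ih =>
    by_cases h : k < n
    · have := su_succ (e := e) (d := d) (S := S) ⟨k, h⟩
      rw [this]
      exact ⟨ih.1.mm _, ih.2.mu _⟩
    · rw [su, dif_neg h]; exact ih

theorem su_x (k : ℕ) (l : I) (h : ∀ i : Fin n, l = e i → k ≤ i) : (su e d S k).x l = S.x l := by
  induction k with
  | zero => rfl
  | succ k ih =>
    by_cases hk : k < n
    · have := su_succ (e := e) (d := d) (S := S) ⟨k, hk⟩
      rw [this]
      simp only [mu]
      rw [if_neg, ih (fun i hi => by have := h i hi; omega)]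
      intro hl
      have := h _ hl
      simp at this
    · rw [su, dif_neg hk]; exact ih (fun i hi => by have := h i hi; omega)

theorem su_x_lt (he : Function.Injective e) (k : ℕ) (i : Fin n) (h : i < k) :
    (su e d S k).x (e i) = xn e d (su e d S i) i := by
  induction k with
  | zero => omega
  | succ k ih =>
    by_cases hk : k < n
    · have := su_succ (e := e) (d := d) (S := S) ⟨k, hk⟩
      rw [this]
      simp only [mu]
      by_cases hik : (i : ℕ) = k
      · have : i = ⟨k, hk⟩ := Fin.ext hik
        subst this; simp
      · rw [if_neg, ih (by omega)]
        intro h'; exact hik (congrArg Fin.val (he h'))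
    · rw [su, dif_neg hk]; exact ih (by have := i.2; omega)

theorem su_ord (hB : GoodB e d D S.B) (hR : GoodR d A S.ρ)
    (hO : ∀ i j : Fin n, j < i → 0 ≤ S.B (e i) j) (k : ℕ) (hk : k ≤ n) :
    ∀ i j : Fin n, rot n k j < rot n k i → 0 ≤ (su e d S k).B (e i) j := by
  induction k with
  | zero => intro i j h; exact hO i j (by simpa [rot] using h)
  | succ k ih =>
    have ih := ih (by omega)
    set s : Fin n := ⟨k, hk⟩ with hs
    have hG := (su_good hB hR k).1
    have := su_succ (e := e) (d := d) (S := S) s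
    rw [show (s : ℕ) = k from rfl] at this
    rw [this]
    have hp : ∀ l, 0 ≤ (su e d S k).B (e l) s := by
      intro l
      by_cases hl : l = s
      · rw [hl, hG.diag]
      · apply ih
        have h2 := l.2
        have h1 : (l : ℕ) ≠ k := fun h => hl (Fin.ext h)
        simp only [rot, hs]; split_ifs <;> omega
    intro i j hij
    show 0 ≤ mm e s _ (e i) j
    by_cases hj : j = s
    · subst hj
      exfalso
      have h2 := i.2
      simp only [rot, hs] at hij; split_ifs at hij <;> omega
    · have hsj : (su e d S k).B (e s) j ≤ 0 := (hG.nonneg_iff j s).1 (hp j)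
      by_cases hi : i = s
      · subst hi; rw [mm_self_row]; omega
      · rw [mm_other_nonpos _ _ _ (fun h => hi (hG.inj h)) hj hsj]
        have h1 := hp i
        rw [max_eq_right (by omega)]
        simp only [zero_mul, sub_zero]
        have := ih i j ?_
        · linarith
        · have h1 : (i : ℕ) ≠ k := fun h => hi (Fin.ext h)
          have h2 : (j : ℕ) ≠ k := fun h => hj (Fin.ext h)
          simp only [rot] at hij ⊢; split_ifs at hij ⊢ <;> omega

theorem hyb (hB : GoodB e d D S.B) (hR : GoodR d A S.ρ) (hx : ∀ k, S.x k ≠ 0)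
    (hO : ∀ i j : Fin n, j < i → 0 ≤ S.B (e i) j) (hA : ∀ a ∈ A, a ∈ O) (hxO : ∀ k, S.x k ∈ O)
    (hinv : ∀ k, (∀ i, k ≠ e i) → (S.x k)⁻¹ ∈ O) (hp : ∀ i : Fin n, (su e d S n).x (e i) ∈ O)
    (j : Fin n) : xn e d S j ∈ O := by
  have hproj : ∀ i : Fin n, xn e d (su e d S i) i ∈ O := fun i => by
    rw [← su_x_lt hB.inj n i i.2]; exact hp i
  suffices h : ∀ t k : ℕ, k + t = j → xn e d (su e d S k) j ∈ O from h j 0 (by simp)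
  intro t
  induction t with
  | zero => intro k hk; rw [show k = j by omega]; exact hproj j
  | succ t ih =>
    intro k hk
    have hkn : k < n := by have := j.2; omega
    set s : Fin n := ⟨k, hkn⟩ with hs
    set T := su e d S k with hT
    obtain ⟨hG, hG'⟩ := su_good hB hR k
    have hord := su_ord hB hR hO k hkn.le
    rw [← hT] at hG hG' hord
    have ih1 := ih (k + 1) (by omega)
    have hsu := su_succ (e := e) (d := d) (S := S) s
    rw [show (s : ℕ) = k from rfl, ← hT] at hsu
    rw [hsu] at ih1
    have hpos : ∀ l, 0 ≤ T.B (e l) s := by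
      intro l
      by_cases hl : l = s
      · rw [hl, hG.diag]
      · apply hord
        have h2 := l.2
        have h1 : (l : ℕ) ≠ k := fun h => hl (Fin.ext h)
        simp only [rot, hs]; split_ifs <;> omega
    have hsj : s ≠ j := fun h => by
      have := congrArg Fin.val h
      simp only [hs] at this; omega
    have hneg : ∀ l, T.B (e s) l ≤ 0 := fun l => (hG.nonneg_iff l s).1 (hpos l)
    have hfro : ∀ l, (∀ i, l ≠ e i) → T.x l = S.x l := fun l hl =>
      su_x k l fun i hi => absurd hi (hl i)
    have hTs : T.x (e s) = S.x (e s) := su_x k _ fun i hi => by rw [← hG.inj hi]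
    have hTj : T.x (e j) = S.x (e j) := su_x k _ fun i hi => by rw [← hG.inj hi]; omega
    have hTx : ∀ l, T.x l ∈ O := by
      intro l
      by_cases hl : ∃ i, l = e i
      · obtain ⟨i, rfl⟩ := hl
        rcases lt_or_ge (i : ℕ) k with h | h
        · rw [hT, su_x_lt hB.inj k i h]; exact hproj i
        · rw [hT, su_x k _ fun i' hi' => by rw [← hG.inj hi']; exact h]; exact hxO _
      · push Not at hl
        rw [hfro l hl]; exact hxO l
    have hTρ : ∀ i r, r ≤ d i → T.ρ i r ∈ O := fun i r hr => hA _ (hG'.mem i r hr)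
    obtain ⟨w, hw, hw'⟩ := R2H hG (ρ := T.ρ) (x := T.x) s j hsj (hneg j) O hTx (hTρ j)
      (by
        intro l
        by_cases hl : ∃ i, l = e i
        · obtain ⟨i, rfl⟩ := hl; exact Or.inr (hpos i)
        · push Not at hl
          left; rw [hfro l hl]; exact hx l)
      (xn e d T s) (T.x (e j))
      (by
        intro h0
        obtain ⟨w, hw, hw'⟩ := Psplit hG (ρ := T.ρ) (x := T.x) s O (fun l _ => hTx l)
          (hG'.zero s) (hTρ s) {e j} (by
            intro q hq
            rw [mem_singleton.1 hq]
            refine Int.le_of_dvd (lt_of_le_of_ne (hpos j) ?_) (hG.dvd s j)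
            exact fun h => h0 ((hG.zero_iff s j).2 h.symm))
        refine ⟨w, hw, ?_⟩
        rw [xn, mul_inv_cancel_left₀ (by rw [hTs]; exact hx _)]
        rw [prod_singleton] at hw'; exact hw') (hTx _)
    rw [← mu_P_other s j hsj.symm T] at hw'
    have hxj : T.x (e j) ≠ 0 := by rw [hTj]; exact hx _
    have hmx : (mu e d s T).x (e j) = T.x (e j) := by
      simp only [mu]; rw [if_neg fun h => hsj (hG.inj h).symm]
    have h1 : P d (mu e d s T) j = T.x (e j) * xn e d (mu e d s T) j := by
      rw [xn, hmx, mul_inv_cancel_left₀ hxj]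
    have h2 : Pev d T.B T.ρ T.x j = T.x (e j) * xn e d T j := by
      rw [xn, mul_inv_cancel_left₀ hxj]; rfl
    rw [h1, h2] at hw'
    have h3 : nu e T.B T.x s j * xn e d T j =
        T.x (e s) ^ (-T.B (e s) j).toNat * xn e d (mu e d s T) j - w := by
      apply mul_left_cancel₀ hxj
      linear_combination -hw'
    have hnu : nu e T.B T.x s j ≠ 0 ∧ (nu e T.B T.x s j)⁻¹ ∈ O := by
      unfold nu
      rw [← prod_inv_distrib, prod_ne_zero_iff]
      have key : ∀ l ∈ univ.erase (e s), T.x l ^ (max (-mm e s T.B l j) 0 - max (-T.B l j) 0) ≠ 0 ∧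
          (T.x l ^ (max (-mm e s T.B l j) 0 - max (-T.B l j) 0))⁻¹ ∈ O := by
        intro l hl
        have hl := (mem_erase.1 hl).1
        by_cases hi : ∃ i, l = e i
        · obtain ⟨i, rfl⟩ := hi
          have : mm e s T.B (e i) j = T.B (e i) j := by
            rw [mm_other_nonpos _ _ _ hl hsj.symm (hneg j)]
            have := hpos i
            rw [max_eq_right (by omega)]; simp
          rw [this]; simp
        · push Not at hi
          have hz : T.x l ≠ 0 := by rw [hfro l hi]; exact hx l
          have hz' : (T.x l)⁻¹ ∈ O := by rw [hfro l hi]; exact hinv l hi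
          refine ⟨zpow_ne_zero _ hz, ?_⟩
          generalize (max (-mm e s T.B l j) 0 - max (-T.B l j) 0) = z
          rcases z with z | z
          · rw [Int.ofNat_eq_natCast, zpow_natCast, ← inv_pow]; exact O.pow_mem hz' _
          · rw [zpow_negSucc, inv_inv]; exact O.pow_mem (hTx l) _
      exact ⟨fun l hl => (key l hl).1, Subring.prod_mem _ fun l hl => (key l hl).2⟩
    have h4 : xn e d T j = (nu e T.B T.x s j)⁻¹ *
        (T.x (e s) ^ (-T.B (e s) j).toNat * xn e d (mu e d s T) j - w) := by
      rw [← h3, inv_mul_cancel_left₀ hnu.1]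
    rw [h4]
    exact O.mul_mem hnu.2 (O.sub_mem (O.mul_mem (O.pow_mem (hTx _) _) ih1) hw)

end hyb
end GCX

open Finset
set_option linter.unusedSectionVars false
set_option linter.unusedVariables false

namespace GCX
open GCA

section nonvan
variable {N I F : Type} [DecidableEq N] [Fintype I] [DecidableEq I] [Field F] [Algebra ℚ F]
  {e : N → I} {d : N → ℕ} {D : N → ℤ} {A : Subring F}

theorem c0_ne {B : I → N → ℤ} {x : I → F} (hx : AlgebraicIndependent ℚ x) (j : N) (q : I)
    (hq : 0 ≤ B q j) {w : F} (hw : w ∈ Algebra.adjoin ℚ (Set.range x)) :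
    c0 B x j + x q * w ≠ 0 := by
  rw [Algebra.adjoin_range_eq_range_aeval] at hw
  obtain ⟨w, rfl⟩ := hw
  intro h
  have h1 : MvPolynomial.aeval x ((∏ l, MvPolynomial.X l ^ (-B l j).toNat) +
      MvPolynomial.X q * w : MvPolynomial I ℚ) = 0 := by
    rw [← h]; simp [c0, map_prod]
  have h2 := (injective_iff_map_eq_zero _).1 hx _ h1
  have h3 := congrArg (MvPolynomial.eval (fun l => if l = q then (0 : ℚ) else 1)) h2
  simp only [map_add, map_mul, map_prod, map_pow, MvPolynomial.eval_X, if_true, zero_mul,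
    add_zero, map_zero] at h3
  refine prod_ne_zero_iff.2 ?_ h3
  intro l _
  by_cases hl : l = q
  · rw [hl, Int.toNat_of_nonpos (by omega), pow_zero]; exact one_ne_zero
  · simp [hl]

/-- The index set of frozen variables. -/
def Fr (e : N → I) : Set I := {l | ∀ i, l ≠ e i}

theorem P_ne_of_edge {S : GS I N F} (hB : GoodB e d D S.B) (hR : GoodR d A S.ρ)
    (hx : AlgebraicIndependent ℚ S.x) (hA : ∀ a ∈ A, a ∈ Algebra.adjoin ℚ (S.x '' Fr e))
    (i j : N) (hij : S.B (e i) j ≠ 0) : P d S j ≠ 0 := by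
  have hmono : Algebra.adjoin ℚ (S.x '' Fr e) ≤ Algebra.adjoin ℚ (Set.range S.x) :=
    Algebra.adjoin_mono (Set.image_subset_range _ _)
  have key : ∀ T : GS I N F, T.x = S.x → GoodB e d D T.B → GoodR d A T.ρ → 0 < T.B (e i) j →
      P d T j ≠ 0 := by
    intro T hTx hTB hTR hpos
    obtain ⟨w, hw, hw'⟩ := Psplit hTB (ρ := T.ρ) (x := T.x) j
      (Algebra.adjoin ℚ (Set.range S.x)).toSubring
      (fun l _ => by rw [hTx]; exact Algebra.subset_adjoin ⟨l, rfl⟩) (hTR.zero j)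
      (fun r hr => hmono (hA _ (hTR.mem j r hr))) {e i} (by
        intro q hq
        rw [mem_singleton.1 hq]
        exact Int.le_of_dvd hpos (hTB.dvd j i))
    rw [prod_singleton, hTx] at hw'
    unfold P
    rw [hTx, hw']
    exact c0_ne hx j (e i) hpos.le hw
  rcases lt_or_gt_of_ne hij with h | h
  · rw [← P_flip hB.dpos]
    exact key (flip d S) rfl hB.flip hR.flip (by simpa [flip] using h)
  · exact key S rfl hB hR h

theorem mm_iso {B : I → N → ℤ} (i l : N) (hl : l ≠ i) (h : B (e i) l = 0) (k : I) :
    mm e i B k l = B k l := by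
  by_cases hk : k = e i
  · rw [hk, mm_self_row, h, neg_zero]
  · rw [mm_other_nonpos i l k hk hl h.le, h]; simp

theorem P_iso (hd : ∀ i, 0 < d i) (S : GS I N F) (i z : N) (hd0 : S.B (e i) i = 0)
    (h : S.B (e i) z = 0) :
    P d (mu e d i S) z = P d S z := by
  by_cases hz : z = i
  · subst hz; exact P_mu_self hd z S hd0
  · unfold P Pev
    refine sum_congr rfl fun r _ => ?_
    congr 1
    · simp [mu, hz]
    · refine prod_congr rfl fun k _ => ?_
      rw [show (mu e d i S).B k z = S.B k z from mm_iso i z hz h k]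
      by_cases hk : k = e i
      · rw [hk, h, ex_zero_b]; simp
      · simp [mu, hk]

/-- Independence is preserved by mutation. -/
theorem ai_mu {S : GS I N F} (hB : GoodB e d D S.B) (hR : GoodR d A S.ρ)
    (hx : AlgebraicIndependent ℚ S.x) (hA : ∀ a ∈ A, a ∈ Algebra.adjoin ℚ (S.x '' Fr e))
    (i : N) (hP : P d S i ≠ 0) : AlgebraicIndependent ℚ (mu e d i S).x := by
  rw [AlgebraicIndependent.iff_transcendental_adjoin_image (e i)] at hx ⊢
  have h1 : ∀ j, j ≠ e i → (mu e d i S).x j = S.x j := fun j hj => by simp [mu, hj]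
  have h2 : (mu e d i S).x '' {e i}ᶜ = S.x '' {e i}ᶜ :=
    Set.image_congr fun j hj => h1 j hj
  have h3 : (mu e d i S).x (e i) = (S.x (e i))⁻¹ * P d S i := by simp [mu, xn]
  rw [h2, h3]
  refine ⟨?_, ?_⟩
  · have : (fun j : {j // j ≠ e i} => (mu e d i S).x j) = fun j : {j // j ≠ e i} => S.x j :=
      funext fun j => h1 j j.2
    rw [this]; exact hx.1
  · have hmono : Algebra.adjoin ℚ (S.x '' Fr e) ≤ Algebra.adjoin ℚ (S.x '' {e i}ᶜ) :=
      Algebra.adjoin_mono (Set.image_mono fun l hl => hl i)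
    have hPm : P d S i ∈ Algebra.adjoin ℚ (S.x '' {e i}ᶜ) := by
      unfold P Pev
      refine Subalgebra.sum_mem _ fun r hr => Subalgebra.mul_mem _
        (hmono (hA _ (hR.mem i r (by simpa [Nat.lt_succ_iff] using hr)))) ?_
      refine Subalgebra.prod_mem _ fun l _ => ?_
      by_cases hl : l = e i
      · rw [hl, hB.diag, ex_zero_b, pow_zero]; exact Subalgebra.one_mem _
      · exact Subalgebra.pow_mem _ (Algebra.subset_adjoin (Set.mem_image_of_mem _ hl)) _
    intro hal
    apply hx.2
    have h4 : IsAlgebraic (Algebra.adjoin ℚ (S.x '' {e i}ᶜ)) (P d S i) :=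
      isAlgebraic_algebraMap (⟨_, hPm⟩ : Algebra.adjoin ℚ (S.x '' {e i}ᶜ))
    rw [mul_comm] at hal
    have := IsAlgebraic.of_mul (mem_nonZeroDivisors_of_ne_zero hP) h4 hal
    exact IsAlgebraic.inv_iff.1 this

/-- The invariant along nondegenerate paths. -/
structure Inv (e : N → I) (d : N → ℕ) (D : N → ℤ) (A : Subring F) (Z : Set N) (S : GS I N F) :
    Prop where
  B : GoodB e d D S.B
  R : GoodR d A S.ρ
  x : AlgebraicIndependent ℚ S.x
  A : ∀ a ∈ A, a ∈ Algebra.adjoin ℚ (S.x '' Fr e)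
  nz : ∀ j, j ∉ Z → P d S j ≠ 0

theorem Inv.mu {Z : Set N} {S : GS I N F} (h : Inv e d D A Z S) (i : N) (hi : i ∉ Z) :
    Inv e d D A Z (mu e d i S) := by
  have hx := ai_mu h.B h.R h.x h.A i (h.nz i hi)
  have hA : ∀ a ∈ A, a ∈ Algebra.adjoin ℚ ((GCX.mu e d i S).x '' Fr e) := by
    have : (GCX.mu e d i S).x '' Fr e = S.x '' Fr e :=
      Set.image_congr fun j hj => by simp [GCX.mu, hj i]
    rw [this]; exact h.A
  refine ⟨h.B.mm i, h.R.mu i, hx, hA, fun j hj h0 => ?_⟩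
  have hB' : GoodB e d D (GCX.mu e d i S).B := h.B.mm i
  have hR' : GoodR d A (GCX.mu e d i S).ρ := h.R.mu i
  have h1 : (GCX.mu e d i S).B (e i) j = 0 := by
    by_contra hne
    exact P_ne_of_edge hB' hR' hx hA i j hne h0
  have h2 : S.B (e i) j = 0 := by
    have : mm e i S.B (e i) j = 0 := h1
    rw [mm_self_row] at this; omega
  rw [P_iso h.B.dpos S i j (h.B.diag i) h2] at h0
  exact h.nz j hj h0

theorem Inv.NV {Z : Set N} : ∀ {L : List N} {S : GS I N F}, Inv e d D A Z S → (∀ i ∈ L, i ∉ Z) →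
    NV e d L S
  | [], S, h, _ => fun k => h.x.ne_zero k
  | i :: L, S, h, hL => ⟨fun k => h.x.ne_zero k,
      Inv.NV (h.mu i (hL i (by simp))) fun j hj => hL j (by simp [hj])⟩

/-- Comparison of a path with its nondegenerate part. -/
structure ZR (e : N → I) (d : N → ℕ) (D : N → ℤ) (Z : Set N) (x0 : I → F) (T T' : GS I N F) : Prop where
  col : ∀ z ∈ Z, ∀ a, T.B (e a) z = 0
  row : ∀ z ∈ Z, ∀ a, T.B (e z) a = 0
  good : GoodB e d D T.B
  B : ∀ l, l ∉ Z → ∀ k, T.B k l = T'.B k l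
  ρ : ∀ l, l ∉ Z → T.ρ l = T'.ρ l
  x : ∀ k, (∀ z ∈ Z, k ≠ e z) → T.x k = T'.x k
  xZ : ∀ z ∈ Z, T.x (e z) = x0 (e z) ∨ T.x (e z) = 0
  P : ∀ z ∈ Z, P d T z = 0

theorem ZR.muZ {Z : Set N} {x0 : I → F} {T T' : GS I N F} (hinj : Function.Injective e)
    (hd : ∀ i, 0 < d i) (h : ZR e d D Z x0 T T')
    (i : N) (hi : i ∈ Z) : ZR e d D Z x0 (mu e d i T) T' := by
  have hrow := h.row i hi
  have hBB : ∀ l, l ≠ i → ∀ k, (mu e d i T).B k l = T.B k l := fun l hl k =>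
    mm_iso i l hl (hrow l) k
  have hBi : ∀ k, (mu e d i T).B k i = -T.B k i := fun k => mm_self_col i k
  have hP : ∀ z, GCX.P d (mu e d i T) z = GCX.P d T z := fun z =>
    P_iso hd T i z (h.good.diag i) (hrow z)
  constructor
  · intro z hz a
    by_cases hzi : z = i
    · rw [hzi, hBi, h.col i hi, neg_zero]
    · rw [hBB z hzi, h.col z hz]
  · intro z hz a
    by_cases hzi : a = i
    · rw [hzi, hBi, h.row z hz, neg_zero]
    · rw [hBB a hzi, h.row z hz]
  · exact h.good.mm i
  · intro l hl k
    rw [hBB l (fun h => hl (h ▸ hi)), h.B l hl]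
  · intro l hl
    rw [← h.ρ l hl]; funext r
    have : l ≠ i := fun h => hl (h ▸ hi)
    simp [mu, this]
  · intro k hk
    rw [← h.x k hk]; simp [mu, hk i hi]
  · intro z hz
    by_cases hzi : z = i
    · right; subst hzi; simp [mu, xn, h.P z hz]
    · have : e z ≠ e i := fun h => hzi (hinj h)
      simpa [mu, this] using h.xZ z hz
  · intro z hz; rw [hP, h.P z hz]

theorem ZR.muN {Z : Set N} {x0 : I → F} {T T' : GS I N F} (hinj : Function.Injective e)
    (hd : ∀ i, 0 < d i) (h : ZR e d D Z x0 T T')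
    (i : N) (hi : i ∉ Z) : ZR e d D Z x0 (GCX.mu e d i T) (GCX.mu e d i T') := by
  have hz : ∀ z ∈ Z, z ≠ i := fun z hz h => hi (h ▸ hz)
  have hPi : GCX.P d T i = GCX.P d T' i := by
    unfold GCX.P Pev
    rw [h.ρ i hi]
    refine sum_congr rfl fun r _ => ?_
    congr 1
    refine prod_congr rfl fun k _ => ?_
    rw [← h.B i hi]
    by_cases hk : ∃ z ∈ Z, k = e z
    · obtain ⟨z, hz, rfl⟩ := hk
      rw [h.row z hz, ex_zero_b, pow_zero, pow_zero]
    · push Not at hk; rw [h.x k hk]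
  constructor
  · intro z hz' a
    rw [show (GCX.mu e d i T).B (e a) z = T.B (e a) z from mm_iso i z (hz z hz') (h.col z hz' i) _,
      h.col z hz']
  · intro z hz' a
    show mm e i T.B (e z) a = 0
    by_cases ha : a = i
    · rw [ha, mm_self_col, h.row z hz', neg_zero]
    · rw [mm_other i a _ (fun h => hz z hz' (hinj h)) ha, h.row z hz', h.row z hz']; simp
  · exact h.good.mm i
  · intro l hl k
    show mm e i T.B k l = mm e i T'.B k l
    unfold mm
    rw [h.B l hl, h.B l hl, h.B i hi]
  · intro l hl
    funext r
    simp [mu, h.ρ i hi, h.ρ l hl]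
  · intro k hk
    simp only [mu, xn]
    rw [h.x k hk, hPi, h.x (e i) (fun z hz' h => hz z hz' (hinj h).symm)]
  · intro z hz'
    have : e z ≠ e i := fun h => hz z hz' (hinj h)
    simpa [mu, this] using h.xZ z hz'
  · intro z hz'
    rw [P_iso hd T i z (h.good.diag i) (h.col z hz' i), h.P z hz']

open Classical in
theorem ZR.ms {Z : Set N} {x0 : I → F} (hinj : Function.Injective e) (hd : ∀ i, 0 < d i) :
    ∀ (L : List N) {T T' : GS I N F}, ZR e d D Z x0 T T' →
    ZR e d D Z x0 (ms e d L T) (ms e d (L.filter fun i => decide (i ∉ Z)) T')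
  | [], T, T', h => h
  | i :: L, T, T', h => by
    by_cases hi : i ∈ Z
    · rw [List.filter_cons_of_neg (by simpa using hi)]
      exact ZR.ms hinj hd L (h.muZ hinj hd i hi)
    · rw [List.filter_cons_of_pos (by simpa using hi)]
      exact ZR.ms hinj hd L (h.muN hinj hd i hi)

end nonvan

theorem main_abs {n : ℕ} {I F : Type} [Fintype I] [DecidableEq I] [Field F] [Algebra ℚ F]
    {e : Fin n → I} {d : Fin n → ℕ} {D : Fin n → ℤ} {A O : Subring F} {S : GS I (Fin n) F}
    (hB : GoodB e d D S.B) (hR : GoodR d A S.ρ) (hx : AlgebraicIndependent ℚ S.x)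
    (hAx : ∀ a ∈ A, a ∈ Algebra.adjoin ℚ (S.x '' Fr e))
    (hO : ∀ i j : Fin n, j < i → 0 ≤ S.B (e i) j) (hA : ∀ a ∈ A, a ∈ O) (hxO : ∀ k, S.x k ∈ O)
    (hinv : ∀ k, (∀ i, k ≠ e i) → (S.x k)⁻¹ ∈ O) (hp : ∀ i : Fin n, (su e d S n).x (e i) ∈ O)
    (L : List (Fin n)) (k : I) : (ms e d L S).x k ∈ O := by
  classical
  set Z : Set (Fin n) := {i | P d S i = 0} with hZ
  have hW : W e d A univ S ≤ O := W_le hA hxO (fun k hk => hinv k fun i => hk i (mem_univ i))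
    fun i _ => hyb hB hR (fun k => hx.ne_zero k) hO hA hxO hinv hp i
  have hInv : Inv e d D A Z S := ⟨hB, hR, hx, hAx, fun j hj => hj⟩
  have hcol : ∀ z ∈ Z, ∀ a, S.B (e a) z = 0 := by
    intro z hz a
    by_contra h
    exact P_ne_of_edge hB hR hx hAx a z h hz
  have hZR : ZR e d D Z S.x S S := ⟨hcol, fun z hz a => (hB.zero_iff z a).2 (hcol z hz a), hB,
    fun _ _ _ => rfl, fun _ _ => rfl, fun _ _ => rfl, fun _ _ => Or.inl rfl, fun z hz => hz⟩
  have h := ZR.ms hB.inj hB.dpos L hZR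
  by_cases hk : ∃ z ∈ Z, k = e z
  · obtain ⟨z, hz, rfl⟩ := hk
    rcases h.xZ z hz with h | h <;> rw [h]
    exacts [hxO _, O.zero_mem]
  · push Not at hk
    rw [h.x k hk]
    refine hW (V_aux (fun i : Fin n => (i : ℕ)) Fin.val_injective _ e A S _ univ rfl hB hR
      (hInv.NV ?_) (fun i j hij => hO i j hij) k)
    intro i hi
    simpa using (List.mem_filter.1 hi).2

end GCX

open Finset
set_option linter.unusedSectionVars false
set_option linter.unusedVariables false

namespace GCX
open GCA

/-- The abstract seed attached to a seed. -/
def toGS {m n : ℕ} (S : Seed m n) : GS (Fin m) (Fin n) (K m) := ⟨S.x, S.ρ, S.B⟩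

theorem toGS_xn {m n : ℕ} (hmn : n ≤ m) (d : Fin n → ℕ) (hd : ∀ i, 0 < d i) (S : Seed m n)
    (i : Fin n) : exchangeVar hmn d S i = xn (Fin.castLE hmn) d (toGS S) i := by
  unfold exchangeVar xn P Pev
  congr 1
  refine sum_congr rfl fun r hr => ?_
  congr 1
  refine prod_congr rfl fun k _ => ?_
  rw [mutExp_eq _ (hd i) _ _ (by simpa [Nat.lt_succ_iff] using hr), zpow_natCast]
  rfl

theorem toGS_mu {m n : ℕ} (hmn : n ≤ m) (d : Fin n → ℕ) (hd : ∀ i, 0 < d i) (S : Seed m n)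
    (i : Fin n) : toGS (Seed.mut hmn d i S) = mu (Fin.castLE hmn) d i (toGS S) := by
  have h : (Seed.mut hmn d i S).x = (mu (Fin.castLE hmn) d i (toGS S)).x := by
    funext j
    simp only [Seed.mut, mu]
    rw [toGS_xn hmn d hd]; rfl
  unfold toGS
  rw [h]; rfl

theorem toGS_ms {m n : ℕ} (hmn : n ≤ m) (d : Fin n → ℕ) (hd : ∀ i, 0 < d i) (L : List (Fin n)) :
    ∀ S : Seed m n, toGS (mutSeq hmn d L S) = ms (Fin.castLE hmn) d L (toGS S) := by
  induction L with
  | nil => intro S; rfl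
  | cons i L ih => intro S; rw [mutSeq, ih, toGS_mu hmn d hd]; rfl

theorem toGS_su {m n : ℕ} (hmn : n ≤ m) (d : Fin n → ℕ) (hd : ∀ i, 0 < d i) (S : Seed m n) (k : ℕ) :
    toGS (seedUpTo hmn d S k) = su (Fin.castLE hmn) d (toGS S) k := by
  induction k with
  | zero => rfl
  | succ k ih =>
    rw [seedUpTo, su]
    split_ifs with h
    · rw [toGS_mu hmn d hd, ih]
    · exact ih

theorem mutSeq_append {m n : ℕ} (hmn : n ≤ m) (d : Fin n → ℕ) (L L' : List (Fin n)) :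
    ∀ S : Seed m n, mutSeq hmn d (L ++ L') S = mutSeq hmn d L' (mutSeq hmn d L S) := by
  induction L with
  | nil => intro S; rfl
  | cons i L ih => intro S; exact ih _

theorem seedUpTo_path {m n : ℕ} (hmn : n ≤ m) (d : Fin n → ℕ) (S : Seed m n) (k : ℕ) :
    ∃ L, seedUpTo hmn d S k = mutSeq hmn d L S := by
  induction k with
  | zero => exact ⟨[], rfl⟩
  | succ k ih =>
    obtain ⟨L, hL⟩ := ih
    rw [seedUpTo]
    split_ifs with h
    · exact ⟨L ++ [⟨k, h⟩], by rw [mutSeq_append, ← hL]; rfl⟩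
    · exact ⟨L, hL⟩

theorem xv_ai (m : ℕ) : AlgebraicIndependent ℚ (xv m) :=
  (MvPolynomial.algebraicIndependent_X (Fin m) ℚ).map' (f := IsScalarTower.toAlgHom ℚ
    (MvPolynomial (Fin m) ℚ) (K m)) (IsFractionRing.injective (MvPolynomial (Fin m) ℚ) (K m))

end GCX

open GCA in
/-- For an acyclic and coprime generalized seed of geometric type,
ordered so that `b_{ij} ≥ 0` whenever `i > j`, the generalized cluster algebra equals the
lower bound generalized cluster algebra `ℒ^{(n)}(Σ) = ℤℙ[x₁, x₁^{(n)}, …, x_n, x_n^{(n)}]`. -/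
theorem gca_eq_lowerBound {m n : ℕ} (hn : 1 ≤ n) (hmn : n ≤ m)
    (d : Fin n → ℕ) (ρ : Fin n → ℕ → K m) (B : Matrix (Fin m) (Fin n) ℤ)
    (hseed : SeedHyps m n hmn d ρ B)
    (hacyc : Acyclic hmn B) (hord : Ordered hmn B)
    (hcop : CoprimeSeed hmn d (initSeed m n ρ B)) :
    gca hmn d (initSeed m n ρ B) = lowerBound hmn d (initSeed m n ρ B) := by
  apply le_antisymm
  · obtain ⟨D, hD, hskew⟩ := hseed.skew
    refine Algebra.adjoin_le ?_
    rintro _ ⟨L, i, rfl⟩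
    set S := initSeed m n ρ B with hS
    set A : Subring (K m) := Subring.closure {y | ∃ j : Fin m, n ≤ (j : ℕ) ∧ y = xv m j} with hA
    have hZP : ∀ a ∈ ZP m n, a ∈ lowerBound hmn d S := fun a ha =>
      (lowerBound hmn d S).algebraMap_mem ⟨a, ha⟩
    have hfr : ∀ j : Fin m, n ≤ (j : ℕ) → xv m j ∈ lowerBound hmn d S := fun j hj =>
      hZP _ (Algebra.subset_adjoin ⟨j, hj, Or.inl rfl⟩)
    have hfr' : ∀ j : Fin m, n ≤ (j : ℕ) → (xv m j)⁻¹ ∈ lowerBound hmn d S := fun j hj =>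
      hZP _ (Algebra.subset_adjoin ⟨j, hj, Or.inr rfl⟩)
    have hFr : ∀ j : Fin m, j ∈ GCX.Fr (Fin.castLE hmn) ↔ n ≤ (j : ℕ) := by
      intro j
      constructor
      · intro h
        by_contra hlt
        exact h ⟨j, by omega⟩ rfl
      · rintro h i rfl
        have := i.2
        simp at h; omega
    have key := GCX.main_abs (e := Fin.castLE hmn) (d := d) (D := D) (A := A)
      (O := (lowerBound hmn d S).toSubring) (S := GCX.toGS S)
      ⟨Fin.castLE_injective hmn, hseed.d_pos, hseed.d_dvd, hD, hskew⟩
      ⟨hseed.rho_zero, hseed.rho_top, by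
        intro i r hr
        obtain ⟨c, f, hf, hp⟩ := hseed.rho_mon i r hr
        show ρ i r ∈ A
        rw [hp]
        refine A.mul_mem (intCast_mem _ _) (A.prod_mem fun j _ => ?_)
        by_cases hj : (j : ℕ) < n
        · rw [hf j hj, pow_zero]; exact A.one_mem
        · exact A.pow_mem (Subring.subset_closure ⟨j, by omega, rfl⟩) _⟩
      (GCX.xv_ai m)
      (by
        intro a ha
        have : A ≤ (Algebra.adjoin ℚ ((GCX.toGS S).x '' GCX.Fr (Fin.castLE hmn))).toSubring := by
          refine Subring.closure_le.2 ?_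
          rintro _ ⟨j, hj, rfl⟩
          exact Algebra.subset_adjoin ⟨j, (hFr j).2 hj, rfl⟩
        exact this ha)
      hord
      (by
        intro a ha
        have : A ≤ (lowerBound hmn d S).toSubring := by
          refine Subring.closure_le.2 ?_
          rintro _ ⟨j, hj, rfl⟩
          exact hfr j hj
        exact this ha)
      (by
        intro k
        by_cases hk : (k : ℕ) < n
        · exact Algebra.subset_adjoin (Or.inl ⟨⟨k, hk⟩, rfl⟩)
        · exact hfr k (by omega))
      (fun k hk => hfr' k ((hFr k).1 hk))
      (by
        intro i
        rw [← GCX.toGS_su hmn d hseed.d_pos]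
        exact Algebra.subset_adjoin (Or.inr ⟨i, rfl⟩))
      L (Fin.castLE hmn i)
    rw [← GCX.toGS_ms hmn d hseed.d_pos] at key
    exact key
  · refine Algebra.adjoin_le ?_
    rintro _ (⟨i, rfl⟩ | ⟨i, rfl⟩)
    · exact Algebra.subset_adjoin ⟨[], i, rfl⟩
    · obtain ⟨L, hL⟩ := GCX.seedUpTo_path hmn d (initSeed m n ρ B) n
      exact Algebra.subset_adjoin ⟨L, i, by rw [projVar, hL]⟩
end

section
/- Let Σ = (x̃,ρ,B̃) be an acyclic generalized seed ordered so that b_{ij} ≥ 0 whenever n ≥ i > j ≥ 1, and for each i ∈ [1,n] let x'_i be the cluster variable obtained by mutating Σ in direction i. Then ℤℙ[x_1, x'_1, …, x_n, x'_n] is a ℤℙ-subalgebra of the lower bound generalized cluster algebra ℒ^{(n)}(Σ) = ℤℙ[x_1, x_1^{(n)}, …, x_n, x_n^{(n)}]. -/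
open Finset

namespace GCA

lemma aux_mutExp_eq (d : ℕ) (hd : 0 < d) (b : ℤ) (r : ℕ) (hr : r ≤ d) :
    mutExp d b r = ⌊(r : ℚ) * b / d⌋ + max (-b) 0 := by
  have hdq : (0 : ℚ) < d := by exact_mod_cast hd
  have hrq : (r : ℚ) ≤ d := by exact_mod_cast hr
  have hr0 : (0 : ℚ) ≤ r := by positivity
  unfold mutExp
  rcases le_total 0 b with hb | hb
  · have hbq : (0 : ℚ) ≤ b := by exact_mod_cast hb
    have h1 : (0 : ℚ) ≤ (r : ℚ) * b / d := by positivity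
    have h2 : -(((d : ℚ) - r) * b / d) ≤ 0 := by
      have : (0 : ℚ) ≤ ((d : ℚ) - r) * b / d :=
        div_nonneg (mul_nonneg (by linarith) hbq) hdq.le
      linarith
    rw [max_eq_left h1, max_eq_right h2, max_eq_right (by omega : -b ≤ 0)]
    simp
  · have hbq : (b : ℚ) ≤ 0 := by exact_mod_cast hb
    have h1 : (r : ℚ) * b / d ≤ 0 :=
      div_nonpos_of_nonpos_of_nonneg (mul_nonpos_of_nonneg_of_nonpos hr0 hbq) hdq.le
    have h2 : 0 ≤ -(((d : ℚ) - r) * b / d) := by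
      have : ((d : ℚ) - r) * b / d ≤ 0 :=
        div_nonpos_of_nonpos_of_nonneg
          (mul_nonpos_of_nonneg_of_nonpos (by linarith) hbq) hdq.le
      linarith
    rw [max_eq_right h1, max_eq_left h2, max_eq_left (by omega : 0 ≤ -b)]
    have h3 : -(((d : ℚ) - r) * b / d) = (r : ℚ) * b / d + ((-b : ℤ) : ℚ) := by
      push_cast
      field_simp
      ring
    rw [h3, Int.floor_add_intCast]
    simp

lemma aux_floor_mul (d : ℕ) (hd : 0 < d) (b e : ℤ) (r : ℕ) :
    ⌊(r : ℚ) * ((b + d * e : ℤ) : ℚ) / d⌋ = ⌊(r : ℚ) * b / d⌋ + r * e := by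
  have hdq : (d : ℚ) ≠ 0 := by exact_mod_cast hd.ne'
  have : (r : ℚ) * ((b + d * e : ℤ) : ℚ) / d = (r : ℚ) * b / d + ((r * e : ℤ) : ℚ) := by
    push_cast
    field_simp
  rw [this, Int.floor_add_intCast]

lemma aux_mutExp_pos (d : ℕ) (hd : 0 < d) (e : ℕ) (r : ℕ) (hr : r ≤ d) :
    mutExp d (d * e) r = ((r * e : ℕ) : ℤ) := by
  rw [aux_mutExp_eq d hd _ r hr]
  have := aux_floor_mul d hd 0 e r
  simp only [zero_add] at this
  rw [this, max_eq_right (by have : (0 : ℤ) ≤ d * e := by positivity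
                             omega)]
  simp

lemma aux_mutExp_neg (d : ℕ) (hd : 0 < d) (e : ℕ) (r : ℕ) (hr : r ≤ d) :
    mutExp d (-(d * e)) r = (((d - r) * e : ℕ) : ℤ) := by
  rw [aux_mutExp_eq d hd _ r hr]
  have := aux_floor_mul d hd 0 (-e) r
  simp only [zero_add, mul_neg] at this
  rw [this, max_eq_left (by have : (0 : ℤ) ≤ d * e := by positivity
                            omega)]
  push_cast [Nat.cast_sub hr]
  simp
  ring

lemma aux_matMut (hmn : n ≤ m) (i : Fin n) (B : Matrix (Fin m) (Fin n) ℤ) (k : Fin m) (l : Fin n)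
    (hk : k ≠ Fin.castLE hmn i) (hl : l ≠ i) (hb : B (Fin.castLE hmn i) l ≤ 0) :
    matMut hmn i B k l = B k l + max (-B k i) 0 * B (Fin.castLE hmn i) l := by
  unfold matMut
  rw [if_neg (by tauto), abs_of_nonpos hb]
  congr 1
  rcases le_total 0 (B k i) with h | h
  · rw [abs_of_nonneg h, max_eq_right (by omega)]
    have : B k i * B (Fin.castLE hmn i) l + B k i * -B (Fin.castLE hmn i) l = 0 := by ring
    rw [this]; simp
  · rw [abs_of_nonpos h, max_eq_left (by omega)]
    have : -B k i * B (Fin.castLE hmn i) l + B k i * -B (Fin.castLE hmn i) l =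
      2 * (-B k i * B (Fin.castLE hmn i) l) := by ring
    rw [this, Int.mul_ediv_cancel_left _ (by norm_num)]

lemma aux_prod_split {M : Type*} [CommMonoid M] (hmn : n ≤ m) (F : Fin m → M) :
    ∏ k : Fin m, F k = (∏ j : Fin n, F (Fin.castLE hmn j)) *
      ∏ k ∈ Finset.univ.filter (fun k : Fin m => n ≤ (k : ℕ)), F k := by
  rw [← Finset.prod_filter_mul_prod_filter_not Finset.univ (fun k : Fin m => (k : ℕ) < n)]
  congr 1
  · symm
    apply Finset.prod_bij (fun (j : Fin n) _ => Fin.castLE hmn j)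
    · intro a _; simp
    · intro a _ b _ h; exact Fin.castLE_injective hmn h
    · intro b hb
      exact ⟨⟨b, by simpa using hb⟩, by simp, by ext; simp⟩
    · intros; rfl
  · apply Finset.prod_congr
    · ext k; simp
    · intros; rfl

lemma aux_seed_succ (hmn : n ≤ m) (d : Fin n → ℕ) (S : Seed m n) (k : ℕ) (hk : k < n) :
    seedUpTo hmn d S (k + 1) = Seed.mut hmn d ⟨k, hk⟩ (seedUpTo hmn d S k) := by
  simp [seedUpTo, hk]

lemma aux_inv_x (hmn : n ≤ m) (d : Fin n → ℕ) (S : Seed m n) (k : ℕ) (hk : k ≤ n) (p : Fin m)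
    (hp : k ≤ (p : ℕ)) : (seedUpTo hmn d S k).x p = S.x p := by
  induction k with
  | zero => rfl
  | succ k ih =>
    rw [aux_seed_succ hmn d S k hk]
    have : p ≠ Fin.castLE hmn ⟨k, hk⟩ := by
      intro h; rw [h] at hp; simp at hp
    simp only [Seed.mut, if_neg this]
    exact ih (by omega) (by omega)

lemma aux_inv_y (hmn : n ≤ m) (d : Fin n → ℕ) (S : Seed m n) (j : Fin n) (k : ℕ) (hk : k ≤ n)
    (hj : (j : ℕ) < k) : (seedUpTo hmn d S k).x (Fin.castLE hmn j) =
      exchangeVar hmn d (seedUpTo hmn d S j) j := by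
  induction k with
  | zero => omega
  | succ k ih =>
    rw [aux_seed_succ hmn d S k hk]
    by_cases h : (j : ℕ) = k
    · subst h
      simp [Seed.mut]
    · have : Fin.castLE hmn j ≠ Fin.castLE hmn ⟨k, hk⟩ := by
        intro h'; exact h (by simpa using congrArg Fin.val h')
      simp only [Seed.mut, if_neg this]
      exact ih (by omega) (by omega)

lemma aux_inv_rho (hmn : n ≤ m) (d : Fin n → ℕ) (S : Seed m n) (k : ℕ) (hk : k ≤ n) (j : Fin n)
    (hj : k ≤ (j : ℕ)) (r : ℕ) : (seedUpTo hmn d S k).ρ j r = S.ρ j r := by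
  induction k with
  | zero => rfl
  | succ k ih =>
    rw [aux_seed_succ hmn d S k hk]
    have : j ≠ ⟨k, hk⟩ := by
      intro h; rw [h] at hj; simp at hj
    simp only [Seed.mut, if_neg this]
    exact ih (by omega) (by omega)

lemma aux_ordered_neg (hmn : n ≤ m) (B : Matrix (Fin m) (Fin n) ℤ)
    (hs : SkewSymmetrizable hmn B) (hord : Ordered hmn B) (i j : Fin n) (h : i < j) :
    B (Fin.castLE hmn i) j ≤ 0 := by
  obtain ⟨D, hD, hDB⟩ := hs
  have h1 := hord j i h
  have h2 := hDB i j
  have h3 := hD i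
  have h4 := mul_nonneg (hD j).le h1
  by_contra hc
  push Not at hc
  have := mul_pos h3 hc
  omega

lemma aux_diag (hmn : n ≤ m) (B : Matrix (Fin m) (Fin n) ℤ)
    (hs : SkewSymmetrizable hmn B) (i : Fin n) : B (Fin.castLE hmn i) i = 0 := by
  obtain ⟨D, hD, hDB⟩ := hs
  have h2 := hDB i i
  have : D i * B (Fin.castLE hmn i) i = 0 := by omega
  exact (mul_eq_zero.mp this).resolve_left (hD i).ne'

lemma aux_zero_symm (hmn : n ≤ m) (B : Matrix (Fin m) (Fin n) ℤ)
    (hs : SkewSymmetrizable hmn B) (i j : Fin n) (h : B (Fin.castLE hmn i) j = 0) :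
    B (Fin.castLE hmn j) i = 0 := by
  obtain ⟨D, hD, hDB⟩ := hs
  have h2 := hDB i j
  rw [h] at h2
  have : D j * B (Fin.castLE hmn j) i = 0 := by omega
  exact (mul_eq_zero.mp this).resolve_left (hD j).ne'

lemma aux_inv_B (hmn : n ≤ m) (d : Fin n → ℕ) (S : Seed m n)
    (hs : SkewSymmetrizable hmn S.B) (hord : Ordered hmn S.B) (k : ℕ) (hk : k ≤ n)
    (j l : Fin n) (hl : k ≤ (l : ℕ)) : (seedUpTo hmn d S k).B (Fin.castLE hmn j) l =
      if (j : ℕ) < k then -S.B (Fin.castLE hmn j) l else S.B (Fin.castLE hmn j) l := by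
  induction k generalizing j l with
  | zero => simp [seedUpTo]
  | succ k ih =>
    rw [aux_seed_succ hmn d S k hk]
    have hlk : l ≠ ⟨k, hk⟩ := by
      intro h; rw [h] at hl; simp at hl
    by_cases h : (j : ℕ) = k
    · subst h
      have := ih (by omega) j l (by omega)
      simp only [Seed.mut, matMut]
      simp at this
      simp [this]
    · have hne : Fin.castLE hmn j ≠ Fin.castLE hmn ⟨k, hk⟩ := by
        intro h'; exact h (by simpa using congrArg Fin.val h')
      simp only [Seed.mut]
      have hb := ih (by omega) ⟨k, hk⟩ l (by omega)
      simp only [lt_irrefl, if_false] at hb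
      have hkl : (⟨k, hk⟩ : Fin n) < l := by rw [Fin.lt_def]; simpa using hl
      rw [aux_matMut hmn _ _ _ _ hne hlk
        (by rw [hb]; exact aux_ordered_neg hmn _ hs hord _ _ hkl)]
      have ha := ih (by omega) j ⟨k, hk⟩ (by simp)
      have hl' := ih (by omega) j l (by omega)
      have ha0 : 0 ≤ (seedUpTo hmn d S k).B (Fin.castLE hmn j) ⟨k, hk⟩ := by
        rw [ha]
        split_ifs with h1
        · have := aux_ordered_neg hmn _ hs hord j ⟨k, hk⟩ (by rw [Fin.lt_def]; simpa using h1)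
          omega
        · exact hord j ⟨k, hk⟩ (by rw [Fin.lt_def]; simp; omega)
      rw [max_eq_right (by omega), hl']
      simp only [zero_mul, add_zero]
      by_cases h1 : (j : ℕ) < k
      · rw [if_pos h1, if_pos (by omega)]
      · rw [if_neg h1, if_neg (by omega)]

/-- The exponent of the frozen variable `x_p` in the constant term of `x_j y_j`. -/
noncomputable def auxC (hmn : n ≤ m) (d : Fin n → ℕ) (S : Seed m n) (p : Fin m) (j : Fin n) : ℤ :=
  max (-(seedUpTo hmn d S j).B p j) 0

lemma aux_inv_F (hmn : n ≤ m) (d : Fin n → ℕ) (S : Seed m n)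
    (hs : SkewSymmetrizable hmn S.B) (hord : Ordered hmn S.B) (k : ℕ) (hk : k ≤ n)
    (p : Fin m) (hp : n ≤ (p : ℕ)) (l : Fin n) (hl : k ≤ (l : ℕ)) :
    (seedUpTo hmn d S k).B p l =
      S.B p l + ∑ j ∈ Finset.univ.filter (fun j : Fin n => (j : ℕ) < k), auxC hmn d S p j * S.B (Fin.castLE hmn j) l := by
  induction k generalizing l with
  | zero => simp [seedUpTo]
  | succ k ih =>
    rw [aux_seed_succ hmn d S k hk]
    have hlk : l ≠ ⟨k, hk⟩ := by
      intro h; rw [h] at hl; simp at hl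
    have hne : p ≠ Fin.castLE hmn ⟨k, hk⟩ := by
      intro h'; rw [h'] at hp; simp at hp; omega
    simp only [Seed.mut]
    have hb := aux_inv_B hmn d S hs hord k (by omega) ⟨k, hk⟩ l (by omega)
    simp only [lt_irrefl, if_false] at hb
    have hkl : (⟨k, hk⟩ : Fin n) < l := by rw [Fin.lt_def]; simpa using hl
    rw [aux_matMut hmn _ _ _ _ hne hlk
        (by rw [hb]; exact aux_ordered_neg hmn _ hs hord _ _ hkl), hb, ih (by omega) l (by omega)]
    have hset : (Finset.univ.filter fun j : Fin n => (j : ℕ) < k + 1) =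
        insert ⟨k, hk⟩ (Finset.univ.filter fun j : Fin n => (j : ℕ) < k) := by
      ext j
      simp only [mem_filter, mem_univ, true_and, mem_insert, Fin.ext_iff]
      omega
    rw [hset, Finset.sum_insert (by simp)]
    simp only [auxC]
    ring

end GCA

namespace GCA

/-- Congruence modulo `x` inside the subalgebra `L`. -/
def AuxCg (L : Subalgebra (↥(ZP m n)) (K m)) (x u v : K m) : Prop :=
  u ∈ L ∧ v ∈ L ∧ ∃ z ∈ L, u = v + x * z

lemma AuxCg.refl {L : Subalgebra (↥(ZP m n)) (K m)} {x u : K m} (h : u ∈ L) : AuxCg L x u u :=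
  ⟨h, h, 0, L.zero_mem, by simp⟩

lemma AuxCg.mul {L : Subalgebra (↥(ZP m n)) (K m)} {x u v u' v' : K m} (hx : x ∈ L)
    (h : AuxCg L x u v) (h' : AuxCg L x u' v') : AuxCg L x (u * u') (v * v') := by
  obtain ⟨a, b, z, hz, e⟩ := h
  obtain ⟨a', b', z', hz', e'⟩ := h'
  refine ⟨L.mul_mem a a', L.mul_mem b b', v * z' + z * v' + x * z * z', ?_, ?_⟩
  · exact L.add_mem (L.add_mem (L.mul_mem b hz') (L.mul_mem hz b'))
      (L.mul_mem (L.mul_mem hx hz) hz')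
  · rw [e, e']; ring

lemma AuxCg.add {L : Subalgebra (↥(ZP m n)) (K m)} {x u v u' v' : K m}
    (h : AuxCg L x u v) (h' : AuxCg L x u' v') : AuxCg L x (u + u') (v + v') := by
  obtain ⟨a, b, z, hz, e⟩ := h
  obtain ⟨a', b', z', hz', e'⟩ := h'
  refine ⟨L.add_mem a a', L.add_mem b b', z + z', L.add_mem hz hz', ?_⟩
  rw [e, e']; ring

lemma AuxCg.pow {L : Subalgebra (↥(ZP m n)) (K m)} {x u v : K m} (hx : x ∈ L)
    (h : AuxCg L x u v) (k : ℕ) : AuxCg L x (u ^ k) (v ^ k) := by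
  induction k with
  | zero => simpa using AuxCg.refl L.one_mem
  | succ k ih => rw [pow_succ, pow_succ]; exact ih.mul hx h

lemma AuxCg.sum {ι : Type*} {L : Subalgebra (↥(ZP m n)) (K m)} {x : K m} (s : Finset ι)
    (u v : ι → K m) (h : ∀ i ∈ s, AuxCg L x (u i) (v i)) :
    AuxCg L x (∑ i ∈ s, u i) (∑ i ∈ s, v i) := by
  classical
  induction s using Finset.induction_on with
  | empty => simpa using AuxCg.refl L.zero_mem
  | insert a s ha ih =>
    rw [Finset.sum_insert ha, Finset.sum_insert ha]
    exact (h a (by simp)).add (ih fun i hi => h i (by simp [hi]))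

lemma AuxCg.prod {ι : Type*} {L : Subalgebra (↥(ZP m n)) (K m)} {x : K m} (hx : x ∈ L)
    (s : Finset ι) (u v : ι → K m) (h : ∀ i ∈ s, AuxCg L x (u i) (v i)) :
    AuxCg L x (∏ i ∈ s, u i) (∏ i ∈ s, v i) := by
  classical
  induction s using Finset.induction_on with
  | empty => simpa using AuxCg.refl L.one_mem
  | insert a s ha ih =>
    rw [Finset.prod_insert ha, Finset.prod_insert ha]
    exact (h a (by simp)).mul hx (ih fun i hi => h i (by simp [hi]))

lemma aux_xv_ne (p : Fin m) : xv m p ≠ 0 := by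
  unfold xv
  rw [Ne, FaithfulSMul.algebraMap_eq_zero_iff]
  exact MvPolynomial.X_ne_zero p

/-- Frozen Laurent monomials. -/
noncomputable def auxF (m n : ℕ) (e : Fin m → ℤ) : K m :=
  ∏ p ∈ Finset.univ.filter (fun k : Fin m => n ≤ (k : ℕ)), xv m p ^ e p

lemma aux_inl_mem (p : Fin m) (hp : n ≤ (p : ℕ)) : xv m p ∈ ZP m n :=
  Algebra.subset_adjoin ⟨p, hp, Or.inl rfl⟩

lemma aux_inr_mem (p : Fin m) (hp : n ≤ (p : ℕ)) : (xv m p)⁻¹ ∈ ZP m n :=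
  Algebra.subset_adjoin ⟨p, hp, Or.inr rfl⟩

lemma auxF_mem_ZP (e : Fin m → ℤ) : auxF m n e ∈ ZP m n := by
  unfold auxF
  apply Subalgebra.prod_mem
  intro p hp
  have hp : n ≤ (p : ℕ) := by simpa using hp
  rcases Int.eq_nat_or_neg (e p) with ⟨k, h | h⟩
  · rw [h, zpow_natCast]
    exact Subalgebra.pow_mem _ (aux_inl_mem p hp) k
  · rw [h, zpow_neg, zpow_natCast, ← inv_pow]
    exact Subalgebra.pow_mem _ (aux_inr_mem p hp) k

lemma aux_ZP_mem (L : Subalgebra (↥(ZP m n)) (K m)) {y : K m} (h : y ∈ ZP m n) : y ∈ L :=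
  L.algebraMap_mem ⟨y, h⟩

lemma auxF_mem (L : Subalgebra (↥(ZP m n)) (K m)) (e : Fin m → ℤ) : auxF m n e ∈ L :=
  aux_ZP_mem L (auxF_mem_ZP e)

lemma auxF_add (e f : Fin m → ℤ) :
    auxF m n (fun p => e p + f p) = auxF m n e * auxF m n f := by
  unfold auxF
  rw [← Finset.prod_mul_distrib]
  exact Finset.prod_congr rfl fun p _ => zpow_add₀ (aux_xv_ne p) _ _

lemma auxF_zero : auxF m n (fun _ => 0) = 1 := by simp [auxF]

lemma auxF_pow (e : Fin m → ℤ) (k : ℕ) :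
    auxF m n e ^ k = auxF m n (fun p => e p * k) := by
  unfold auxF
  rw [← Finset.prod_pow]
  exact Finset.prod_congr rfl fun p _ => by rw [zpow_mul, zpow_natCast]

lemma auxF_prod {ι : Type*} (s : Finset ι) (e : ι → Fin m → ℤ) :
    ∏ j ∈ s, auxF m n (e j) = auxF m n (fun p => ∑ j ∈ s, e j p) := by
  classical
  induction s using Finset.induction_on with
  | empty => simp [auxF_zero]
  | insert a s ha ih =>
    rw [Finset.prod_insert ha, ih, ← auxF_add]
    simp [Finset.sum_insert ha]

lemma auxF_congr (e f : Fin m → ℤ) (h : ∀ p : Fin m, n ≤ (p : ℕ) → e p = f p) :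
    auxF m n e = auxF m n f :=
  Finset.prod_congr rfl fun p hp => by rw [h p (by simpa using hp)]

lemma aux_mon_mem {y : K m} (h : IsFrozenMonomial m n y) : y ∈ ZP m n := by
  obtain ⟨c, e, he, rfl⟩ := h
  apply Subalgebra.mul_mem
  · exact intCast_mem _ c
  · apply Subalgebra.prod_mem
    intro p _
    by_cases hp : n ≤ (p : ℕ)
    · exact Subalgebra.pow_mem _ (aux_inl_mem p hp) _
    · rw [he p (by omega), pow_zero]
      exact Subalgebra.one_mem _

/-- The absolute values of the principal `β`. -/
def auxβ (hmn : n ≤ m) (d : Fin n → ℕ) (B : Matrix (Fin m) (Fin n) ℤ) (j i : Fin n) : ℕ :=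
  (B (Fin.castLE hmn j) i).natAbs / d i

lemma auxβ_spec (hmn : n ≤ m) (d : Fin n → ℕ) (ρ : Fin n → ℕ → K m) (B : Matrix (Fin m) (Fin n) ℤ)
    (hseed : SeedHyps m n hmn d ρ B) (hord : Ordered hmn B) (j i : Fin n) :
    B (Fin.castLE hmn j) i =
      if j < i then -((d i : ℤ) * auxβ hmn d B j i) else (d i : ℤ) * auxβ hmn d B j i := by
  have h1 : d i * auxβ hmn d B j i = (B (Fin.castLE hmn j) i).natAbs := by
    apply Nat.mul_div_cancel'
    exact Int.natCast_dvd.mp (hseed.d_dvd i j)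
  have h2 : (d i : ℤ) * auxβ hmn d B j i = |B (Fin.castLE hmn j) i| := by
    rw [← Int.natCast_natAbs, ← h1]; push_cast; ring
  rw [h2]
  split_ifs with h
  · rw [abs_of_nonpos (aux_ordered_neg hmn B hseed.skew hord _ _ h)]; ring
  · rw [abs_of_nonneg]
    rcases lt_or_eq_of_le (not_lt.mp h) with h' | h'
    · exact hord _ _ h'
    · rw [h', aux_diag hmn B hseed.skew]

lemma aux_x_rel (hmn : n ≤ m) (d : Fin n → ℕ) (ρ : Fin n → ℕ → K m) (B : Matrix (Fin m) (Fin n) ℤ)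
    (hseed : SeedHyps m n hmn d ρ B) (hord : Ordered hmn B) (i : Fin n) :
    xv m (Fin.castLE hmn i) * exchangeVar hmn d (initSeed m n ρ B) i =
      ∑ r ∈ Finset.range (d i + 1), ρ i r *
        ((∏ j : Fin n, xv m (Fin.castLE hmn j) ^
          (if j < i then (d i - r) * auxβ hmn d B j i else r * auxβ hmn d B j i)) *
        auxF m n (fun p => ⌊(r : ℚ) * B p i / d i⌋ + max (-B p i) 0)) := by
  unfold exchangeVar
  simp only [initSeed]
  rw [mul_inv_cancel_left₀ (aux_xv_ne _)]
  refine Finset.sum_congr rfl fun r hr => ?_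
  have hr : r ≤ d i := by simpa [Nat.lt_succ_iff] using hr
  rw [aux_prod_split hmn]
  congr 2
  · refine Finset.prod_congr rfl fun j _ => ?_
    rw [auxβ_spec hmn d ρ B hseed hord j i]
    split_ifs
    · rw [aux_mutExp_neg _ (hseed.d_pos i) _ _ hr, zpow_natCast]
    · rw [aux_mutExp_pos _ (hseed.d_pos i) _ _ hr, zpow_natCast]
  · exact Finset.prod_congr rfl fun p _ => by rw [aux_mutExp_eq _ (hseed.d_pos i) _ _ hr]

lemma aux_y_rel (hmn : n ≤ m) (d : Fin n → ℕ) (ρ : Fin n → ℕ → K m) (B : Matrix (Fin m) (Fin n) ℤ)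
    (hseed : SeedHyps m n hmn d ρ B) (hord : Ordered hmn B) (i : Fin n) :
    xv m (Fin.castLE hmn i) * projVar hmn d (initSeed m n ρ B) i =
      ∑ r ∈ Finset.range (d i + 1), ρ i r *
        ((∏ j : Fin n, (if j < i then projVar hmn d (initSeed m n ρ B) j
            else xv m (Fin.castLE hmn j)) ^ (r * auxβ hmn d B j i)) *
        auxF m n (fun p => ⌊(r : ℚ) * (seedUpTo hmn d (initSeed m n ρ B) i).B p i / d i⌋ +
          auxC hmn d (initSeed m n ρ B) p i)) := by
  have hi : (i : ℕ) ≤ n := i.2.le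
  have hp : ∀ j : Fin n, projVar hmn d (initSeed m n ρ B) j =
      exchangeVar hmn d (seedUpTo hmn d (initSeed m n ρ B) j) j := fun j =>
    aux_inv_y hmn d _ j n le_rfl j.2
  rw [hp i]
  unfold exchangeVar
  rw [aux_inv_x hmn d _ i hi _ (by simp)]
  simp only [initSeed]
  rw [mul_inv_cancel_left₀ (aux_xv_ne _)]
  refine Finset.sum_congr rfl fun r hr => ?_
  have hr : r ≤ d i := by simpa [Nat.lt_succ_iff] using hr
  rw [aux_inv_rho hmn d _ i hi i le_rfl, aux_prod_split hmn]
  congr 2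
  · refine Finset.prod_congr rfl fun j _ => ?_
    rw [aux_inv_B hmn d _ hseed.skew hord i hi j i le_rfl]
    simp only
    rw [auxβ_spec hmn d ρ B hseed hord j i]
    by_cases h : j < i
    · have h' : (j : ℕ) < i := h
      rw [if_pos h', if_pos h, if_pos h, neg_neg, aux_mutExp_pos _ (hseed.d_pos i) _ _ hr,
        zpow_natCast, aux_inv_y hmn d _ j i hi h']
      exact congrArg (· ^ (r * auxβ hmn d B j i)) (hp j).symm
    · have h' : ¬ (j : ℕ) < i := h
      rw [if_neg h', if_neg h, if_neg h, aux_mutExp_pos _ (hseed.d_pos i) _ _ hr,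
        zpow_natCast, aux_inv_x hmn d _ i hi _ (by simpa using h')]
  · refine Finset.prod_congr rfl fun p hpp => ?_
    have hpp : n ≤ (p : ℕ) := by simpa using hpp
    rw [aux_mutExp_eq _ (hseed.d_pos i) _ _ hr, aux_inv_x hmn d _ i hi _ (by omega)]
    rfl

lemma aux_x_mem (hmn : n ≤ m) (d : Fin n → ℕ) (ρ : Fin n → ℕ → K m)
    (B : Matrix (Fin m) (Fin n) ℤ) (i : Fin n) :
    xv m (Fin.castLE hmn i) ∈ lowerBound hmn d (initSeed m n ρ B) :=
  Algebra.subset_adjoin (Or.inl ⟨i, rfl⟩)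

lemma aux_y_mem (hmn : n ≤ m) (d : Fin n → ℕ) (ρ : Fin n → ℕ → K m)
    (B : Matrix (Fin m) (Fin n) ℤ) (i : Fin n) :
    projVar hmn d (initSeed m n ρ B) i ∈ lowerBound hmn d (initSeed m n ρ B) :=
  Algebra.subset_adjoin (Or.inr ⟨i, rfl⟩)

/-- `x_j y_j` is congruent to its frozen constant term modulo `x_i`. -/
lemma aux_cong (hmn : n ≤ m) (d : Fin n → ℕ) (ρ : Fin n → ℕ → K m) (B : Matrix (Fin m) (Fin n) ℤ)
    (hseed : SeedHyps m n hmn d ρ B) (hord : Ordered hmn B) (i j : Fin n) (hji : j < i)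
    (hβ : auxβ hmn d B j i ≠ 0) :
    AuxCg (lowerBound hmn d (initSeed m n ρ B)) (xv m (Fin.castLE hmn i))
      (xv m (Fin.castLE hmn j) * projVar hmn d (initSeed m n ρ B) j)
      (auxF m n (fun p => auxC hmn d (initSeed m n ρ B) p j)) := by
  set L := lowerBound hmn d (initSeed m n ρ B) with hL
  have hX := aux_x_mem hmn d ρ B
  have hY := aux_y_mem hmn d ρ B
  rw [← hL] at hX hY
  have hβ' : auxβ hmn d B i j ≠ 0 := by
    intro h
    have h1 := auxβ_spec hmn d ρ B hseed hord i j
    rw [h] at h1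
    simp only [Nat.cast_zero, mul_zero, neg_zero, ite_self] at h1
    have h2 := aux_zero_symm hmn B hseed.skew i j h1
    apply hβ
    simp [auxβ, h2]
  rw [aux_y_rel hmn d ρ B hseed hord j, Finset.sum_range_succ']
  rw [show auxF m n (fun p => auxC hmn d (initSeed m n ρ B) p j) =
    (∑ r ∈ Finset.range (d j), 0) + auxF m n (fun p => auxC hmn d (initSeed m n ρ B) p j) by simp]
  apply AuxCg.add
  · apply AuxCg.sum
    intro r hr
    have hr : r < d j := by simpa using hr
    have hmemρ : ρ j (r + 1) ∈ L := aux_ZP_mem L (aux_mon_mem (hseed.rho_mon j (r + 1) hr))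
    have hG : ∀ k : Fin n, (if k < j then projVar hmn d (initSeed m n ρ B) k
            else xv m (Fin.castLE hmn k)) ∈ L := by
      intro k; split_ifs
      · exact hY k
      · exact hX k
    have h0 : AuxCg L (xv m (Fin.castLE hmn i)) (∏ k : Fin n,
        (if k < j then projVar hmn d (initSeed m n ρ B) k
            else xv m (Fin.castLE hmn k)) ^ ((r + 1) * auxβ hmn d B k j)) 0 := by
      refine ⟨L.prod_mem fun k _ => L.pow_mem (hG k) _, L.zero_mem,
        (xv m (Fin.castLE hmn i)) ^ ((r + 1) * auxβ hmn d B i j - 1) *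
        ∏ k ∈ Finset.univ.erase i, (if k < j then projVar hmn d (initSeed m n ρ B) k
            else xv m (Fin.castLE hmn k)) ^ ((r + 1) * auxβ hmn d B k j),
        L.mul_mem (L.pow_mem (hX i) _) (L.prod_mem fun k _ => L.pow_mem (hG k) _), ?_⟩
      rw [← Finset.mul_prod_erase _ _ (Finset.mem_univ i), if_neg (not_lt.mpr hji.le), zero_add,
        ← mul_assoc, ← pow_succ', Nat.sub_add_cancel]
      exact Nat.one_le_iff_ne_zero.mpr (Nat.mul_ne_zero (by omega) hβ')
    have := (AuxCg.refl (x := xv m (Fin.castLE hmn i)) hmemρ).mul (hX i)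
      (h0.mul (hX i) (AuxCg.refl (auxF_mem L (fun p =>
        ⌊((r + 1 : ℕ) : ℚ) * (seedUpTo hmn d (initSeed m n ρ B) j).B p j / d j⌋ +
          auxC hmn d (initSeed m n ρ B) p j))))
    simpa using this
  · have : ρ j 0 = 1 := hseed.rho_zero j
    simp only [this, zero_mul, pow_zero, Finset.prod_const_one, one_mul, Nat.cast_zero, zero_div,
      Int.floor_zero, zero_add]
    exact AuxCg.refl (auxF_mem L _)

lemma aux_main (hmn : n ≤ m) (d : Fin n → ℕ) (ρ : Fin n → ℕ → K m) (B : Matrix (Fin m) (Fin n) ℤ)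
    (hseed : SeedHyps m n hmn d ρ B) (hord : Ordered hmn B) (i : Fin n) :
    exchangeVar hmn d (initSeed m n ρ B) i ∈ lowerBound hmn d (initSeed m n ρ B) := by
  set L := lowerBound hmn d (initSeed m n ρ B) with hL
  have hX := aux_x_mem hmn d ρ B
  have hY := aux_y_mem hmn d ρ B
  have hcong := aux_cong hmn d ρ B hseed hord i
  have hxr := aux_x_rel hmn d ρ B hseed hord i
  have hyr := aux_y_rel hmn d ρ B hseed hord i
  have hF := aux_inv_F hmn d (initSeed m n ρ B) hseed.skew hord i i.2.le
  rw [← hL] at hX hY hcong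
  have hβs := auxβ_spec hmn d ρ B hseed hord
  set β := auxβ hmn d B with hβ
  set y := projVar hmn d (initSeed m n ρ B) with hy
  set C := auxC hmn d (initSeed m n ρ B) with hC
  set S := seedUpTo hmn d (initSeed m n ρ B) i with hS
  set X : Fin n → K m := fun j => xv m (Fin.castLE hmn j) with hXdef
  change ∀ j, X j ∈ L at hX
  set z' := exchangeVar hmn d (initSeed m n ρ B) i with hz'
  change X i * z' = ∑ r ∈ Finset.range (d i + 1), ρ i r *
    ((∏ j, X j ^ (if j < i then (d i - r) * β j i else r * β j i)) * _) at hxr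
  change X i * y i = ∑ r ∈ Finset.range (d i + 1), ρ i r *
    ((∏ j, (if j < i then y j else X j) ^ (r * β j i)) * _) at hyr
  change ∀ j, j < i → β j i ≠ 0 → AuxCg L (X i) (X j * y j) (auxF m n (fun p => C p j)) at hcong
  set M : K m := ∏ j, (if j < i then X j ^ (d i * β j i) else 1) with hM
  set U : K m := auxF m n (fun p => C p i + min (B p i) 0) with hU
  have hMmem : M ∈ L := by
    refine L.prod_mem fun j _ => ?_
    split_ifs
    · exact L.pow_mem (hX j) _
    · exact L.one_mem
  have key : AuxCg L (X i) (M * (X i * y i)) (U * (X i * z')) := by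
    rw [hyr, hxr, Finset.mul_sum, Finset.mul_sum]
    apply AuxCg.sum
    intro r hr
    have hr : r ≤ d i := by simpa [Nat.lt_succ_iff] using hr
    have hmemρ : ρ i r ∈ L := aux_ZP_mem L (aux_mon_mem (hseed.rho_mon i r hr))
    -- left-hand side
    have e1 : ∀ F : K m, M * (ρ i r * ((∏ j, (if j < i then y j else X j) ^ (r * β j i)) * F)) =
        ρ i r * ((∏ j, ((if j < i then (X j * y j) ^ (r * β j i) else 1) *
          X j ^ (if j < i then (d i - r) * β j i else r * β j i))) * F) := by
      intro F
      have : (∏ j, ((if j < i then (X j * y j) ^ (r * β j i) else 1) *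
          X j ^ (if j < i then (d i - r) * β j i else r * β j i))) =
          M * ∏ j, (if j < i then y j else X j) ^ (r * β j i) := by
        rw [hM, ← Finset.prod_mul_distrib]
        refine Finset.prod_congr rfl fun j _ => ?_
        split_ifs
        · have hsum : d i * β j i = r * β j i + (d i - r) * β j i := by
            rw [← add_mul, Nat.add_sub_cancel' hr]
          rw [hsum, pow_add, mul_pow]; ring
        · ring
      rw [this]; ring
    rw [e1]
    have e2 : (∏ j, (if j < i then auxF m n (fun p => C p j) ^ (r * β j i) else 1)) *
        auxF m n (fun p => ⌊(r : ℚ) * S.B p i / d i⌋ + C p i) =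
        U * auxF m n (fun p => ⌊(r : ℚ) * B p i / d i⌋ + max (-B p i) 0) := by
      rw [← Finset.prod_filter]
      simp only [auxF_pow]
      rw [auxF_prod, hU, ← auxF_add, ← auxF_add]
      apply auxF_congr
      intro p hp
      have h1 : S.B p i = B p i + d i * (-∑ j ∈ Finset.univ.filter (fun j : Fin n => j < i),
          C p j * β j i) := by
        rw [hF p hp i le_rfl]
        congr 1
        rw [mul_neg, Finset.mul_sum, ← Finset.sum_neg_distrib]
        apply Finset.sum_congr
        · ext j; simp
        · intro j hj
          have hj : j < i := by simpa using hj
          change C p j * B (Fin.castLE hmn j) i = _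
          rw [hβs j i, if_pos hj]; ring
      rw [h1, aux_floor_mul _ (hseed.d_pos i)]
      have h2 : ∑ j ∈ Finset.univ.filter (fun j : Fin n => j < i), C p j * ((r * β j i : ℕ) : ℤ) =
          r * ∑ j ∈ Finset.univ.filter (fun j : Fin n => j < i), C p j * β j i := by
        rw [Finset.mul_sum]
        refine Finset.sum_congr rfl fun j _ => ?_
        push_cast; ring
      rw [h2]
      have h3 : min (B p i) 0 + max (-B p i) 0 = 0 := by omega
      linear_combination -h3
    have e3 : U * (ρ i r * ((∏ j, X j ^ (if j < i then (d i - r) * β j i else r * β j i)) *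
        auxF m n (fun p => ⌊(r : ℚ) * B p i / d i⌋ + max (-B p i) 0))) =
        ρ i r * ((∏ j, ((if j < i then auxF m n (fun p => C p j) ^ (r * β j i) else 1) *
          X j ^ (if j < i then (d i - r) * β j i else r * β j i))) *
          auxF m n (fun p => ⌊(r : ℚ) * S.B p i / d i⌋ + C p i)) := by
      rw [Finset.prod_mul_distrib]
      linear_combination (-(ρ i r) *
        (∏ j, X j ^ (if j < i then (d i - r) * β j i else r * β j i))) * e2
    rw [e3]
    refine (AuxCg.refl hmemρ).mul (hX i) (AuxCg.mul (hX i) ?_ (AuxCg.refl (auxF_mem L _)))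
    refine AuxCg.prod (hX i) _ _ _ fun j _ => ?_
    refine AuxCg.mul (hX i) ?_ (AuxCg.refl (L.pow_mem (hX j) _))
    by_cases h : j < i
    · rw [if_pos h, if_pos h]
      by_cases hb : β j i = 0
      · rw [hb, mul_zero, pow_zero, pow_zero]
        exact AuxCg.refl L.one_mem
      · exact (hcong j h hb).pow (hX i) _
    · rw [if_neg h, if_neg h]
      exact AuxCg.refl L.one_mem
  obtain ⟨-, -, z, hz, e⟩ := key
  have hXi : X i ≠ 0 := aux_xv_ne _
  have hUinv : auxF m n (fun p => -(C p i + min (B p i) 0)) * U = 1 := by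
    rw [hU, ← auxF_add]
    simp only [neg_add_cancel]
    exact auxF_zero
  have h1 : M * y i = U * z' + z := by
    apply mul_left_cancel₀ hXi
    linear_combination e
  have h2 : z' = auxF m n (fun p => -(C p i + min (B p i) 0)) * (M * y i - z) := by
    rw [h1]
    linear_combination (-z') * hUinv
  rw [h2]
  exact L.mul_mem (auxF_mem L _) (L.sub_mem (L.mul_mem hMmem (hY i)) hz)

end GCA

open GCA in
/-- For an acyclic generalized seed ordered so that `b_{ij} ≥ 0` whenever
`i > j`, the algebra `ℤℙ[x₁, x'₁, …, x_n, x'_n]` generated by the initial cluster variables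
and the once-mutated cluster variables is a `ℤℙ`-subalgebra of the lower bound generalized
cluster algebra `ℒ^{(n)}(Σ) = ℤℙ[x₁, x₁^{(n)}, …, x_n, x_n^{(n)}]`. -/
theorem adjoin_exchange_le_lowerBound {m n : ℕ} (hn : 1 ≤ n) (hmn : n ≤ m)
    (d : Fin n → ℕ) (ρ : Fin n → ℕ → K m) (B : Matrix (Fin m) (Fin n) ℤ)
    (hseed : SeedHyps m n hmn d ρ B)
    (hacyc : Acyclic hmn B) (hord : Ordered hmn B) :
    Algebra.adjoin (↥(ZP m n))
        ({y | ∃ i : Fin n, y = xv m (Fin.castLE hmn i)} ∪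
          {y | ∃ i : Fin n, y = exchangeVar hmn d (initSeed m n ρ B) i}) ≤
      lowerBound hmn d (initSeed m n ρ B) := by
  apply Algebra.adjoin_le
  rintro y (⟨i, rfl⟩ | ⟨i, rfl⟩)
  · exact aux_x_mem hmn d ρ B i
  · exact aux_main hmn d ρ B hseed hord i
end
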